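/- Let M be a simple Harish-Chandra module over the N=1 Heisenberg–Virasoro algebra S. Then M is a highest weight module, a lowest weight module, or isomorphic to Γ'(λ,b,d) or Π(Γ'(λ,b,d)) for some λ,b,d ∈ ℂ, where Γ'(λ,b,d) denotes the unique nontrivial simple sub-quotient of Γ(λ,b,d). -/

import Mathlib

/-!
The `N = 1` Heisenberg–Virasoro algebra and its tensor modules `Γ(λ, b, d)`.
The underlying space of `Γ(λ, b, d) = A ⊗ ℂv` is realised as finitely supported
functions on `ℤ × Fin 2`, the pair `(m, r)` corresponding to `tᵐξ^r ⊗ v`.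
-/

noncomputable section

open Module

/-- Underlying space of `A = ℂ[t^{±1}] ⊗ Λ(ξ)` (and of `Γ(λ, b, d) = A ⊗ ℂv`). -/
abbrev HVCar : Type := (ℤ × Fin 2) →₀ ℂ

/-- Action of `L i` on `Γ(λ, b, d)`. -/
def hvL (lam b : ℂ) (i : ℤ) : End ℂ HVCar :=
  Finsupp.lsum ℂ fun p : ℤ × Fin 2 =>
    (lam + (p.1 : ℂ) + (i : ℂ) * b + (if p.2 = 1 then (i : ℂ) / 2 else 0)) •
      Finsupp.lsingle (p.1 + i, p.2)

/-- Action of `G i` on `Γ(λ, b, d)`. -/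
def hvG (lam b : ℂ) (i : ℤ) : End ℂ HVCar :=
  Finsupp.lsum ℂ fun p : ℤ × Fin 2 =>
    if p.2 = 0 then
      (lam + (p.1 : ℂ) + 2 * (i : ℂ) * b) • Finsupp.lsingle (p.1 + i, (1 : Fin 2))
    else - Finsupp.lsingle (p.1 + i, (0 : Fin 2))

/-- Action of `H i` on `Γ(λ, b, d)`. -/
def hvH (d : ℂ) (i : ℤ) : End ℂ HVCar :=
  Finsupp.lsum ℂ fun p : ℤ × Fin 2 => d • Finsupp.lsingle (p.1 + i, p.2)

/-- Action of `Q i` on `Γ(λ, b, d)`. -/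
def hvQ (d : ℂ) (i : ℤ) : End ℂ HVCar :=
  Finsupp.lsum ℂ fun p : ℤ × Fin 2 =>
    if p.2 = 0 then (-d) • Finsupp.lsingle (p.1 + i, (1 : Fin 2)) else 0

/-- The super grading on `Γ(λ, b, d)`: the parity of `tᵐξ^r ⊗ v` is `r`. -/
def hvGr (q : Fin 2) : Submodule ℂ HVCar :=
  Finsupp.supported ℂ ℂ {p : ℤ × Fin 2 | p.2 = q}

/-- The set of operators of `Γ(λ, b, d)`. -/
def hvOps (lam b d : ℂ) : Set (End ℂ HVCar) :=
  Set.range (hvL lam b) ∪ Set.range (hvG lam b)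
    ∪ Set.range (hvH d) ∪ Set.range (hvQ d)

/-- An endomorphism has parity `p` with respect to a `ℤ/2`-grading. -/
def MapsGr {M : Type} [AddCommGroup M] [Module ℂ M]
    (gr : Fin 2 → Submodule ℂ M) (p : Fin 2) (f : End ℂ M) : Prop :=
  ∀ q, (gr q).map f ≤ gr (q + p)

/-- A subspace is invariant under a set of operators. -/
def InvariantUnder {M : Type} [AddCommGroup M] [Module ℂ M]
    (S : Set (End ℂ M)) (N : Submodule ℂ M) : Prop :=
  ∀ f ∈ S, N.map f ≤ N

/-- A subspace is graded (homogeneous) with respect to the grading `gr`. -/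
def GradedSub {M : Type} [AddCommGroup M] [Module ℂ M]
    (gr : Fin 2 → Submodule ℂ M) (N : Submodule ℂ M) : Prop :=
  N ≤ (N ⊓ gr 0) ⊔ (N ⊓ gr 1)

/-- Simplicity: `M ≠ 0` and the only graded invariant subspaces are `0`, `M`. -/
def IsSimpleRep {M : Type} [AddCommGroup M] [Module ℂ M]
    (S : Set (End ℂ M)) (gr : Fin 2 → Submodule ℂ M) : Prop :=
  (∃ v : M, v ≠ 0) ∧
    ∀ N : Submodule ℂ M, InvariantUnder S N → GradedSub gr N → N = ⊥ ∨ N = ⊤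

/-- The operators `(L, H, G, Q, CL, CLa, Ca)` make `M` into a module over the
`N = 1` Heisenberg–Virasoro algebra `S`. -/
structure IsSRep {M : Type} [AddCommGroup M] [Module ℂ M]
    (L H G Q : ℤ → End ℂ M) (CL CLa Ca : End ℂ M) : Prop where
  comm_LL : ∀ i j : ℤ, L i * L j - L j * L i
      = ((j : ℂ) - (i : ℂ)) • L (i + j)
        + (if i + j = 0 then ((i : ℂ) ^ 3 - (i : ℂ)) / 12 else 0) • CL
  comm_LH : ∀ i j : ℤ, L i * H j - H j * L i
      = (j : ℂ) • H (i + j) + (if i + j = 0 then (i : ℂ) ^ 2 + (i : ℂ) else 0) • CLa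
  comm_LG : ∀ i j : ℤ, L i * G j - G j * L i = ((j : ℂ) - (i : ℂ) / 2) • G (i + j)
  comm_LQ : ∀ i j : ℤ, L i * Q j - Q j * L i = ((j : ℂ) + (i : ℂ) / 2) • Q (i + j)
  comm_HH : ∀ i j : ℤ, H i * H j - H j * H i
      = (if i + j = 0 then (i : ℂ) else 0) • Ca
  comm_GH : ∀ i j : ℤ, G i * H j - H j * G i = (-(j : ℂ)) • Q (i + j)
  comm_HQ : ∀ i j : ℤ, H i * Q j - Q j * H i = 0
  comm_GQ : ∀ i j : ℤ, G i * Q j + Q j * G i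
      = H (i + j) + (if i + j = 0 then 2 * (i : ℂ) - 1 else 0) • CLa
  comm_GG : ∀ i j : ℤ, G i * G j + G j * G i
      = (-2 : ℂ) • L (i + j)
        + (if i + j = 0 then (4 * (i : ℂ) ^ 2 - 1) / 12 else 0) • CL
  comm_QQ : ∀ i j : ℤ, Q i * Q j + Q j * Q i = (if i + j = 0 then (1 : ℂ) else 0) • Ca
  central_CL : (∀ i, CL * L i = L i * CL ∧ CL * H i = H i * CL ∧
      CL * G i = G i * CL ∧ CL * Q i = Q i * CL) ∧
      CL * CLa = CLa * CL ∧ CL * Ca = Ca * CL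
  central_CLa : (∀ i, CLa * L i = L i * CLa ∧ CLa * H i = H i * CLa ∧
      CLa * G i = G i * CLa ∧ CLa * Q i = Q i * CLa) ∧ CLa * Ca = Ca * CLa
  central_Ca : ∀ i, Ca * L i = L i * Ca ∧ Ca * H i = H i * Ca ∧
      Ca * G i = G i * Ca ∧ Ca * Q i = Q i * Ca

/-- Compatibility of an `S`-module structure with a super grading. -/
structure IsSSuper {M : Type} [AddCommGroup M] [Module ℂ M]
    (gr : Fin 2 → Submodule ℂ M)
    (L H G Q : ℤ → End ℂ M) (CL CLa Ca : End ℂ M) : Prop where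
  internal : DirectSum.IsInternal gr
  hL : ∀ i, MapsGr gr 0 (L i)
  hH : ∀ i, MapsGr gr 0 (H i)
  hG : ∀ i, MapsGr gr 1 (G i)
  hQ : ∀ i, MapsGr gr 1 (Q i)
  hCL : MapsGr gr 0 CL
  hCLa : MapsGr gr 0 CLa
  hCa : MapsGr gr 0 Ca

/-- The set of all operators of an `S`-module structure. -/
def sOps {M : Type} [AddCommGroup M] [Module ℂ M]
    (L H G Q : ℤ → End ℂ M) (CL CLa Ca : End ℂ M) : Set (End ℂ M) :=
  Set.range L ∪ Set.range H ∪ Set.range G ∪ Set.range Q ∪ {CL, CLa, Ca}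

/-- `M` is a weight module: `L₀` acts diagonalizably. -/
def IsWeightMod {M : Type} [AddCommGroup M] [Module ℂ M] (L0 : End ℂ M) : Prop :=
  ⨆ μ : ℂ, L0.eigenspace μ = ⊤

/-- `M` is a Harish-Chandra module. -/
def IsHarishChandra {M : Type} [AddCommGroup M] [Module ℂ M] (L0 : End ℂ M) : Prop :=
  IsWeightMod L0 ∧ ∀ μ : ℂ, FiniteDimensional ℂ (L0.eigenspace μ)

/-- `M` is a highest weight module over `S`. -/
def IsHighestWeightS {M : Type} [AddCommGroup M] [Module ℂ M]
    (L H G Q : ℤ → End ℂ M) (CL CLa Ca : End ℂ M) : Prop :=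
  ∃ v₀ : M, v₀ ≠ 0 ∧
    (∀ i : ℤ, 0 < i → L i v₀ = 0 ∧ H i v₀ = 0 ∧ G i v₀ = 0 ∧ Q i v₀ = 0) ∧
    (∃ c : ℂ, L 0 v₀ = c • v₀) ∧ (∃ c : ℂ, H 0 v₀ = c • v₀) ∧
    (∃ c : ℂ, CL v₀ = c • v₀) ∧ (∃ c : ℂ, CLa v₀ = c • v₀) ∧
    (∃ c : ℂ, Ca v₀ = c • v₀) ∧
    (∀ N : Submodule ℂ M, InvariantUnder (sOps L H G Q CL CLa Ca) N → v₀ ∈ N → N = ⊤)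

/-- `M` is a lowest weight module over `S`. -/
def IsLowestWeightS {M : Type} [AddCommGroup M] [Module ℂ M]
    (L H G Q : ℤ → End ℂ M) (CL CLa Ca : End ℂ M) : Prop :=
  ∃ v₀ : M, v₀ ≠ 0 ∧
    (∀ i : ℤ, i < 0 → L i v₀ = 0 ∧ H i v₀ = 0 ∧ G i v₀ = 0 ∧ Q i v₀ = 0) ∧
    (∃ c : ℂ, L 0 v₀ = c • v₀) ∧ (∃ c : ℂ, H 0 v₀ = c • v₀) ∧
    (∃ c : ℂ, CL v₀ = c • v₀) ∧ (∃ c : ℂ, CLa v₀ = c • v₀) ∧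
    (∃ c : ℂ, Ca v₀ = c • v₀) ∧
    (∀ N : Submodule ℂ M, InvariantUnder (sOps L H G Q CL CLa Ca) N → v₀ ∈ N → N = ⊤)

section
open Filter Topology

/-- An operator identity near `0` whose zeroth order terms cancel can be divided by `ε`. -/
lemma exists_analytic_quotient {R : Type*} [NormedRing R] [NormedAlgebra ℂ R]
    {Θ Φ Ψ : ℂ → R} {g κ : ℂ → ℂ} {c θ ψ γ : ℂ}
    (hΘ : AnalyticAt ℂ Θ 0) (hΦ : AnalyticAt ℂ Φ 0) (hΨ : AnalyticAt ℂ Ψ 0)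
    (hg : AnalyticAt ℂ g 0) (hκ : AnalyticAt ℂ κ 0)
    (hΘ0 : Θ 0 = 1) (hΦ0 : Φ 0 = c • 1) (hΨ0 : Ψ 0 = 1) (hg0 : g 0 = 1) (hκ0 : κ 0 = 0)
    (dΘ : HasDerivAt Θ (θ • 1) 0) (dΨ : HasDerivAt Ψ (ψ • 1) 0) (dg : HasDerivAt g γ 0)
    (dκ : HasDerivAt κ 1 0) :
    ∃ Φ' : ℂ → R, AnalyticAt ℂ Φ' 0 ∧ Φ' 0 = (c * (θ - γ - ψ)) • 1 ∧
      ∀ ε, Θ ε * Φ ε - g ε • (Φ (κ ε) * Ψ ε) = ε • Φ' ε := by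
  set F : ℂ → R := fun ε => Θ ε * Φ ε - g ε • (Φ (κ ε) * Ψ ε) with hF
  have hcomp : AnalyticAt ℂ (fun ε => Φ (κ ε)) 0 :=
    AnalyticAt.comp (g := Φ) (f := κ) (by rw [hκ0]; exact hΦ) hκ
  have hFa : AnalyticAt ℂ F 0 := (hΘ.mul hΦ).sub (hg.smul (hcomp.mul hΨ))
  have hF0 : F 0 = 0 := by simp [hF, hΘ0, hΦ0, hΨ0, hg0, hκ0]
  refine ⟨dslope F 0, ?_, ?_, ?_⟩
  · obtain ⟨p, hp⟩ := hFa
    exact ⟨_, hp.has_fpower_series_dslope_fslope⟩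
  · rw [dslope_same]
    have dΦ := hΦ.differentiableAt.hasDerivAt
    have dcomp : HasDerivAt (fun ε => Φ (κ ε)) ((1 : ℂ) • deriv Φ 0) 0 :=
      HasDerivAt.scomp (h := κ) 0 (by rw [hκ0]; exact dΦ) dκ
    have := ((dΘ.mul dΦ).sub (dg.smul (dcomp.mul dΨ))).deriv
    have h2 : deriv F 0 = _ := this
    rw [h2, Pi.mul_apply, hΘ0, hΦ0, hΨ0, hg0, hκ0, hΦ0]
    simp only [one_smul, smul_mul_assoc, mul_one, one_mul, smul_smul]
    module
  · intro ε
    have := sub_smul_dslope F 0 ε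
    rw [sub_zero, hF0, sub_zero] at this
    exact this.symm

/-- The analytic asymptotic expansion `B (j+1) y u ∼ jᵐ Φ(1/j) s_j` with leading term `c`. -/
def HasAsymp {V : Type*} [NormedAddCommGroup V] [NormedSpace ℂ V]
    (B : ℕ → ℂ → V →L[ℂ] V) (s : ℕ → V) (x : ℂ) (m : ℕ) (u : V) (c : ℂ) : Prop :=
  ∃ Φ : ℂ → V →L[ℂ] V, AnalyticAt ℂ Φ 0 ∧ Φ 0 = c • 1 ∧
    ∀ᶠ j : ℕ in atTop, B (j + 1) (x + m) u = (j : ℂ) ^ m • Φ ((j : ℂ)⁻¹) (s j)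

section
variable {V : Type*} [NormedAddCommGroup V] [NormedSpace ℂ V]
  {B : ℕ → ℂ → V →L[ℂ] V} {s : ℕ → V} {x : ℂ}

lemma tendsto_inv_natCast_zero : Tendsto (fun j : ℕ => ((j : ℂ)⁻¹)) atTop (𝓝 0) :=
  tendsto_inv_atTop_nhds_zero_nat (𝕜 := ℂ)

lemma HasAsymp.add {m : ℕ} {u u' : V} {c c' : ℂ} (h : HasAsymp B s x m u c)
    (h' : HasAsymp B s x m u' c') : HasAsymp B s x m (u + u') (c + c') := by
  obtain ⟨Φ, h1, h2, h3⟩ := h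
  obtain ⟨Φ', h1', h2', h3'⟩ := h'
  refine ⟨Φ + Φ', h1.add h1', by simp [h2, h2', add_smul], ?_⟩
  filter_upwards [h3, h3'] with j a b
  rw [map_add, a, b]
  simp

lemma HasAsymp.smul {m : ℕ} {u : V} {c : ℂ} (k : ℂ) (h : HasAsymp B s x m u c) :
    HasAsymp B s x m (k • u) (k * c) := by
  obtain ⟨Φ, h1, h2, h3⟩ := h
  refine ⟨fun ε => k • Φ ε, h1.const_smul (c := k), by simp [h2, mul_smul], ?_⟩
  filter_upwards [h3] with j a
  rw [map_smul, a]
  simp [smul_comm k]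

lemma HasAsymp.zero {m : ℕ} : HasAsymp B s x m 0 0 :=
  ⟨0, analyticAt_const, by simp, Eventually.of_forall fun j => by simp⟩

lemma HasAsymp.sub {m : ℕ} {u u' : V} {c c' : ℂ} (h : HasAsymp B s x m u c)
    (h' : HasAsymp B s x m u' c') : HasAsymp B s x m (u - u') (c - c') := by
  have := h.add (h'.smul (-1))
  simpa [sub_eq_add_neg] using this

lemma HasAsymp.coeff_eq_zero [CompleteSpace V] (hs : ∀ j ≥ 2, s j ≠ 0) {m : ℕ} {c : ℂ}
    (h : HasAsymp B s x m 0 c) : c = 0 := by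
  by_contra hc
  obtain ⟨Φ, h1, h2, h3⟩ := h
  have hu : IsUnit (Φ 0) := by
    rw [h2, ← Algebra.algebraMap_eq_smul_one]
    exact (IsUnit.mk0 c hc).map (algebraMap ℂ (V →L[ℂ] V))
  have hev : ∀ᶠ ε in 𝓝 (0 : ℂ), IsUnit (Φ ε) :=
    h1.continuousAt.eventually (Units.isOpen.mem_nhds hu)
  obtain ⟨j, hj1, hj2, hj3⟩ := ((tendsto_inv_natCast_zero.eventually hev).and
    (h3.and (eventually_ge_atTop 2))).exists
  have hj0 : (j : ℂ) ^ m ≠ 0 := pow_ne_zero _ (by norm_cast; omega)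
  rw [map_zero, eq_comm, smul_eq_zero] at hj2
  have := hj2.resolve_left hj0
  obtain ⟨w, hw⟩ := hj1
  refine hs j hj3 ?_
  have h5 : ((↑w⁻¹ : V →L[ℂ] V) * (w : V →L[ℂ] V)) (s j) = s j := by simp
  rw [← h5, mul_apply_eq_comp, hw, this, map_zero]

lemma HasAsymp.unique [CompleteSpace V] (hs : ∀ j ≥ 2, s j ≠ 0) {m : ℕ} {u : V} {c c' : ℂ}
    (h : HasAsymp B s x m u c) (h' : HasAsymp B s x m u c') : c = c' := by
  have := (h.sub h')
  rw [sub_self] at this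
  exact sub_eq_zero.mp (this.coeff_eq_zero hs)
end

/-- A family of operators `B a y` behaving like the operators `L_{a-1}` in weight `y`. -/
structure WittFamily {R : Type*} [Ring R] [Algebra ℂ R] (B : ℕ → ℂ → R) (Y Z : R) : Prop where
  zero : ∀ y, B 0 y = 1
  two : ∀ y, B 2 y = (y * (y + 1)) • 1 + Y
  three : ∀ y, B 3 y = (y * (y + 1) * (y + 2)) • 1 + (3 * y) • Y + Z
  rel : ∀ (a c : ℕ) (y : ℂ), 1 ≤ a + c →
    B a (y + c - 1) * B c y - B c (y + a - 1) * B a y = ((c : ℂ) - a) • B (a + c - 1) y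

section
variable {V : Type*} [NormedAddCommGroup V] [NormedSpace ℂ V]
  {B : ℕ → ℂ → V →L[ℂ] V} {Y Z : V →L[ℂ] V} {s : ℕ → V} {x : ℂ}

lemma WittFamily.step (hB : WittFamily B Y Z) (y : ℂ) (j : ℕ) (u : V) :
    B (j + 1) y u = B (j + 1) (y + 1) u - ((j : ℂ) + 1) • B j (y + 1) u := by
  have := hB.rel 0 (j + 1) (y + 1) (by omega)
  simp only [hB.zero, one_mul, mul_one] at this
  have h2 := congrArg (fun f => f u) this
  simp at h2
  rw [← h2]; abel

lemma WittFamily.raise_two (hB : WittFamily B Y Z) (y : ℂ) (j : ℕ) (u : V) :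
    B (j + 1) (y + 1) (B 2 y u) =
      B 2 (y + j) (B (j + 1) y u) - ((j : ℂ) - 1) • B (j + 2) y u := by
  have h2 := congrArg (fun f => f u) (hB.rel 2 (j + 1) y (by omega))
  have e1 : y + ((j + 1 : ℕ) : ℂ) - 1 = y + j := by push_cast; ring
  have e2 : y + ((2 : ℕ) : ℂ) - 1 = y + 1 := by push_cast; ring
  have e3 : 2 + (j + 1) - 1 = j + 2 := by omega
  have e4 : ((j + 1 : ℕ) : ℂ) - ((2 : ℕ) : ℂ) = (j : ℂ) - 1 := by push_cast; ring
  rw [e1, e2, e3, e4] at h2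
  simp at h2
  rw [← h2]; abel

lemma WittFamily.raise_three (hB : WittFamily B Y Z) (y : ℂ) (j : ℕ) (u : V) :
    B (j + 1) (y + 2) (B 3 y u) =
      B 3 (y + j) (B (j + 1) y u) - ((j : ℂ) - 2) • B (j + 3) y u := by
  have h2 := congrArg (fun f => f u) (hB.rel 3 (j + 1) y (by omega))
  have e1 : y + ((j + 1 : ℕ) : ℂ) - 1 = y + j := by push_cast; ring
  have e2 : y + ((3 : ℕ) : ℂ) - 1 = y + 2 := by push_cast; ring
  have e3 : 3 + (j + 1) - 1 = j + 3 := by omega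
  have e4 : ((j + 1 : ℕ) : ℂ) - ((3 : ℕ) : ℂ) = (j : ℂ) - 2 := by push_cast; ring
  rw [e1, e2, e3, e4] at h2
  simp at h2
  rw [← h2]; abel

/-- `ε² B₂(y + 1/ε)`. -/
def quadSymbol (Y : V →L[ℂ] V) (y ε : ℂ) : V →L[ℂ] V :=
  ((1 + y * ε) * (1 + (y + 1) * ε)) • 1 + (ε ^ 2) • Y

lemma quadSymbol_zero (y : ℂ) : quadSymbol Y y 0 = 1 := by simp [quadSymbol]

lemma analyticAt_quadSymbol (y : ℂ) : AnalyticAt ℂ (quadSymbol Y y) 0 := by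
  unfold quadSymbol; fun_prop

lemma hasDerivAt_quadSymbol (y : ℂ) :
    HasDerivAt (quadSymbol Y y) ((2 * y + 1) • (1 : V →L[ℂ] V)) 0 := by
  unfold quadSymbol
  have h1 : HasDerivAt (fun ε : ℂ => (1 + y * ε) * (1 + (y + 1) * ε)) (2 * y + 1) 0 := by
    have := (((hasDerivAt_id (0 : ℂ)).const_mul y).const_add 1).mul
      (((hasDerivAt_id (0 : ℂ)).const_mul (y + 1)).const_add 1)
    refine this.congr_deriv ?_
    simp; ring
  have h2 : HasDerivAt (fun ε : ℂ => ε ^ 2) 0 0 := by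
    simpa using hasDerivAt_pow 2 (0 : ℂ)
  have := (h1.smul_const (1 : V →L[ℂ] V)).add (h2.smul_const Y)
  refine this.congr_deriv ?_
  simp

lemma WittFamily.two_eq (hB : WittFamily B Y Z) (y : ℂ) {j : ℂ} (hj : j ≠ 0) :
    B 2 (y + j) = j ^ 2 • quadSymbol Y y j⁻¹ := by
  rw [hB.two, quadSymbol, smul_add, smul_smul, smul_smul]
  have h1 : (y + j) * (y + j + 1) = j ^ 2 * ((1 + y * j⁻¹) * (1 + (y + 1) * j⁻¹)) := by
    field_simp; ring
  have h2 : j ^ 2 * j⁻¹ ^ 2 = 1 := by field_simp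
  rw [h1, h2, one_smul]

/-- `ε³ B₃(y + 1/ε)`. -/
def cubeSymbol (Y Z : V →L[ℂ] V) (y ε : ℂ) : V →L[ℂ] V :=
  ((1 + y * ε) * (1 + (y + 1) * ε) * (1 + (y + 2) * ε)) • 1 + (3 * ε ^ 2 * (1 + y * ε)) • Y
    + (ε ^ 3) • Z

lemma cubeSymbol_zero (y : ℂ) : cubeSymbol Y Z y 0 = 1 := by simp [cubeSymbol]

lemma analyticAt_cubeSymbol (y : ℂ) : AnalyticAt ℂ (cubeSymbol Y Z y) 0 := by
  unfold cubeSymbol; fun_prop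

lemma hasDerivAt_cubeSymbol (y : ℂ) :
    HasDerivAt (cubeSymbol Y Z y) ((3 * y + 3) • (1 : V →L[ℂ] V)) 0 := by
  unfold cubeSymbol
  have h1 : HasDerivAt (fun ε : ℂ => (1 + y * ε) * (1 + (y + 1) * ε) * (1 + (y + 2) * ε))
      (3 * y + 3) 0 := by
    have := ((((hasDerivAt_id (0 : ℂ)).const_mul y).const_add 1).mul
      (((hasDerivAt_id (0 : ℂ)).const_mul (y + 1)).const_add 1)).mul
      (((hasDerivAt_id (0 : ℂ)).const_mul (y + 2)).const_add 1)
    refine this.congr_deriv ?_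
    simp; ring
  have h2 : HasDerivAt (fun ε : ℂ => 3 * ε ^ 2 * (1 + y * ε)) 0 0 := by
    have := ((hasDerivAt_pow 2 (0 : ℂ)).const_mul 3).mul
      (((hasDerivAt_id (0 : ℂ)).const_mul y).const_add 1)
    refine this.congr_deriv ?_
    simp
  have h3 : HasDerivAt (fun ε : ℂ => ε ^ 3) 0 0 := by
    simpa using hasDerivAt_pow 3 (0 : ℂ)
  have := ((h1.smul_const (1 : V →L[ℂ] V)).add (h2.smul_const Y)).add (h3.smul_const Z)
  refine this.congr_deriv ?_
  simp

lemma WittFamily.three_eq (hB : WittFamily B Y Z) (y : ℂ) {j : ℂ} (hj : j ≠ 0) :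
    B 3 (y + j) = j ^ 3 • cubeSymbol Y Z y j⁻¹ := by
  rw [hB.three, cubeSymbol, smul_add, smul_add, smul_smul, smul_smul, smul_smul]
  have h1 : (y + j) * (y + j + 1) * (y + j + 2) =
      j ^ 3 * ((1 + y * j⁻¹) * (1 + (y + 1) * j⁻¹) * (1 + (y + 2) * j⁻¹)) := by
    field_simp; ring
  have h2 : j ^ 3 * j⁻¹ ^ 3 = 1 := by field_simp
  have h3 : j ^ 3 * (3 * j⁻¹ ^ 2 * (1 + y * j⁻¹)) = 3 * (y + j) := by field_simp; ring
  rw [h1, h2, h3, one_smul]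

lemma analyticAt_mobius (k : ℂ) : AnalyticAt ℂ (fun ε : ℂ => ε / (1 + k * ε)) 0 := by
  refine AnalyticAt.div (by fun_prop) (by fun_prop) (by simp)

lemma hasDerivAt_mobius (k : ℂ) : HasDerivAt (fun ε : ℂ => ε / (1 + k * ε)) 1 0 := by
  have := (hasDerivAt_id (0 : ℂ)).div (((hasDerivAt_id (0 : ℂ)).const_mul k).const_add 1)
    (by simp)
  refine this.congr_deriv ?_
  simp

lemma tendsto_shift {p : ℕ → Prop} (k : ℕ) (h : ∀ᶠ j in atTop, p j) :
    ∀ᶠ j in atTop, p (j + k) := (tendsto_add_atTop_nat k).eventually h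

lemma HasAsymp.raise_two [CompleteSpace V] (hB : WittFamily B Y Z)
    (hs : ∀ j : ℕ, ((j : ℂ) - 1) • s (j + 1) = B 2 (x + j) (s j)) {m : ℕ} {u : V} {c : ℂ}
    (h : HasAsymp B s x m u c) : HasAsymp B s x (m + 1) (B 2 (x + m) u) (m * c) := by
  obtain ⟨Φ, h1, h2, h3⟩ := h
  have dg : HasDerivAt (fun ε : ℂ => (1 + ε) ^ m) (m : ℂ) 0 := by
    have := ((hasDerivAt_id (0 : ℂ)).const_add 1).pow m
    refine this.congr_deriv ?_
    simp
  obtain ⟨Φ', a1, a2, a3⟩ := exists_analytic_quotient (Θ := quadSymbol Y (x + m)) (Φ := Φ)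
    (Ψ := quadSymbol Y x) (g := fun ε => (1 + ε) ^ m) (κ := fun ε => ε / (1 + 1 * ε))
    (analyticAt_quadSymbol _) h1 (analyticAt_quadSymbol _) (by fun_prop) (analyticAt_mobius 1)
    (quadSymbol_zero _) h2 (quadSymbol_zero _) (by simp) (by simp)
    (hasDerivAt_quadSymbol _) (hasDerivAt_quadSymbol _) dg (hasDerivAt_mobius 1)
  refine ⟨Φ', a1, ?_, ?_⟩
  · rw [a2]; congr 1; ring
  · filter_upwards [h3, tendsto_shift 1 h3, eventually_ge_atTop 2] with j b1 b2 b3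
    have hj0 : (j : ℂ) ≠ 0 := by norm_cast; omega
    have hj1 : (j : ℂ) + 1 ≠ 0 := by norm_cast
    have e : x + ((m + 1 : ℕ) : ℂ) = x + m + 1 := by push_cast; ring
    rw [e, hB.raise_two, b1, hB.two_eq _ hj0, b2]
    have h4 := congrArg (fun f => (j : ℂ) ^ (m + 2) • f (s j)) (a3 (j : ℂ)⁻¹)
    have e2 : (j : ℂ)⁻¹ / (1 + 1 * (j : ℂ)⁻¹) = ((j + 1 : ℕ) : ℂ)⁻¹ := by
      push_cast; field_simp
    rw [e2] at h4
    have e5 : ((j : ℂ) - 1) • ((j + 1 : ℕ) : ℂ) ^ m • Φ ((j + 1 : ℕ) : ℂ)⁻¹ (s (j + 1)) =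
       ((j : ℂ) + 1) ^ m • Φ ((j + 1 : ℕ) : ℂ)⁻¹ (((j : ℂ) ^ 2) • quadSymbol Y x (j : ℂ)⁻¹ (s j)) := by
      have := hs j
      rw [hB.two_eq x hj0, smul_apply] at this
      rw [← this, map_smul, smul_comm]; push_cast; rfl
    rw [e5]
    simp only [sub_apply, smul_apply, mul_apply_eq_comp,
      map_smul, smul_sub, smul_smul] at h4 ⊢
    convert h4 using 2
    · ring_nf
    · congr 1
      have e9 : 1 + (j : ℂ)⁻¹ = (j + 1) / j := by field_simp
      rw [e9, div_pow]
      field_simp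
      ring
    · field_simp
      ring

lemma HasAsymp.raise_three [CompleteSpace V] (hB : WittFamily B Y Z)
    (hs : ∀ j : ℕ, ((j : ℂ) - 1) • s (j + 1) = B 2 (x + j) (s j)) {m : ℕ} {u : V} {c : ℂ}
    (h : HasAsymp B s x m u c) : HasAsymp B s x (m + 2) (B 3 (x + m) u) ((m - x) * c) := by
  obtain ⟨Φ, h1, h2, h3⟩ := h
  have dg : HasDerivAt (fun ε : ℂ => (1 - 2 * ε) / (1 + (-1) * ε) * (1 + 2 * ε) ^ m)
      (2 * m - 1 : ℂ) 0 := by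
    have := ((((hasDerivAt_id (0 : ℂ)).const_mul 2).const_sub 1).div
      (((hasDerivAt_id (0 : ℂ)).const_mul (-1)).const_add 1) (by simp)).mul
      ((((hasDerivAt_id (0 : ℂ)).const_mul 2).const_add 1).pow m)
    refine this.congr_deriv ?_
    simp; ring
  have ag : AnalyticAt ℂ (fun ε : ℂ => (1 - 2 * ε) / (1 + (-1) * ε) * (1 + 2 * ε) ^ m) 0 :=
    (AnalyticAt.div (by fun_prop) (by fun_prop) (by simp)).mul (by fun_prop)
  have dΨ : HasDerivAt (fun ε => quadSymbol Y (x + 1) ε * quadSymbol Y x ε)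
      ((4 * x + 4) • (1 : V →L[ℂ] V)) 0 := by
    have := (hasDerivAt_quadSymbol (Y := Y) (x + 1)).mul (hasDerivAt_quadSymbol (Y := Y) x)
    refine this.congr_deriv ?_
    rw [quadSymbol_zero, quadSymbol_zero, mul_one, one_mul, ← add_smul]
    congr 1; ring
  obtain ⟨Φ', a1, a2, a3⟩ := exists_analytic_quotient (Θ := cubeSymbol Y Z (x + m)) (Φ := Φ)
    (Ψ := fun ε => quadSymbol Y (x + 1) ε * quadSymbol Y x ε)
    (g := fun ε : ℂ => (1 - 2 * ε) / (1 + (-1) * ε) * (1 + 2 * ε) ^ m)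
    (κ := fun ε => ε / (1 + 2 * ε))
    (analyticAt_cubeSymbol _) h1 ((analyticAt_quadSymbol _).mul (analyticAt_quadSymbol _))
    ag (analyticAt_mobius 2)
    (cubeSymbol_zero _) h2 (by simp [quadSymbol_zero]) (by simp) (by simp)
    (hasDerivAt_cubeSymbol _) dΨ dg (hasDerivAt_mobius 2)
  refine ⟨Φ', a1, ?_, ?_⟩
  · rw [a2]; congr 1; ring
  · filter_upwards [h3, tendsto_shift 2 h3, eventually_ge_atTop 3] with j b1 b2 b3
    have hj0 : (j : ℂ) ≠ 0 := by norm_cast; omega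
    have hj2 : (j : ℂ) + 2 ≠ 0 := by norm_cast
    have hj1 : (j : ℂ) - 1 ≠ 0 := by
      rw [sub_ne_zero]; norm_cast; omega
    have e : x + ((m + 2 : ℕ) : ℂ) = x + m + 2 := by push_cast; ring
    rw [e, hB.raise_three, b1, hB.three_eq _ hj0, b2]
    have h4 := congrArg (fun f => (j : ℂ) ^ (m + 3) • f (s j)) (a3 (j : ℂ)⁻¹)
    have e2 : (j : ℂ)⁻¹ / (1 + 2 * (j : ℂ)⁻¹) = ((j + 2 : ℕ) : ℂ)⁻¹ := by
      push_cast; field_simp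
    rw [e2] at h4
    have e6 : s (j + 2) = ((j : ℂ) ^ 3 / ((j : ℂ) - 1)) •
        quadSymbol Y (x + 1) (j : ℂ)⁻¹ (quadSymbol Y x (j : ℂ)⁻¹ (s j)) := by
      have t1 := hs j
      have t2 := hs (j + 1)
      have e7 : x + ((j + 1 : ℕ) : ℂ) = x + 1 + j := by push_cast; ring
      have e8 : ((j + 1 : ℕ) : ℂ) - 1 = j := by push_cast; ring
      rw [hB.two_eq x hj0, smul_apply] at t1
      rw [e7, e8, hB.two_eq (x + 1) hj0, smul_apply] at t2
      have t3 : s (j + 1) = ((j : ℂ) - 1)⁻¹ • (j : ℂ) ^ 2 • quadSymbol Y x (j : ℂ)⁻¹ (s j) := by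
        rw [← t1, smul_smul, inv_mul_cancel₀ hj1, one_smul]
      have t4 : s (j + 2) = (j : ℂ)⁻¹ • (j : ℂ) • s (j + 1 + 1) := by
        rw [smul_smul, inv_mul_cancel₀ hj0, one_smul]
      rw [t4, t2, t3]
      simp only [map_smul, smul_smul]
      congr 1
      field_simp
    rw [e6]
    simp only [sub_apply, smul_apply, mul_apply_eq_comp,
      map_smul, smul_sub, smul_smul] at h4 ⊢
    have hj3 : 1 - (j : ℂ)⁻¹ ≠ 0 := by
      intro h; apply hj1; field_simp at h; simpa using h
    convert h4 using 2
    · ring_nf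
    · congr 1
      have : 1 + -1 * (j : ℂ)⁻¹ = (j - 1) / j := by field_simp; ring
      have e9 : 1 + 2 * (j : ℂ)⁻¹ = (j + 2) / j := by field_simp
      rw [this, e9, div_pow]
      push_cast
      field_simp
      ring
    · field_simp
      ring

lemma HasAsymp.lower [CompleteSpace V] (hB : WittFamily B Y Z)
    (hs : ∀ j : ℕ, ((j : ℂ) - 1) • s (j + 1) = B 2 (x + j) (s j)) {m : ℕ} {u : V} {c : ℂ}
    (h : HasAsymp B s x (m + 1) u c) : HasAsymp B s x m u ((2 * x + m + 1) * c) := by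
  obtain ⟨Φ, h1, h2, h3⟩ := h
  have dg : HasDerivAt (fun ε : ℂ => (1 - 2 * ε) * (1 + ε) * (1 - ε) ^ (m + 1))
      (-(m : ℂ) - 2) 0 := by
    have := ((((hasDerivAt_id (0 : ℂ)).const_mul 2).const_sub 1).mul
      ((hasDerivAt_id (0 : ℂ)).const_add 1)).mul
      (((hasDerivAt_id (0 : ℂ)).const_sub 1).pow (m + 1))
    refine this.congr_deriv ?_
    simp; ring
  have aΨ : AnalyticAt ℂ (fun ε => Ring.inverse (quadSymbol Y (x - 1) ε)) 0 := by
    refine AnalyticAt.comp (g := Ring.inverse) ?_ (analyticAt_quadSymbol _)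
    rw [quadSymbol_zero]
    exact analyticAt_inverse (𝕜 := ℂ) (1 : (V →L[ℂ] V)ˣ)
  have dΨ : HasDerivAt (fun ε => Ring.inverse (quadSymbol Y (x - 1) ε))
      ((1 - 2 * x) • (1 : V →L[ℂ] V)) 0 := by
    have := HasFDerivAt.comp_hasDerivAt (0 : ℂ) (f := quadSymbol Y (x - 1))
      (by rw [quadSymbol_zero]; exact hasFDerivAt_ringInverse (𝕜 := ℂ) (1 : (V →L[ℂ] V)ˣ))
      (hasDerivAt_quadSymbol _)
    refine this.congr_deriv ?_
    simp
    module
  obtain ⟨Φ', a1, a2, a3⟩ := exists_analytic_quotient (Θ := fun _ => 1) (Φ := Φ)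
    (Ψ := fun ε => Ring.inverse (quadSymbol Y (x - 1) ε))
    (g := fun ε : ℂ => (1 - 2 * ε) * (1 + ε) * (1 - ε) ^ (m + 1))
    (κ := fun ε => ε / (1 + (-1) * ε)) (θ := 0)
    analyticAt_const h1 aΨ (by fun_prop) (analyticAt_mobius (-1))
    rfl h2 (by simp [quadSymbol_zero]) (by simp) (by simp)
    (by rw [zero_smul]; exact hasDerivAt_const _ _) dΨ dg (hasDerivAt_mobius (-1))
  have hinv : ∀ᶠ ε in 𝓝 (0 : ℂ), IsUnit (quadSymbol Y (x - 1) ε) :=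
    (analyticAt_quadSymbol (Y := Y) (x - 1)).continuousAt.eventually
      (Units.isOpen.mem_nhds (by rw [quadSymbol_zero]; exact isUnit_one))
  refine ⟨Φ', a1, ?_, ?_⟩
  · rw [a2]; congr 1; ring
  · have hsh : ∀ᶠ j : ℕ in atTop, B (j - 1 + 1) (x + (m + 1 : ℕ)) u
        = ((j - 1 : ℕ) : ℂ) ^ (m + 1) • Φ (((j - 1 : ℕ) : ℂ)⁻¹) (s (j - 1)) :=
      (tendsto_sub_atTop_nat 1).eventually h3
    filter_upwards [h3, hsh, eventually_ge_atTop 3,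
      tendsto_inv_natCast_zero.eventually hinv] with j b1 b2 b3 b4
    have hj0 : (j : ℂ) ≠ 0 := by norm_cast; omega
    have hj1 : (j : ℂ) - 1 ≠ 0 := by
      rw [sub_ne_zero]; norm_cast; omega
    have hj2 : ((j - 1 : ℕ) : ℂ) = (j : ℂ) - 1 := by
      rw [Nat.cast_sub (by omega)]; simp
    have e : x + ((m + 1 : ℕ) : ℂ) = x + m + 1 := by push_cast; ring
    rw [Nat.sub_add_cancel (by omega), hj2] at b2
    rw [hB.step, ← e, b1, b2]
    have h4 := congrArg (fun f => (j : ℂ) ^ (m + 1) • f (s j)) (a3 (j : ℂ)⁻¹)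
    have e2 : (j : ℂ)⁻¹ / (1 + (-1) * (j : ℂ)⁻¹) = ((j : ℂ) - 1)⁻¹ := by
      have : 1 + -1 * (j : ℂ)⁻¹ = (j - 1) / j := by field_simp; ring
      rw [this]; field_simp
    rw [e2] at h4
    have e6 : s (j - 1) = (((j : ℂ) - 2) / (j : ℂ) ^ 2) •
        Ring.inverse (quadSymbol Y (x - 1) (j : ℂ)⁻¹) (s j) := by
      have t1 := hs (j - 1)
      rw [Nat.sub_add_cancel (by omega), hj2] at t1
      have e7 : x + ((j : ℂ) - 1) = x - 1 + j := by ring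
      rw [e7, hB.two_eq (x - 1) hj0, smul_apply] at t1
      have t2 := congrArg (fun w => (Ring.inverse (quadSymbol Y (x - 1) (j : ℂ)⁻¹) : V →L[ℂ] V) w) t1
      have t3 := congrArg (fun f => f (s (j - 1))) (Ring.inverse_mul_cancel _ b4)
      simp only [mul_apply_eq_comp, one_apply_eq_self] at t3
      simp only [map_smul] at t2
      rw [t3] at t2
      rw [div_eq_inv_mul, mul_smul]
      have e8 : (j : ℂ) - 2 = j - 1 - 1 := by ring
      rw [e8, t2, smul_smul, inv_mul_cancel₀ (pow_ne_zero 2 hj0), one_smul]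
    rw [e6]
    simp only [sub_apply, smul_apply, mul_apply_eq_comp,
      one_apply_eq_self, map_smul, smul_sub, smul_smul] at h4 ⊢
    convert h4 using 2
    · congr 1
      have e9 : 1 - (j : ℂ)⁻¹ = (j - 1) / j := by field_simp
      rw [e9, div_pow]
      field_simp
    · field_simp
      ring
end

section
variable {V : Type*} [NormedAddCommGroup V] [NormedSpace ℂ V] [FiniteDimensional ℂ V]
  {B : ℕ → ℂ → V →L[ℂ] V} {Y Z : V →L[ℂ] V} {s : ℕ → V} {x : ℂ}

/-- The zeros of `det B₂` are finite in number, so one of them can be chosen extremal. -/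
lemma WittFamily.exists_extremal_zero [Nontrivial V] (hB : WittFamily B Y Z) :
    ∃ x : ℂ, x ≠ 0 ∧ (∃ v ≠ 0, B 2 x v = 0) ∧
      ∀ l : ℕ, 2 ≤ l → ∀ v, B 2 (x + l) v = 0 → v = 0 := by
  set Λ : Set ℂ := {x | ∃ v ≠ 0, B 2 x v = 0} with hΛ
  have hmem : ∀ x, x ∈ Λ ↔ Module.End.HasEigenvalue (Y : V →ₗ[ℂ] V) (-(x * (x + 1))) := by
    intro x
    constructor
    · rintro ⟨v, hv, h⟩
      refine Module.End.hasEigenvalue_of_hasEigenvector (x := v) ⟨?_, hv⟩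
      rw [Module.End.mem_eigenspace_iff]
      rw [hB.two] at h
      simp at h
      rw [neg_smul]; exact eq_neg_of_add_eq_zero_right h
    · intro h
      obtain ⟨v, hv⟩ := h.exists_hasEigenvector
      refine ⟨v, hv.2, ?_⟩
      have := hv.apply_eq_smul
      rw [hB.two]
      simp only [ContinuousLinearMap.coe_coe] at this
      simp [this]
  have hfin : Λ.Finite := by
    have h1 := (Module.End.finite_hasEigenvalue (Y : V →ₗ[ℂ] V))
    have h2 : Λ ⊆ ⋃ μ ∈ {μ | Module.End.HasEigenvalue (Y : V →ₗ[ℂ] V) μ}, {x : ℂ | x ^ 2 + x + μ = 0} := by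
      intro x hx
      refine Set.mem_biUnion ((hmem x).1 hx) ?_
      simp only [Set.mem_ofPred_eq]; ring
    refine (h1.biUnion fun μ _ => ?_).subset h2
    have h3 : (Polynomial.X ^ 2 + Polynomial.X + Polynomial.C μ : Polynomial ℂ) ≠ 0 := by
      intro h
      have := congrArg (fun p => Polynomial.coeff p 2) h
      simp [Polynomial.coeff_X] at this
    refine (Polynomial.finite_setOfPred_isRoot h3).subset ?_
    intro x hx
    simpa using hx
  have hne : Λ.Nonempty := by
    obtain ⟨μ, hμ⟩ := Module.End.exists_eigenvalue (Y : V →ₗ[ℂ] V)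
    obtain ⟨z, hz⟩ := IsSepClosed.exists_pow_nat_eq (1 / 4 - μ) 2
    refine ⟨z - 1 / 2, (hmem _).2 ?_⟩
    have e : -((z - 1 / 2) * (z - 1 / 2 + 1)) = μ := by linear_combination -hz
    rwa [e]
  obtain ⟨x, hx, hmax⟩ := hfin.exists_maximalFor Complex.re _ hne
  have hmax' : ∀ z ∈ Λ, z.re ≤ x.re := fun z hz => by
    by_contra h
    exact h (hmax hz (le_of_lt (not_le.1 h)))
  have key : ∀ x' : ℂ, x' ∈ Λ → x.re < x'.re + 2 →
      ∀ l : ℕ, 2 ≤ l → ∀ v, B 2 (x' + l) v = 0 → v = 0 := by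
    intro x' _ h l hl v hv
    by_contra hv0
    have := hmax' (x' + l) ⟨v, hv0, hv⟩
    have h2 : (2 : ℝ) ≤ l := by exact_mod_cast hl
    simp at this
    linarith
  by_cases h0 : x = 0
  · have h1 : (-1 : ℂ) ∈ Λ := by
      rw [hmem]; rw [hmem, h0] at hx
      simpa using hx
    exact ⟨-1, by norm_num, h1, key _ h1 (by simp [h0])⟩
  · exact ⟨x, h0, hx, key _ hx (by linarith)⟩

omit [FiniteDimensional ℂ V] in
lemma WittFamily.eigen_of_eq (hB : WittFamily B Y Z) {y b : ℂ} {v : V}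
    (h2 : B 2 y v = ((y + b) * (y + 1 - b)) • v)
    (h3 : B 3 y v = ((y + 2 * b) * (y + 1 - b) * (y + 2 - b)) • v) :
    Y v = (b * (1 - b)) • v ∧ Z v = (2 * b * (1 - b) * (2 - b)) • v := by
  rw [hB.two] at h2
  rw [hB.three] at h3
  simp only [add_apply, smul_apply, one_apply_eq_self] at h2 h3
  have e1 : Y v = (b * (1 - b)) • v := by
    rw [eq_comm, ← sub_eq_iff_eq_add'] at h2
    rw [← h2, ← sub_smul]; congr 1; ring
  refine ⟨e1, ?_⟩
  rw [e1, eq_comm, ← sub_eq_iff_eq_add'] at h3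
  rw [← h3, smul_smul, ← add_smul, ← sub_smul]
  congr 1; ring

/-- The vectors with an asymptotic expansion of order `m`. -/
def asympSubmodule (B : ℕ → ℂ → V →L[ℂ] V) (s : ℕ → V) (x : ℂ) (m : ℕ) : Submodule ℂ V where
  carrier := {u | ∃ c, HasAsymp B s x m u c}
  add_mem' := fun ⟨_, h⟩ ⟨_, h'⟩ => ⟨_, h.add h'⟩
  zero_mem' := ⟨0, HasAsymp.zero⟩
  smul_mem' := fun k _ ⟨_, h⟩ => ⟨_, h.smul k⟩

/-- The vectors whose leading asymptotic coefficient of order `m` vanishes. -/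
def asympKer (B : ℕ → ℂ → V →L[ℂ] V) (s : ℕ → V) (x : ℂ) (m : ℕ) : Submodule ℂ V where
  carrier := {u | HasAsymp B s x m u 0}
  add_mem' := fun h h' => by simpa using HasAsymp.add h h'
  zero_mem' := HasAsymp.zero
  smul_mem' := fun k _ h => by simpa using HasAsymp.smul k h

/-- The operators `Y` and `Z` have a common eigenvector of tensor density type, or the
representation is reducible. -/
theorem WittFamily.eigenvector_or_reducible [Nontrivial V] (hB : WittFamily B Y Z) :
    (∃ v ≠ 0, ∃ b : ℂ, Y v = (b * (1 - b)) • v ∧ Z v = (2 * b * (1 - b) * (2 - b)) • v) ∨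
    ∃ N : Submodule ℂ V, N ≠ ⊥ ∧ N ≠ ⊤ ∧ (∀ u ∈ N, Y u ∈ N) ∧ (∀ u ∈ N, Z u ∈ N) := by
  have : CompleteSpace V := FiniteDimensional.complete ℂ V
  obtain ⟨x, hx0, ⟨v, hv0, hv⟩, hinj⟩ := hB.exists_extremal_zero
  by_cases hw : B 3 x v = 0
  · exact Or.inl ⟨v, hv0, x + 1, hB.eigen_of_eq (y := x) (by rw [hv]; simp) (by rw [hw]; simp)⟩
  set s : ℕ → V := fun j => B (j + 1) x v with hs_def
  have hs : ∀ j : ℕ, ((j : ℂ) - 1) • s (j + 1) = B 2 (x + j) (s j) := by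
    intro j
    have := hB.raise_two x j v
    rw [hv, map_zero] at this
    exact (sub_eq_zero.1 this.symm).symm
  have hsne : ∀ j ≥ 2, s j ≠ 0 := by
    intro j hj
    induction j, hj using Nat.le_induction with
    | base => exact hw
    | succ j hj ih =>
      intro h
      have h1 := hs j
      rw [h, smul_zero] at h1
      exact ih (hinj j hj _ h1.symm)
  have hbase : HasAsymp B s x 0 v 1 :=
    ⟨fun _ => 1, analyticAt_const, by simp, Eventually.of_forall fun j => by simp [hs_def]⟩
  have hsm : ∀ m ≥ 2, ∃ c ≠ 0, HasAsymp B s x m (s m) c := by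
    intro m hm
    induction m, hm using Nat.le_induction with
    | base =>
      refine ⟨-x, neg_ne_zero.2 hx0, ?_⟩
      simpa [hs_def] using hbase.raise_three hB hs
    | succ m hm ih =>
      obtain ⟨c, hc, h⟩ := ih
      have h1 := h.raise_two hB hs
      have hm1 : (m : ℂ) - 1 ≠ 0 := by rw [sub_ne_zero]; norm_cast; omega
      rw [← hs m] at h1
      have h2 := h1.smul ((m : ℂ) - 1)⁻¹
      rw [smul_smul, inv_mul_cancel₀ hm1, one_smul] at h2
      refine ⟨_, ?_, h2⟩
      have : (m : ℂ) ≠ 0 := by norm_cast; omega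
      simp [hm1, this, hc]
  have hanti : Antitone (asympSubmodule B s x) :=
    antitone_nat_of_succ_le fun m u ⟨c, hc⟩ => ⟨_, hc.lower hB hs⟩
  obtain ⟨m₀, hm₀⟩ := IsArtinian.monotone_stabilizes
    (⟨fun m => OrderDual.toDual (asympSubmodule B s x m), fun a b h => hanti h⟩ :
      ℕ →o (Submodule ℂ V)ᵒᵈ)
  have hU : ∀ m ≥ m₀, asympSubmodule B s x m = asympSubmodule B s x m₀ := fun m hm =>
    (OrderDual.toDual_inj.1 (hm₀ m hm)).symm
  set U := asympSubmodule B s x m₀ with hUdef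
  have of2 : ∀ (N : Submodule ℂ V) (y : ℂ), ∀ u ∈ N, B 2 y u ∈ N → Y u ∈ N := by
    intro N y u hu h
    rw [hB.two] at h
    exact (N.add_mem_iff_right (N.smul_mem _ hu)).1 h
  have of3 : ∀ (N : Submodule ℂ V) (y : ℂ), ∀ u ∈ N, Y u ∈ N → B 3 y u ∈ N → Z u ∈ N := by
    intro N y u hu hY h
    rw [hB.three] at h
    exact (N.add_mem_iff_right (N.add_mem (N.smul_mem _ hu) (N.smul_mem _ hY))).1 h
  have hUY : ∀ u ∈ U, Y u ∈ U := fun u hu => by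
    obtain ⟨c, hc⟩ := hu
    refine of2 U (x + m₀) u ⟨c, hc⟩ ?_
    rw [← hU (m₀ + 1) (by omega)]
    exact ⟨_, hc.raise_two hB hs⟩
  have hUZ : ∀ u ∈ U, Z u ∈ U := fun u hu => by
    have hY := hUY u hu
    obtain ⟨c, hc⟩ := hu
    refine of3 U (x + m₀) u ⟨c, hc⟩ hY ?_
    rw [← hU (m₀ + 2) (by omega)]
    exact ⟨_, hc.raise_three hB hs⟩
  have hsU : s (m₀ + 2) ∈ U := by
    obtain ⟨c, _, h⟩ := hsm (m₀ + 2) (by omega)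
    rw [← hU (m₀ + 2) (by omega)]; exact ⟨c, h⟩
  by_cases hUtop : U = ⊤
  swap
  · refine Or.inr ⟨U, ?_, hUtop, hUY, hUZ⟩
    intro h
    rw [h, Submodule.mem_bot] at hsU
    exact hsne _ (by omega) hsU
  -- every vector has an expansion of every large order
  obtain ⟨m₁, h1m, hm₁⟩ : ∃ m₁ ≥ m₀ + 2, ∀ m : ℕ, m₁ ≤ m → 2 * x + m + 1 ≠ 0 := by
    obtain ⟨n, hn⟩ := exists_nat_gt ‖2 * x + 1‖
    refine ⟨max n (m₀ + 2), le_max_right _ _, fun m hm h => ?_⟩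
    have h3 : (m : ℂ) = -(2 * x + 1) := by linear_combination h
    have h4 : ‖(m : ℂ)‖ = ‖2 * x + 1‖ := by rw [h3, norm_neg]
    rw [Complex.norm_natCast] at h4
    have h5 : (n : ℝ) ≤ m := by exact_mod_cast (le_max_left _ _).trans hm
    linarith
  have hall : ∀ m ≥ m₀, ∀ u, ∃ c, HasAsymp B s x m u c := fun m hm u => by
    have : u ∈ asympSubmodule B s x m := by rw [hU m hm, hUtop]; trivial
    exact this
  have hKstep : ∀ m ≥ m₁, asympKer B s x (m + 1) = asympKer B s x m := by
    intro m hm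
    ext u
    obtain ⟨c, hc⟩ := hall (m + 1) (by omega) u
    have h1 := hc.lower hB hs
    constructor
    · intro hu
      have hu' : HasAsymp B s x (m + 1) u 0 := hu
      have := hu'.lower hB hs
      rwa [mul_zero] at this
    · intro hu
      have h2 := h1.unique hsne (show HasAsymp B s x m u 0 from hu)
      rcases mul_eq_zero.1 h2 with h3 | h3
      · exact absurd h3 (hm₁ m hm)
      · rw [h3] at hc; exact hc
  have hK : ∀ m ≥ m₁, asympKer B s x m = asympKer B s x m₁ := by
    intro m hm
    induction m, hm using Nat.le_induction with
    | base => rfl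
    | succ m hm ih => rw [hKstep m hm, ih]
  set K := asympKer B s x m₁ with hKdef
  obtain ⟨c₁, hc₁, hsc⟩ := hsm m₁ (by omega)
  by_cases hKbot : K = ⊥
  · left
    have hker : ∀ m ≥ m₁, ∀ u, HasAsymp B s x m u 0 → u = 0 := fun m hm u hu => by
      have : u ∈ asympKer B s x m := hu
      rw [hK m hm, hKbot] at this
      simpa using this
    obtain ⟨v', hv'⟩ := exists_ne (0 : V)
    refine ⟨v', hv', -x, ?_⟩
    obtain ⟨c, hc⟩ := hall (m₁ + 1 + 1) (by omega) v'
    have l1 := hc.lower hB hs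
    have l2 := l1.lower hB hs
    push_cast at l1 l2
    refine hB.eigen_of_eq (y := x + m₁) ?_ ?_
    · refine sub_eq_zero.1 (hker (m₁ + 1) (by omega) _ ?_)
      have := (l2.raise_two hB hs).sub (l1.smul ((x + m₁ + -x) * (x + m₁ + 1 - -x)))
      convert this using 1
      ring
    · refine sub_eq_zero.1 (hker (m₁ + 2) (by omega) _ ?_)
      have := (l2.raise_three hB hs).sub
        (hc.smul ((x + m₁ + 2 * -x) * (x + m₁ + 1 - -x) * (x + m₁ + 2 - -x)))
      convert this using 1
      ring
  · right
    refine ⟨K, hKbot, ?_, ?_⟩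
    · intro h
      have : s m₁ ∈ K := by rw [h]; trivial
      exact hc₁ (hsc.unique hsne this)
    · have hKY : ∀ u ∈ K, Y u ∈ K := fun u hu => by
        refine of2 K (x + m₁) u hu ?_
        rw [← hK (m₁ + 1) (by omega)]
        have hu' : HasAsymp B s x m₁ u 0 := hu
        have := hu'.raise_two hB hs
        rwa [mul_zero] at this
      refine ⟨hKY, fun u hu => ?_⟩
      refine of3 K (x + m₁) u hu (hKY u hu) ?_
      rw [← hK (m₁ + 2) (by omega)]
      have hu' : HasAsymp B s x m₁ u 0 := hu
      have := hu'.raise_three hB hs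
      rwa [mul_zero] at this
end

lemma WittFamily.map {R S : Type*} [Ring R] [Algebra ℂ R] [Ring S] [Algebra ℂ S]
    {B : ℕ → ℂ → R} {Y Z : R} (hB : WittFamily B Y Z) (f : R →ₐ[ℂ] S) :
    WittFamily (fun a y => f (B a y)) (f Y) (f Z) where
  zero y := by rw [hB.zero, map_one]
  two y := by rw [hB.two]; simp
  three y := by rw [hB.three]; simp
  rel a c y h := by
    rw [← map_mul, ← map_mul, ← map_sub, hB.rel a c y h, map_smul]

section
variable {V : Type*} [AddCommGroup V] [Module ℂ V]
  {B : ℕ → ℂ → End ℂ V} {Y Z : End ℂ V}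

lemma WittFamily.mem_of_stable (hB : WittFamily B Y Z) {N : Submodule ℂ V}
    (hY : ∀ u ∈ N, Y u ∈ N) (hZ : ∀ u ∈ N, Z u ∈ N) (a : ℕ) :
    ∀ y, ∀ u ∈ N, B a y u ∈ N := by
  have h2 : ∀ y, ∀ u ∈ N, B 2 y u ∈ N := fun y u hu => by
    rw [hB.two]; exact N.add_mem (N.smul_mem _ hu) (hY u hu)
  induction a using Nat.strong_induction_on with
  | _ a ih =>
  intro y u hu
  match a, ih with
  | 0, _ => rw [hB.zero]; exact hu
  | 1, _ =>
    have h := congrArg (fun f => f u) (hB.rel 0 2 y (by omega))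
    rw [hB.zero, hB.zero, one_mul, mul_one] at h
    simp only [LinearMap.sub_apply, LinearMap.smul_apply] at h
    have h3 : B (0 + 2 - 1) y u = (2 : ℂ)⁻¹ • (B 2 y u - B 2 (y + (0 : ℕ) - 1) u) := by
      rw [h, smul_smul]; norm_num
    rw [h3]
    exact N.smul_mem _ (N.sub_mem (h2 _ _ hu) (h2 _ _ hu))
  | 2, _ => exact h2 y u hu
  | 3, _ =>
    rw [hB.three]
    exact N.add_mem (N.add_mem (N.smul_mem _ hu) (N.smul_mem _ (hY u hu))) (hZ u hu)
  | (n + 4), ih =>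
    have h := congrArg (fun f => f u) (hB.rel 2 (n + 3) y (by omega))
    simp only [LinearMap.sub_apply, LinearMap.smul_apply, Module.End.mul_apply] at h
    have e : 2 + (n + 3) - 1 = n + 4 := by omega
    rw [e] at h
    have hn : (((n + 3 : ℕ) : ℂ) - (2 : ℕ)) ≠ 0 := by
      rw [sub_ne_zero]; norm_cast; omega
    rw [← N.smul_mem_iff hn, ← h]
    exact N.sub_mem (h2 _ _ (ih _ (by omega) _ _ hu)) (ih _ (by omega) _ _ (h2 _ _ hu))

lemma WittFamily.restrict (hB : WittFamily B Y Z) {N : Submodule ℂ V}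
    (hY : ∀ u ∈ N, Y u ∈ N) (hZ : ∀ u ∈ N, Z u ∈ N) :
    WittFamily (R := End ℂ N)
      (fun a y => (B a y).restrict (hB.mem_of_stable hY hZ a y)) (Y.restrict hY) (Z.restrict hZ) where
  zero y := by ext u; simp [hB.zero]
  two y := by ext u; simp [hB.two]
  three y := by ext u; simp [hB.three]
  rel a c y h := by
    ext u
    have := congrArg (fun f => f (u : V)) (hB.rel a c y h)
    simpa using this

lemma WittFamily.quotient (hB : WittFamily B Y Z) {N : Submodule ℂ V}
    (hY : ∀ u ∈ N, Y u ∈ N) (hZ : ∀ u ∈ N, Z u ∈ N) :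
    WittFamily (R := End ℂ (V ⧸ N))
      (fun a y => N.mapQ N (B a y) (hB.mem_of_stable hY hZ a y)) (N.mapQ N Y hY) (N.mapQ N Z hZ) where
  zero y := by ext u; simp [hB.zero]
  two y := by ext u; simp [hB.two]
  three y := by ext u; simp [hB.three]
  rel a c y h := by
    ext u
    have := congrArg (fun f => N.mkQ (f (u : V))) (hB.rel a c y h)
    simpa using this

/-- A finite-dimensional Witt family has a joint eigenvector of tensor density type. -/
theorem WittFamily.exists_eigenvector [FiniteDimensional ℂ V] [Nontrivial V]
    (hB : WittFamily B Y Z) :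
    ∃ v ≠ 0, ∃ b : ℂ, Y v = (b * (1 - b)) • v ∧ Z v = (2 * b * (1 - b) * (2 - b)) • v := by
  induction hn : finrank ℂ V using Nat.strong_induction_on generalizing V with
  | _ n ih =>
  set e : V ≃ₗ[ℂ] (Fin (finrank ℂ V) → ℂ) := (finBasis ℂ V).equivFun with he
  let φ : End ℂ V ≃ₐ[ℂ] ((Fin (finrank ℂ V) → ℂ) →L[ℂ] (Fin (finrank ℂ V) → ℂ)) :=
    (e.conjAlgEquiv ℂ).trans (Module.End.toContinuousLinearMap _)
  have hφ : ∀ f u, φ f (e u) = e (f u) := fun f u => by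
    change e (f (e.symm (e u))) = _
    rw [e.symm_apply_apply]
  have : Nontrivial (Fin (finrank ℂ V) → ℂ) := e.symm.toEquiv.nontrivial
  rcases (hB.map φ.toAlgHom).eigenvector_or_reducible with
    ⟨w, hw, b, h1, h2⟩ | ⟨N, hb, ht, h1, h2⟩
  · obtain ⟨v, rfl⟩ := e.surjective w
    refine ⟨v, fun h => hw (by rw [h, map_zero]), b, e.injective ?_, e.injective ?_⟩
    · rw [← hφ, map_smul]; exact h1
    · rw [← hφ, map_smul]; exact h2
  · set N' : Submodule ℂ V := N.comap (e : V →ₗ[ℂ] _) with hN'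
    have hY : ∀ u ∈ N', Y u ∈ N' := fun u hu => by
      have := h1 (e u) hu
      simp only [N', Submodule.mem_comap, LinearEquiv.coe_coe]
      rw [← hφ]; exact this
    have hZ : ∀ u ∈ N', Z u ∈ N' := fun u hu => by
      have := h2 (e u) hu
      simp only [N', Submodule.mem_comap, LinearEquiv.coe_coe]
      rw [← hφ]; exact this
    have hb' : N' ≠ ⊥ := by
      obtain ⟨w, hw, hw0⟩ := Submodule.exists_mem_ne_zero_of_ne_bot hb
      obtain ⟨v, rfl⟩ := e.surjective w
      intro h
      have : v ∈ N' := hw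
      rw [h, Submodule.mem_bot] at this
      exact hw0 (by rw [this, map_zero])
    have ht' : N' ≠ ⊤ := by
      intro h
      apply ht
      rw [eq_top_iff]
      intro w _
      obtain ⟨v, rfl⟩ := e.surjective w
      have : v ∈ N' := by rw [h]; trivial
      exact this
    have : Nontrivial N' := Submodule.nontrivial_iff_ne_bot.2 hb'
    obtain ⟨v, hv, b, h3, h4⟩ := ih _ (hn ▸ Submodule.finrank_lt ht') (hB.restrict hY hZ) rfl
    refine ⟨v, fun h => hv (Subtype.ext h), b, ?_, ?_⟩
    · simpa using congrArg Subtype.val h3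
    · simpa using congrArg Subtype.val h4

/-- Submodules obtained by successively adjoining tensor density type eigenvectors. -/
inductive IsWittFlag (Y Z : End ℂ V) : Submodule ℂ V → Prop
  | bot : IsWittFlag Y Z ⊥
  | step (N : Submodule ℂ V) (v : V) (b : ℂ) : IsWittFlag Y Z N →
      Y v - (b * (1 - b)) • v ∈ N → Z v - (2 * b * (1 - b) * (2 - b)) • v ∈ N →
      IsWittFlag Y Z (N ⊔ ℂ ∙ v)

lemma stable_sup_span {Y : End ℂ V} {N : Submodule ℂ V} {v : V} {c : ℂ}
    (h : ∀ u ∈ N, Y u ∈ N) (hv : Y v - c • v ∈ N) :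
    ∀ u ∈ N ⊔ ℂ ∙ v, Y u ∈ N ⊔ ℂ ∙ v := by
  intro u hu
  obtain ⟨n, hn, z, hz, rfl⟩ := Submodule.mem_sup.1 hu
  obtain ⟨k, rfl⟩ := Submodule.mem_span_singleton.1 hz
  have e : Y (n + k • v) = (Y n + k • (Y v - c • v)) + (k * c) • v := by
    rw [map_add, map_smul, smul_sub, smul_smul]; abel
  rw [e]
  exact Submodule.add_mem_sup (N.add_mem (h n hn) (N.smul_mem _ hv))
    (Submodule.smul_mem _ _ (Submodule.mem_span_singleton_self v))

lemma IsWittFlag.stable {N : Submodule ℂ V} (h : IsWittFlag Y Z N) :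
    (∀ u ∈ N, Y u ∈ N) ∧ (∀ u ∈ N, Z u ∈ N) := by
  induction h with
  | bot => simp
  | step N v b _ h1 h2 ih => exact ⟨stable_sup_span ih.1 h1, stable_sup_span ih.2 h2⟩

theorem WittFamily.isWittFlag_top [FiniteDimensional ℂ V] (hB : WittFamily B Y Z) :
    IsWittFlag Y Z ⊤ := by
  obtain ⟨N, hN, hmax⟩ := WellFounded.has_min (wellFounded_gt (α := Submodule ℂ V))
    {N | IsWittFlag Y Z N} ⟨⊥, IsWittFlag.bot⟩
  by_cases ht : N = ⊤
  · exact ht ▸ hN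
  exfalso
  obtain ⟨hY, hZ⟩ := IsWittFlag.stable hN
  have : Nontrivial (V ⧸ N) := Submodule.Quotient.nontrivial_iff.2 ht
  obtain ⟨w, hw, b, h1, h2⟩ := (hB.quotient hY hZ).exists_eigenvector
  obtain ⟨v, rfl⟩ := N.mkQ_surjective w
  have hv : v ∉ N := fun h => hw (by simpa using h)
  refine hmax _ (IsWittFlag.step N v b hN ?_ ?_) ?_
  · rw [← Submodule.Quotient.mk_eq_zero]
    simpa [sub_eq_zero] using h1
  · rw [← Submodule.Quotient.mk_eq_zero]
    simpa [sub_eq_zero] using h2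
  · refine lt_of_le_of_ne le_sup_left fun h => hv ?_
    rw [h]
    exact Submodule.mem_sup_right (Submodule.mem_span_singleton_self v)
end

section PolyFun
variable {R : Type*} [Ring R] [Algebra ℂ R]

/-- Operator valued functions that are polynomial in a complex variable. -/
def IsPolyFun (F : ℂ → R) : Prop :=
  ∃ p : Polynomial R, ∀ y, F y = p.eval (algebraMap ℂ R y)

lemma IsPolyFun.sub {F G : ℂ → R} (hF : IsPolyFun F) (hG : IsPolyFun G) :
    IsPolyFun (fun y => F y - G y) := by
  obtain ⟨p, hp⟩ := hF
  obtain ⟨q, hq⟩ := hG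
  exact ⟨p - q, fun y => by beta_reduce; rw [hp, hq, Polynomial.eval_sub]⟩

lemma IsPolyFun.mul {F G : ℂ → R} (hF : IsPolyFun F) (hG : IsPolyFun G) :
    IsPolyFun (fun y => F y * G y) := by
  obtain ⟨p, hp⟩ := hF
  obtain ⟨q, hq⟩ := hG
  refine ⟨p * q, fun y => ?_⟩
  beta_reduce
  rw [hp, hq]
  exact (Polynomial.eval₂_mul_noncomm (RingHom.id R) _ fun k =>
    (Algebra.commutes y _).symm).symm

lemma IsPolyFun.scalar (q : Polynomial ℂ) (r : R) : IsPolyFun (fun y => q.eval y • r) := by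
  refine ⟨q.map (algebraMap ℂ R) * Polynomial.C r, fun y => ?_⟩
  have h := Polynomial.eval₂_mul_noncomm (p := q.map (algebraMap ℂ R)) (q := Polynomial.C r)
    (RingHom.id R) (algebraMap ℂ R y) fun k => (Algebra.commutes y _).symm
  have h1 : (q.map (algebraMap ℂ R)).eval (algebraMap ℂ R y) = algebraMap ℂ R (q.eval y) :=
    by rw [Polynomial.eval_map, Polynomial.eval₂_at_apply]
  change _ = Polynomial.eval₂ _ _ _
  rw [h]
  change _ = (q.map (algebraMap ℂ R)).eval (algebraMap ℂ R y) * (Polynomial.C r).eval _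
  rw [h1, Polynomial.eval_C]
  exact Algebra.smul_def _ _

lemma IsPolyFun.sum {ι : Type*} (s : Finset ι) (F : ι → ℂ → R) (h : ∀ i ∈ s, IsPolyFun (F i)) :
    IsPolyFun (fun y => ∑ i ∈ s, F i y) := by
  choose! p hp using h
  refine ⟨∑ i ∈ s, p i, fun y => ?_⟩
  rw [Polynomial.eval_finsetSum]
  exact Finset.sum_congr rfl fun i hi => hp i hi y

lemma IsPolyFun.eq_zero {F : ℂ → R} (hF : IsPolyFun F) {y₀ : ℂ}
    (h0 : ∀ k : ℕ, F (y₀ + k) = 0) (y : ℂ) : F y = 0 := by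
  obtain ⟨p, hp⟩ := hF
  rw [← Module.forall_dual_apply_eq_zero_iff ℂ]
  intro f
  set q : Polynomial ℂ := ∑ i ∈ p.support, Polynomial.C (f (p.coeff i)) * Polynomial.X ^ i with hq
  have hfq : ∀ y, f (F y) = q.eval y := by
    intro y
    rw [hp, Polynomial.eval_eq_sum, Polynomial.sum, map_sum, hq, Polynomial.eval_finsetSum]
    refine Finset.sum_congr rfl fun i _ => ?_
    rw [← map_pow, ← Algebra.commutes, ← Algebra.smul_def, map_smul]
    simp only [Polynomial.eval_mul, Polynomial.eval_C, Polynomial.eval_pow, Polynomial.eval_X,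
      smul_eq_mul]
    ring
  have hq0 : q = 0 := by
    refine Polynomial.eq_zero_of_infinite_isRoot q ?_
    refine Set.Infinite.mono (s := Set.range fun k : ℕ => y₀ + k) ?_ ?_
    · rintro _ ⟨k, rfl⟩
      change q.eval _ = 0
      rw [← hfq, h0, map_zero]
    · refine Set.infinite_range_of_injective fun a b h => ?_
      simpa using h
  rw [hfq, hq0, Polynomial.eval_zero]
end PolyFun

/-- Rising factorial. -/
noncomputable def risingFact (s : ℕ) (y : ℂ) : ℂ := (ascPochhammer ℂ s).eval y

lemma risingFact_sub (s : ℕ) (y : ℂ) :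
    risingFact (s + 1) y - risingFact (s + 1) (y - 1) = (s + 1) * risingFact s y := by
  have h1 : risingFact (s + 1) y = risingFact s y * (y + s) := by
    simp [risingFact, ascPochhammer_succ_right]
  have h2 : risingFact (s + 1) (y - 1) = (y - 1) * risingFact s y := by
    simp [risingFact, ascPochhammer_succ_left]
  rw [h1, h2]; ring

section Appell
variable {R : Type*} [Ring R] [Algebra ℂ R]

/-- The polynomial interpolation of an Appell sequence. -/
noncomputable def appellPoly (e : ℕ → R) (y₀ : ℂ) (a : ℕ) (y : ℂ) : R :=
  ∑ s ∈ Finset.range (a + 1), ((a.choose s : ℂ) * risingFact s (y - y₀)) • e (a - s)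

lemma isPolyFun_appellPoly (e : ℕ → R) (y₀ : ℂ) (a : ℕ) (t : ℂ) :
    IsPolyFun (fun y => appellPoly e y₀ a (y + t)) := by
  refine IsPolyFun.sum _ _ fun s _ => ?_
  convert IsPolyFun.scalar (Polynomial.C (a.choose s : ℂ) *
    (ascPochhammer ℂ s).comp (Polynomial.X + Polynomial.C (t - y₀))) (e (a - s)) using 3 with y
  simp [risingFact]
  left; congr 1; ring

lemma appellPoly_sub (e : ℕ → R) (y₀ : ℂ) (a : ℕ) (y : ℂ) :
    appellPoly e y₀ (a + 1) y - appellPoly e y₀ (a + 1) (y - 1) =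
      ((a : ℂ) + 1) • appellPoly e y₀ a y := by
  rw [appellPoly, appellPoly, ← Finset.sum_sub_distrib, Finset.sum_range_succ', appellPoly,
    Finset.smul_sum]
  have : risingFact 0 (y - y₀) = risingFact 0 (y - 1 - y₀) := by simp [risingFact]
  rw [this, sub_self, add_zero]
  refine Finset.sum_congr rfl fun s _ => ?_
  rw [← sub_smul, smul_smul, ← mul_sub]
  have h1 := risingFact_sub s (y - y₀)
  have e1 : y - y₀ - 1 = y - 1 - y₀ := by ring
  rw [e1] at h1
  rw [h1]
  have h2 : ((a : ℂ) + 1) * a.choose s = (a + 1).choose (s + 1) * ((s : ℂ) + 1) := by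
    exact_mod_cast Nat.add_one_mul_choose_eq a s
  have e2 : a + 1 - (s + 1) = a - s := by omega
  rw [e2, ← mul_assoc, ← h2, mul_assoc]

lemma appellPoly_zero (e : ℕ → R) (y₀ y : ℂ) : appellPoly e y₀ 0 y = e 0 := by
  simp [appellPoly, risingFact]

lemma appellPoly_base (e : ℕ → R) (y₀ : ℂ) (a : ℕ) : appellPoly e y₀ a y₀ = e a := by
  rw [appellPoly, Finset.sum_range_succ']
  rw [Finset.sum_eq_zero]
  · simp [risingFact]
  · intro s _
    simp [risingFact]

lemma appellPoly_eq (e : ℕ → ℕ → R) (y₀ : ℂ) (h0 : ∀ k, e 0 k = 1)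
    (h : ∀ a k, e (a + 1) (k + 1) - e (a + 1) k = ((a : ℂ) + 1) • e a (k + 1)) (a k : ℕ) :
    appellPoly (fun a => e a 0) y₀ a (y₀ + k) = e a k := by
  induction a generalizing k with
  | zero => rw [appellPoly_zero, h0, h0]
  | succ a iha =>
    induction k with
    | zero => simp [appellPoly_base]
    | succ k ihk =>
      have h1 := appellPoly_sub (fun a => e a 0) y₀ a (y₀ + (k + 1 : ℕ))
      have e1 : y₀ + ((k + 1 : ℕ) : ℂ) - 1 = y₀ + k := by push_cast; ring
      rw [e1, ihk, iha, ← h a k] at h1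
      exact sub_left_injective h1

/-- An Appell sequence of operators satisfying the Witt relations at infinitely many points
is a Witt family. -/
lemma wittFamily_appellPoly (e : ℕ → ℕ → R) (y₀ : ℂ) (h0 : ∀ k, e 0 k = 1)
    (h1 : e 1 0 = algebraMap ℂ R y₀)
    (h : ∀ a k, e (a + 1) (k + 1) - e (a + 1) k = ((a : ℂ) + 1) • e a (k + 1))
    (hrel : ∀ a c j, 1 ≤ a + c → e a (j + c) * e c (j + 1) - e c (j + a) * e a (j + 1) =
      ((c : ℂ) - a) • e (a + c - 1) (j + 1)) :
    ∃ (B : ℕ → ℂ → R) (Y Z : R), WittFamily B Y Z ∧ ∀ a k : ℕ, B a (y₀ + (k : ℂ)) = e a k := by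
  set B := appellPoly (fun a => e a 0) y₀ with hB
  have hBe : ∀ a k : ℕ, B a (y₀ + (k : ℂ)) = e a k := appellPoly_eq e y₀ h0 h
  have b1 : ∀ y, B 1 y = y • 1 := by
    intro y
    simp [hB, appellPoly, Finset.sum_range_succ, risingFact, h0, h1, Algebra.algebraMap_eq_smul_one,
      sub_smul]
  have asc2 : ∀ y, risingFact 2 y = y * (y + 1) := fun y => by
    simp [risingFact, ascPochhammer_succ_right]
  have asc3 : ∀ y, risingFact 3 y = y * (y + 1) * (y + 2) := fun y => by
    simp [risingFact, ascPochhammer_succ_right]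
  have asc1 : ∀ y, risingFact 1 y = y := fun y => by simp [risingFact]
  have asc0 : ∀ y, risingFact 0 y = 1 := fun y => by simp [risingFact]
  have c31 : Nat.choose 3 1 = 3 := rfl
  have c32 : Nat.choose 3 2 = 3 := rfl
  have hBdef : ∀ a y, B a y = appellPoly (fun a => e a 0) y₀ a y := fun _ _ => rfl
  refine ⟨B, B 2 0, B 3 0, ⟨fun y => ?_, fun y => ?_, fun y => ?_, fun a c y hac => ?_⟩, hBe⟩
  · rw [hB, appellPoly_zero, h0]
  · simp only [hBdef, appellPoly, Finset.sum_range_succ, Finset.sum_range_zero, asc0, asc1, asc2,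
      h0, h1, Algebra.algebraMap_eq_smul_one, Nat.choose_self, Nat.choose_zero_right,
      Nat.choose_one_right]
    simp
    module
  · simp only [hBdef, appellPoly, Finset.sum_range_succ, Finset.sum_range_zero, asc0, asc1, asc2,
      asc3, h0, h1, Algebra.algebraMap_eq_smul_one, Nat.choose_self, Nat.choose_zero_right,
      c31, c32, Nat.choose_one_right]
    simp
    module
  · have key : IsPolyFun (fun y => (B a (y + ((c : ℂ) - 1)) * B c (y + 0)
        - B c (y + ((a : ℂ) - 1)) * B a (y + 0)) -
          (((Polynomial.C ((c : ℂ) - a)).eval y • (1 : R)) * B (a + c - 1) (y + 0))) :=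
      (((isPolyFun_appellPoly _ _ _ _).mul (isPolyFun_appellPoly _ _ _ _)).sub
        ((isPolyFun_appellPoly _ _ _ _).mul (isPolyFun_appellPoly _ _ _ _))).sub
        ((IsPolyFun.scalar _ _).mul (isPolyFun_appellPoly _ _ _ _))
    have h2 := key.eq_zero (y₀ := y₀ + 1) (fun j => ?_) y
    · rw [sub_eq_zero] at h2
      simpa [add_sub_assoc] using h2
    · have t1 : y₀ + 1 + (j : ℂ) + (c - 1) = y₀ + ((j + c : ℕ) : ℂ) := by push_cast; ring
      have t2 : y₀ + 1 + (j : ℂ) + (a - 1) = y₀ + ((j + a : ℕ) : ℂ) := by push_cast; ring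
      have t3 : y₀ + 1 + (j : ℂ) + 0 = y₀ + ((j + 1 : ℕ) : ℂ) := by push_cast; ring
      simp only [t1, t2, t3, hBe]
      rw [hrel a c j hac]
      simp
end Appell

/-- Operators `P a` (playing the role of `L_{a-1}`) acting on the spaces `Mk k` (weight spaces of
weight `lam + k`) of bounded dimension. -/
structure WTail {M : Type*} [AddCommGroup M] [Module ℂ M] (P : ℕ → End ℂ M)
    (Mk : ℕ → Submodule ℂ M) (lam : ℂ) : Prop where
  maps : ∀ a k v, v ∈ Mk k → 1 ≤ k + a → P a v ∈ Mk (k + a - 1)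
  diag : ∀ k, ∀ v ∈ Mk k, P 1 v = (lam + (k : ℂ)) • v
  comm : ∀ a c, 1 ≤ a + c → P a * P c - P c * P a = ((c : ℂ) - a) • P (a + c - 1)
  fin : ∀ k, FiniteDimensional ℂ (Mk k)
  bdd : ∃ C, ∀ k, finrank ℂ (Mk k) ≤ C

section
variable {M : Type*} [AddCommGroup M] [Module ℂ M] {P : ℕ → End ℂ M}
  {Mk : ℕ → Submodule ℂ M} {lam : ℂ}

lemma WTail.comm_apply (h : WTail P Mk lam) (a c : ℕ) (hac : 1 ≤ a + c) (v : M) :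
    P a (P c v) = P c (P a v) + ((c : ℂ) - a) • P (a + c - 1) v := by
  have := congrArg (fun f => f v) (h.comm a c hac)
  simp at this
  rw [← this]; abel

/-- Raising a vector killed by `P 0`. -/
lemma WTail.raise_killed (h : WTail P Mk lam) {k : ℕ} {v : M} (hv : v ∈ Mk k) (hv0 : v ≠ 0)
    (hk : P 0 v = 0) (hre : 1 / 2 < (lam + k).re) (j : ℕ) :
    ∃ w ∈ Mk (k + j), w ≠ 0 ∧ P 2 (P 0 w) =
      ((lam + (k + j : ℕ)) ^ 2 - (lam + (k + j : ℕ)) - ((lam + k) ^ 2 - (lam + k))) • w := by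
  induction j with
  | zero => exact ⟨v, hv, hv0, by simp [hk]⟩
  | succ j ih =>
    obtain ⟨w, hw, hw0, he⟩ := ih
    have h02 : P 0 (P 2 w) =
        (((lam + (k + j : ℕ)) + (lam + k)) * ((lam + (k + j : ℕ)) - (lam + k) + 1)) • w := by
      rw [h.comm_apply 0 2 (by omega), he]
      rw [show 0 + 2 - 1 = 1 from rfl, h.diag _ w hw, smul_smul, ← add_smul]
      congr 1; push_cast; ring
    have hne : ((lam + (k + j : ℕ)) + (lam + k)) * ((lam + (k + j : ℕ)) - (lam + k) + 1) ≠ 0 := by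
      refine mul_ne_zero (fun h0 => ?_) (fun h0 => ?_)
      · have := congrArg Complex.re h0
        simp at this hre
        have : (0:ℝ) ≤ j := by positivity
        linarith
      · have := congrArg Complex.re h0
        simp at this
        have : (0:ℝ) ≤ j := by positivity
        linarith
    refine ⟨P 2 w, ?_, ?_, ?_⟩
    · have := h.maps 2 (k + j) w hw (by omega)
      rwa [show k + j + 2 - 1 = k + (j + 1) by omega] at this
    · intro h0
      rw [h0, map_zero] at h02
      exact (smul_ne_zero hne hw0) h02.symm
    · rw [h02, map_smul]
      congr 1; push_cast; ring

lemma WTail.finite_killed (h : WTail P Mk lam) :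
    {k : ℕ | 1 / 2 < (lam + k).re ∧ ∃ v ∈ Mk k, v ≠ 0 ∧ P 0 v = 0}.Finite := by
  obtain ⟨C, hC⟩ := h.bdd
  by_contra hinf
  obtain ⟨F, hFs, hFc⟩ := Set.Infinite.exists_subset_card_eq hinf (C + 1)
  set N := F.sup id with hN
  have hle : ∀ k ∈ F, k ≤ N := fun k hk => Finset.le_sup (f := id) hk
  have hex : ∀ k : F, ∃ w ∈ Mk N, w ≠ 0 ∧ P 2 (P 0 w) =
      ((lam + N) ^ 2 - (lam + N) - ((lam + (k : ℕ)) ^ 2 - (lam + (k : ℕ)))) • w := by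
    rintro ⟨k, hk⟩
    obtain ⟨hre, v, hv, hv0, hkl⟩ := hFs hk
    obtain ⟨w, hw⟩ := h.raise_killed hv hv0 hkl hre (N - k)
    rw [show k + (N - k) = N from Nat.add_sub_cancel' (hle k hk)] at hw
    exact ⟨w, hw⟩
  choose w hw hw0 hwe using hex
  have hinj : Function.Injective fun k : F =>
      (lam + N) ^ 2 - (lam + N) - ((lam + ((k : ℕ) : ℂ)) ^ 2 - (lam + ((k : ℕ) : ℂ))) := by
    rintro ⟨k, hk⟩ ⟨l, hl⟩ he
    have h1 := (hFs hk).1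
    have h2 := (hFs hl).1
    have : ((k : ℂ) - l) * ((lam + k) + (lam + l) - 1) = 0 := by
      simp only at he
      linear_combination -he
    rcases mul_eq_zero.1 this with h0 | h0
    · exact Subtype.ext (Nat.cast_injective (R := ℂ) (sub_eq_zero.1 h0))
    · have := congrArg Complex.re h0
      simp at this h1 h2
      linarith
  have hli : LinearIndependent ℂ w :=
    Module.End.eigenvectors_linearIndependent' (P 2 * P 0) _ hinj w fun k =>
      ⟨Module.End.mem_eigenspace_iff.2 (hwe k), hw0 k⟩
  have hli' : LinearIndependent ℂ (fun k => (⟨w k, hw k⟩ : Mk N)) :=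
    LinearIndependent.of_comp (Mk N).subtype hli
  have := h.fin N
  have := hli'.fintype_card_le_finrank
  rw [Fintype.card_coe, hFc] at this
  have := hC N
  omega

lemma exists_eventually_const (f : ℕ → ℕ) (K : ℕ) (hf : ∀ k ≥ K, f (k + 1) ≤ f k) :
    ∃ K' ≥ K, ∀ k ≥ K', f (k + 1) = f k := by
  obtain ⟨m, ⟨hmK, hm⟩⟩ : ∃ m ≥ K, ∀ k ≥ K, f m ≤ f k := by
    obtain ⟨m, hm, hmin⟩ := (WellFounded.has_min (measure f).wf {k | K ≤ k} ⟨K, le_refl K⟩)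
    exact ⟨m, hm, fun k hk => not_lt.1 (hmin k hk)⟩
  have hle : ∀ k ≥ m, f k ≤ f m := by
    intro k hk
    induction k, hk using Nat.le_induction with
    | base => rfl
    | succ k hk ih => exact (hf k (hmK.trans hk)).trans ih
  refine ⟨m, hmK, fun k hk => ?_⟩
  have h1 := hle k hk
  have h2 := hle (k + 1) (by omega)
  have h3 := hm k (hmK.trans hk)
  have h4 := hm (k + 1) (by omega)
  omega

lemma WTail.exists_bijective (h : WTail P Mk lam) (n : ℕ) : ∃ K ≥ n, ∀ k ≥ K,
    Function.Bijective ((P 0).restrict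
      (fun v hv => h.maps 0 (k + 1) v hv (by omega) : ∀ v ∈ Mk (k + 1), P 0 v ∈ Mk k)) := by
  obtain ⟨K1, hK1⟩ := h.finite_killed.bddAbove
  obtain ⟨K2, hK2⟩ := exists_nat_gt (1 / 2 - lam.re)
  set K0 := max n (max (K1 + 1) K2) with hK0
  have hinj : ∀ k ≥ K0, Function.Injective ((P 0).restrict
      (fun v hv => h.maps 0 (k + 1) v hv (by omega) : ∀ v ∈ Mk (k + 1), P 0 v ∈ Mk k)) := by
    intro k hk
    rw [← LinearMap.ker_eq_bot, LinearMap.ker_eq_bot']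
    rintro ⟨v, hv⟩ h0
    by_contra hne
    have h1 : P 0 v = 0 := by simpa using congrArg Subtype.val h0
    have h2 : k + 1 ≤ K1 := hK1 ⟨by
      have : (K2 : ℝ) ≤ k := by exact_mod_cast (by omega : K2 ≤ k)
      simp; linarith, v, hv, fun h => hne (Subtype.ext h), h1⟩
    omega
  have hfin := h.fin
  obtain ⟨K, hK, hc⟩ := exists_eventually_const (fun k => finrank ℂ (Mk k)) K0 fun k hk =>
    LinearMap.finrank_le_finrank_of_injective (hinj k hk)
  refine ⟨K, by omega, fun k hk => ⟨hinj k (by omega), ?_⟩⟩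
  exact (LinearMap.injective_iff_surjective_of_finrank_eq_finrank (hc k hk)).1 (hinj k (by omega))

/-- The weight spaces of a tail are eventually all identified with one space, on which the
operators are given by a Witt family. -/
theorem WTail.exists_wittFamily (h : WTail P Mk lam) (n : ℕ) :
    ∃ K ≥ n, ∃ (U : ℕ → Mk K →ₗ[ℂ] M) (B : ℕ → ℂ → End ℂ (Mk K)) (Y Z : End ℂ (Mk K)),
      WittFamily B Y Z ∧ (∀ k, LinearMap.range (U k) = Mk (K + k)) ∧
      (∀ k u, P 0 (U (k + 1) u) = U k u) ∧
      ∀ a k u, P a (U (k + 1) u) = U (k + a) (B a (lam + K + 1 + (k : ℂ)) u) := by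
  obtain ⟨K, hKn, hbij⟩ := h.exists_bijective n
  let e (k : ℕ) : Mk (K + k + 1) ≃ₗ[ℂ] Mk (K + k) :=
    LinearEquiv.ofBijective _ (hbij (K + k) (by omega))
  let D (k : ℕ) : Mk K ≃ₗ[ℂ] Mk (K + k) :=
    Nat.rec (motive := fun k => Mk K ≃ₗ[ℂ] Mk (K + k)) (LinearEquiv.refl ℂ _)
      (fun k D => D.trans (e k).symm) k
  have hD : ∀ k u, e k (D (k + 1) u) = D k u := fun k u => by
    change e k ((e k).symm (D k u)) = D k u
    simp
  let U (k : ℕ) : Mk K →ₗ[ℂ] M := (Mk (K + k)).subtype ∘ₗ (D k).toLinearMap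
  have hU0 : ∀ k u, P 0 (U (k + 1) u) = U k u := fun k u => congrArg Subtype.val (hD k u)
  have hUinj : ∀ k, Function.Injective (U k) := fun k =>
    Subtype.val_injective.comp (D k).injective
  have hUr : ∀ k, LinearMap.range (U k) = Mk (K + k) := fun k => by
    rw [LinearMap.range_comp, LinearEquiv.range, Submodule.map_top, Submodule.range_subtype]
  have hUm : ∀ k u, U k u ∈ Mk (K + k) := fun k u => (D k u).2
  have hm : ∀ a k, ∀ v ∈ Mk (K + (k + 1)), P a v ∈ Mk (K + (k + a)) := fun a k v hv => by
    have := h.maps a _ v hv (by omega)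
    rwa [show K + (k + 1) + a - 1 = K + (k + a) by omega] at this
  let E (a k : ℕ) : End ℂ (Mk K) :=
    (D (k + a)).symm.toLinearMap ∘ₗ (P a).restrict (hm a k) ∘ₗ (D (k + 1)).toLinearMap
  have hE : ∀ a k u, U (k + a) (E a k u) = P a (U (k + 1) u) := fun a k u => by
    change ((D (k + a) ((D (k + a)).symm _) : Mk (K + (k + a))) : M) = _
    rw [LinearEquiv.apply_symm_apply]
    rfl
  have key : ∃ (B : ℕ → ℂ → End ℂ (Mk K)) (Y Z : End ℂ (Mk K)), WittFamily B Y Z ∧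
      ∀ a k : ℕ, B a (lam + K + 1 + (k : ℂ)) = E a k := by
    refine wittFamily_appellPoly E (lam + K + 1) ?_ ?_ ?_ ?_
    · intro k
      ext1 u
      apply hUinj k
      exact (hE 0 k u).trans (hU0 k u)
    · ext1 u
      apply hUinj 1
      rw [show (1 : ℕ) = 0 + 1 from rfl, hE, h.diag _ _ (hUm _ _)]
      rw [Algebra.algebraMap_eq_smul_one, LinearMap.smul_apply, map_smul]
      simp [add_assoc]
    · intro a k
      ext1 u
      apply hUinj (k + 1 + a)
      rw [LinearMap.sub_apply, LinearMap.smul_apply, map_sub, map_smul, hE]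
      have h1 : U (k + 1 + a) (E (a + 1) (k + 1) u) = P 0 (P (a + 1) (U (k + 2) u)) := by
        rw [← hU0, show k + 1 + a + 1 = k + 1 + (a + 1) by omega, hE]
      have h2 : U (k + 1 + a) (E (a + 1) k u) = P (a + 1) (U (k + 1) u) := by
        rw [show k + 1 + a = k + (a + 1) by omega, hE]
      rw [h1, h2, h.comm_apply 0 (a + 1) (by omega), hU0]
      simp
    · intro a c j hac
      ext1 u
      apply hUinj (j + c + a)
      have h1 : U (j + c + a) (E a (j + c) (E c (j + 1) u)) = P a (P c (U (j + 2) u)) := by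
        rw [hE, show j + c + 1 = j + 1 + c by omega, hE]
      have h2 : U (j + c + a) (E c (j + a) (E a (j + 1) u)) = P c (P a (U (j + 2) u)) := by
        rw [show j + c + a = j + a + c by omega, hE, show j + a + 1 = j + 1 + a by omega, hE]
      have h3 : U (j + c + a) (E (a + c - 1) (j + 1) u) = P (a + c - 1) (U (j + 2) u) := by
        rw [show j + c + a = j + 1 + (a + c - 1) by omega, hE]
      rw [LinearMap.sub_apply, LinearMap.smul_apply, map_sub, map_smul, Module.End.mul_apply,
        Module.End.mul_apply, h1, h2, h3, h.comm_apply a c hac]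
      simp
  obtain ⟨B, Y, Z, hB, hBE⟩ := key
  refine ⟨K, hKn, U, B, Y, Z, hB, hUr, hU0, fun a k u => ?_⟩
  rw [hBE, hE]
end

section
variable {V : Type*} [AddCommGroup V] [Module ℂ V] {Y Z : End ℂ V}

lemma IsWittFlag.exists_last {N : Submodule ℂ V} (h : IsWittFlag Y Z N) (hN : N ≠ ⊥) :
    ∃ (N' : Submodule ℂ V) (v : V) (b : ℂ), IsWittFlag Y Z N' ∧ v ∉ N' ∧ N' ⊔ ℂ ∙ v = N ∧
      Y v - (b * (1 - b)) • v ∈ N' ∧ Z v - (2 * b * (1 - b) * (2 - b)) • v ∈ N' := by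
  induction h with
  | bot => exact absurd rfl hN
  | step N v b hf h1 h2 ih =>
    by_cases hv : v ∈ N
    · have e : N ⊔ ℂ ∙ v = N := sup_eq_left.2 ((Submodule.span_singleton_le_iff_mem _ _).2 hv)
      rw [e] at hN ⊢
      exact ih hN
    · exact ⟨N, v, b, hf, hv, rfl, h1, h2⟩

lemma IsWittFlag.exists_dual [Nontrivial V] (h : IsWittFlag Y Z ⊤) :
    ∃ (f : Dual ℂ V) (b : ℂ), f ≠ 0 ∧ (∀ u, f (Y u) = (b * (1 - b)) * f u) ∧
      ∀ u, f (Z u) = (2 * b * (1 - b) * (2 - b)) * f u := by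
  obtain ⟨N, v, b, hf, hv, hs, hY, hZ⟩ := h.exists_last top_ne_bot
  obtain ⟨f, hfv, hfN⟩ := Submodule.exists_le_ker_of_notMem hv
  have hN : ∀ u ∈ N, f u = 0 := fun u hu => hfN hu
  have key : ∀ (W : End ℂ V) (c : ℂ), (∀ u ∈ N, W u ∈ N) → W v - c • v ∈ N →
      ∀ u, f (W u) = c * f u := by
    intro W c hW hWv u
    have hu : u ∈ N ⊔ ℂ ∙ v := hs ▸ Submodule.mem_top
    obtain ⟨n, hn, z, hz, rfl⟩ := Submodule.mem_sup.1 hu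
    obtain ⟨k, rfl⟩ := Submodule.mem_span_singleton.1 hz
    have := hN _ hWv
    simp only [map_sub, map_smul, smul_eq_mul] at this
    simp only [map_add, map_smul, hN _ hn, hN _ (hW n hn), smul_eq_mul]
    linear_combination k * this
  exact ⟨f, b, fun h0 => hfv (by simp [h0]), key Y _ hf.stable.1 hY, key Z _ hf.stable.2 hZ⟩
end

/-- Functionals on an independent family of subspaces extend to the whole space. -/
lemma exists_dual_extension {ι M : Type*} [AddCommGroup M] [Module ℂ M] {p : ι → Submodule ℂ M}
    (hp : iSupIndep p) (f : ∀ i, p i →ₗ[ℂ] ℂ) : ∃ φ : Dual ℂ M, ∀ i (v : p i), φ v = f i v := by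
  classical
  obtain ⟨g, hg⟩ := LinearMap.exists_leftInverse_of_injective
    (DFinsupp.lsum ℕ fun i => (p i).subtype : (Π₀ i, p i) →ₗ[ℂ] M)
    (LinearMap.ker_eq_bot.2 hp.dfinsupp_lsum_injective)
  refine ⟨(DFinsupp.lsum ℕ f : (Π₀ i, p i) →ₗ[ℂ] ℂ) ∘ₗ g, fun i v => ?_⟩
  have := congrArg (fun F => F (DFinsupp.single i v)) hg
  simp at this
  simp [this]

section
variable {M : Type*} [AddCommGroup M] [Module ℂ M] {P : ℕ → End ℂ M}
  {Mk : ℕ → Submodule ℂ M} {lam : ℂ}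

lemma WTail.iSupIndep (h : WTail P Mk lam) : iSupIndep Mk := by
  have h1 := Module.End.eigenspaces_iSupIndep (P 1)
  have hinj : Function.Injective fun k : ℕ => lam + (k : ℂ) := fun k l hkl => by simpa using hkl
  exact (h1.comp hinj).mono fun k v hv => Module.End.mem_eigenspace_iff.2 (h.diag k v hv)

/-- A tail with nonzero weight spaces has a functional behaving like the coefficient functional
of a density module. -/
theorem WTail.exists_functional (h : WTail P Mk lam) (hne : ∀ n, ∃ k ≥ n, Mk k ≠ ⊥) :
    ∃ (φ : Dual ℂ M) (b : ℂ) (K : ℕ), ∀ k ≥ K, (∃ v ∈ Mk k, φ v ≠ 0) ∧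
      (∀ v ∈ Mk k, φ (P 0 v) = (lam + k - b) * φ v) ∧
      (∀ v ∈ Mk k, φ (P 2 v) = (lam + k + b) * φ v) ∧
      (∀ v ∈ Mk k, φ (P 3 v) = (lam + k + 2 * b) * φ v) := by
  obtain ⟨K, -, U, B, Y, Z, hB, hUr, hU0, hU⟩ := h.exists_wittFamily 0
  have hV : Nontrivial (Mk K) := by
    by_contra hV
    rw [not_nontrivial_iff_subsingleton] at hV
    obtain ⟨k, hk, hkb⟩ := hne K
    apply hkb
    have := hUr (k - K)
    rw [show K + (k - K) = k by omega] at this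
    rw [← this, LinearMap.range_eq_bot]
    ext u
    simp [Subsingleton.elim u 0]
  have := h.fin K
  obtain ⟨f, b, hf0, hfY, hfZ⟩ := hB.isWittFlag_top.exists_dual
  let y (j : ℕ) : ℂ := lam + K + (j : ℂ)
  let γ (j : ℕ) : ℂ := ∏ i ∈ Finset.range j, if y (i + 1) - b = 0 then 1 else (y (i + 1) - b)⁻¹
  have hγ : ∀ j, γ j ≠ 0 := fun j => Finset.prod_ne_zero_iff.2 fun i _ => by
    split_ifs with h0
    · exact one_ne_zero
    · exact inv_ne_zero h0
  obtain ⟨J, hJ⟩ : ∃ J : ℕ, ∀ j ≥ J, y j - b ≠ 0 := by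
    obtain ⟨J, hJ⟩ := exists_nat_gt (b.re - lam.re)
    refine ⟨J, fun j hj h0 => ?_⟩
    have := congrArg Complex.re h0
    have h2 : (J : ℝ) ≤ j := by exact_mod_cast hj
    simp [y] at this
    have : (0:ℝ) ≤ K := by positivity
    linarith
  have hγs : ∀ j ≥ J, γ j = γ (j + 1) * (y (j + 1) - b) := fun j hj => by
    have := hJ (j + 1) (by omega)
    simp only [γ, Finset.prod_range_succ, if_neg this]
    field_simp
  have hUmem : ∀ j u, U j u ∈ Mk (K + j) := fun j u => hUr j ▸ LinearMap.mem_range_self _ u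
  have hUex : ∀ j, ∀ v ∈ Mk (K + j), ∃ u, U j u = v := fun j v hv => by
    rwa [← hUr j] at hv
  have hUinj : ∀ j u, U j u = 0 → u = 0 := by
    intro j
    induction j with
    | zero =>
      have hs : Function.Surjective ((U 0).codRestrict (Mk K) fun u => hUmem 0 u) := fun v => by
        obtain ⟨u, hu⟩ := hUex 0 v.1 v.2
        exact ⟨u, Subtype.ext hu⟩
      have hi := LinearMap.injective_iff_surjective.2 hs
      intro u hu
      exact hi (Subtype.ext (by simpa using hu))
    | succ j ih =>
      intro u hu
      apply ih
      rw [← hU0, hu, map_zero]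
  let Ue (j : ℕ) : Mk K ≃ₗ[ℂ] Mk (K + j) :=
    LinearEquiv.ofBijective ((U j).codRestrict (Mk (K + j)) (hUmem j))
      ⟨by
        rw [← LinearMap.ker_eq_bot, LinearMap.ker_eq_bot']
        exact fun u hu => hUinj j u (congrArg Subtype.val hu),
       fun v => by
        obtain ⟨u, hu⟩ := hUex j v.1 v.2
        exact ⟨u, Subtype.ext hu⟩⟩
  obtain ⟨φ, hφ⟩ := exists_dual_extension (p := fun j => Mk (K + j))
    (h.iSupIndep.comp (add_right_injective K)) fun j => γ j • f ∘ₗ (Ue j).symm.toLinearMap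
  have hφU : ∀ j u, φ (U j u) = γ j * f u := fun j u => by
    have := hφ j (Ue j u)
    rw [show U j u = (Ue j u : M) from rfl, this]
    simp
  refine ⟨φ, b, K + J + 1, fun k hk => ?_⟩
  obtain ⟨j, rfl⟩ : ∃ j, k = K + (j + 1) := ⟨k - K - 1, by omega⟩
  have hj : J ≤ j := by omega
  have hy : lam + ((K + (j + 1) : ℕ) : ℂ) = y (j + 1) := by simp only [y]; push_cast; ring
  have hy' : lam + K + 1 + (j : ℂ) = y (j + 1) := by simp only [y]; push_cast; ring
  have hy2 : y (j + 1 + 1) = y (j + 1) + 1 := by simp only [y]; push_cast; ring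
  have hy3 : y (j + 1 + 1 + 1) = y (j + 1) + 2 := by simp only [y]; push_cast; ring
  rw [hy]
  have e2 := hγs (j + 1) (by omega)
  have e3 := hγs (j + 1 + 1) (by omega)
  refine ⟨?_, fun v hv => ?_, fun v hv => ?_, fun v hv => ?_⟩
  · obtain ⟨u, hu⟩ : ∃ u, f u ≠ 0 := by
      by_contra! h0
      exact hf0 (LinearMap.ext h0)
    exact ⟨U (j + 1) u, hUmem _ u, by rw [hφU]; exact mul_ne_zero (hγ _) hu⟩
  all_goals obtain ⟨u, rfl⟩ := hUex _ v hv
  · rw [hU0, hφU, hφU, hγs j hj]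
    ring
  · rw [hU, hφU, hφU, hB.two, hy', e2, hy2]
    simp [hfY]
    ring
  · rw [hU, hφU, hφU, hB.three, hy', e2, e3, hy2, hy3]
    simp [hfY, hfZ]
    ring

/-- One step of a flag in a tail: `v` spans a density module modulo `T`. -/
structure FlagStep (P : ℕ → End ℂ M) (Mk : ℕ → Submodule ℂ M) (lam b : ℂ) (K : ℕ)
    (T : ℕ → Submodule ℂ M) (v : ℕ → M) : Prop where
  le : ∀ k ≥ K, T k ≤ Mk k
  zero : ∀ k ≥ K, ∀ t ∈ T (k + 1), P 0 t ∈ T k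
  two : ∀ k ≥ K, ∀ t ∈ T k, P 2 t ∈ T (k + 1)
  three : ∀ k ≥ K, ∀ t ∈ T k, P 3 t ∈ T (k + 2)
  mem : ∀ k ≥ K, v k ∈ Mk k
  vzero : ∀ k ≥ K, P 0 (v (k + 1)) = v k
  vtwo : ∀ k ≥ K, P 2 (v k) - ((lam + k + b) * (lam + k + 1 - b)) • v (k + 1) ∈ T (k + 1)
  vthree : ∀ k ≥ K, P 3 (v k) -
    ((lam + k + 2 * b) * (lam + k + 1 - b) * (lam + k + 2 - b)) • v (k + 2) ∈ T (k + 2)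

/-- To show that functionals vanish on a tail, it is enough to treat density modules. -/
theorem WTail.flag_induction (h : WTail P Mk lam) (Θ : ℕ → Dual ℂ M)
    (hstep : ∀ b K T v, FlagStep P Mk lam b K T v →
      (∃ q₀, ∀ q ≥ q₀, ∀ᶠ k in atTop, ∀ t ∈ T k, Θ q t = 0) →
      ∃ q₀, ∀ q ≥ q₀, ∀ᶠ k in atTop, Θ q (v k) = 0) :
    ∃ q₀, ∀ q ≥ q₀, ∀ᶠ k in atTop, ∀ v ∈ Mk k, Θ q v = 0 := by
  obtain ⟨K, -, U, B, Y, Z, hB, hUr, hU0, hU⟩ := h.exists_wittFamily 0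
  have := h.fin K
  have hUmem : ∀ j u, U j u ∈ Mk (K + j) := fun j u => hUr j ▸ LinearMap.mem_range_self _ u
  have hUP : ∀ k ≥ K + 1, ∀ a u, P a (U (k - K) u) = U (k - 1 - K + a) (B a (lam + k) u) := by
    intro k hk a u
    obtain ⟨j, rfl⟩ : ∃ j, k = K + (j + 1) := ⟨k - K - 1, by omega⟩
    rw [show K + (j + 1) - K = j + 1 by omega, show K + (j + 1) - 1 - K = j by omega, hU]
    congr 3; push_cast; ring
  have key : ∀ N : Submodule ℂ (Mk K), IsWittFlag Y Z N →
      ∃ q₀, ∀ q ≥ q₀, ∀ᶠ k in atTop, ∀ u ∈ N, Θ q (U (k - K) u) = 0 := by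
    intro N hN
    induction hN with
    | bot => exact ⟨0, fun q _ => .of_forall fun k u hu => by simp [(Submodule.mem_bot ℂ).1 hu]⟩
    | step N v b hf h1 h2 ih =>
      have hst := hB.mem_of_stable hf.stable.1 hf.stable.2
      have hs : FlagStep P Mk lam b (K + 1) (fun k => N.map (U (k - K))) (fun k => U (k - K) v) := by
        constructor
        · rintro k hk _ ⟨u, -, rfl⟩
          have := hUmem (k - K) u
          rwa [show K + (k - K) = k by omega] at this
        · rintro k hk _ ⟨u, hu, rfl⟩
          refine ⟨u, hu, ?_⟩
          rw [show k + 1 - K = k - K + 1 by omega, hU0]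
        · rintro k hk _ ⟨u, hu, rfl⟩
          refine ⟨_, hst 2 (lam + k) u hu, ?_⟩
          rw [hUP k hk, show k - 1 - K + 2 = k + 1 - K by omega]
        · rintro k hk _ ⟨u, hu, rfl⟩
          refine ⟨_, hst 3 (lam + k) u hu, ?_⟩
          rw [hUP k hk, show k - 1 - K + 3 = k + 2 - K by omega]
        · intro k hk
          have := hUmem (k - K) v
          rwa [show K + (k - K) = k by omega] at this
        · intro k hk
          rw [show k + 1 - K = k - K + 1 by omega, hU0]
        · intro k hk
          rw [hUP k hk, show k - 1 - K + 2 = k + 1 - K by omega, ← map_smul, ← map_sub]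
          refine Submodule.mem_map_of_mem ?_
          convert h1 using 1
          rw [hB.two]
          simp
          module
        · intro k hk
          rw [hUP k hk, show k - 1 - K + 3 = k + 2 - K by omega, ← map_smul, ← map_sub]
          refine Submodule.mem_map_of_mem ?_
          convert N.add_mem (N.smul_mem (3 * (lam + (k : ℂ))) h1) h2 using 1
          rw [hB.three]
          simp
          module
      obtain ⟨q0, hq0⟩ := ih
      obtain ⟨q1, hq1⟩ := hstep b _ _ _ hs ⟨q0, fun q hq => (hq0 q hq).mono fun k hk t ht => by
        obtain ⟨u, hu, rfl⟩ := ht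
        exact hk u hu⟩
      refine ⟨max q0 q1, fun q hq => ?_⟩
      filter_upwards [hq0 q (le_of_max_le_left hq), hq1 q (le_of_max_le_right hq)] with k hk1 hk2 u hu
      obtain ⟨n, hn, z, hz, rfl⟩ := Submodule.mem_sup.1 hu
      obtain ⟨c, rfl⟩ := Submodule.mem_span_singleton.1 hz
      simp [hk1 n hn, hk2]
  obtain ⟨q₀, hq⟩ := key ⊤ hB.isWittFlag_top
  refine ⟨q₀, fun q hqq => ?_⟩
  filter_upwards [hq q hqq, eventually_ge_atTop K] with k hk hkK v hv
  rw [show k = K + (k - K) by omega, ← hUr] at hv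
  obtain ⟨u, rfl⟩ := hv
  exact hk u Submodule.mem_top
end

/-- The four types of generators. -/
inductive HVGen
  | L | H | G | Q

/-- A module with scalar central charges. -/
structure HVRel {M : Type} [AddCommGroup M] [Module ℂ M] (X : HVGen → ℤ → End ℂ M)
    (c l a : ℂ) : Prop where
  rel : IsSRep (X .L) (X .H) (X .G) (X .Q) (c • 1) (l • 1) (a • 1)

/-- A simple weight module with scalar central charges; `p` is the projection onto the even part. -/
structure HVData {M : Type} [AddCommGroup M] [Module ℂ M] (X : HVGen → ℤ → End ℂ M)
    (c l a lam : ℂ) (p : End ℂ M) : Prop extends HVRel X c l a where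
  pp : ∀ v, p (p v) = p v
  pL : ∀ i v, p (X .L i v) = X .L i (p v)
  pH : ∀ i v, p (X .H i v) = X .H i (p v)
  pG : ∀ i v, p (X .G i v) = X .G i (v - p v)
  pQ : ∀ i v, p (X .Q i v) = X .Q i (v - p v)
  simple : ∀ N : Submodule ℂ M, (∀ g i, ∀ v ∈ N, X g i v ∈ N) → (∀ v ∈ N, p v ∈ N) →
    N = ⊥ ∨ N = ⊤
  ne : ∃ v ≠ 0, X .L 0 v = lam • v
  top : ⨆ k : ℤ, (X .L 0).eigenspace (lam + k) = ⊤
  fin : ∀ k : ℤ, FiniteDimensional ℂ ((X .L 0).eigenspace (lam + k))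

namespace HVRel
variable {M : Type} [AddCommGroup M] [Module ℂ M] {X : HVGen → ℤ → End ℂ M}
    {c l a : ℂ}

section basic
variable (h : HVRel X c l a)
include h

lemma LL (i j : ℤ) (v : M) : X .L i (X .L j v) = X .L j (X .L i v) +
    ((j : ℂ) - i) • X .L (i + j) v +
      (if i + j = 0 then ((i : ℂ) ^ 3 - i) / 12 * c else 0) • v := by
  have := congrArg (fun f => f v) (h.rel.comm_LL i j)
  simp only [LinearMap.sub_apply, LinearMap.add_apply, LinearMap.smul_apply, Module.End.mul_apply,
    Module.End.one_apply, sub_eq_iff_eq_add, smul_smul, ite_mul, zero_mul] at this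
  rw [this]; abel

lemma LH (i j : ℤ) (v : M) : X .L i (X .H j v) = X .H j (X .L i v) + (j : ℂ) • X .H (i + j) v +
      (if i + j = 0 then ((i : ℂ) ^ 2 + i) * l else 0) • v := by
  have := congrArg (fun f => f v) (h.rel.comm_LH i j)
  simp only [LinearMap.sub_apply, LinearMap.add_apply, LinearMap.smul_apply, Module.End.mul_apply,
    Module.End.one_apply, sub_eq_iff_eq_add, smul_smul, ite_mul, zero_mul] at this
  rw [this]; abel

lemma LG (i j : ℤ) (v : M) : X .L i (X .G j v) = X .G j (X .L i v) +
    ((j : ℂ) - i / 2) • X .G (i + j) v := by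
  have := congrArg (fun f => f v) (h.rel.comm_LG i j)
  simp only [LinearMap.sub_apply, LinearMap.smul_apply, Module.End.mul_apply,
    sub_eq_iff_eq_add] at this
  rw [this]; abel

lemma LQ (i j : ℤ) (v : M) : X .L i (X .Q j v) = X .Q j (X .L i v) +
    ((j : ℂ) + i / 2) • X .Q (i + j) v := by
  have := congrArg (fun f => f v) (h.rel.comm_LQ i j)
  simp only [LinearMap.sub_apply, LinearMap.smul_apply, Module.End.mul_apply,
    sub_eq_iff_eq_add] at this
  rw [this]; abel

lemma HH (i j : ℤ) (v : M) : X .H i (X .H j v) = X .H j (X .H i v) +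
    (if i + j = 0 then (i : ℂ) * a else 0) • v := by
  have := congrArg (fun f => f v) (h.rel.comm_HH i j)
  simp only [LinearMap.sub_apply, LinearMap.smul_apply, Module.End.mul_apply,
    Module.End.one_apply, sub_eq_iff_eq_add, smul_smul, ite_mul, zero_mul] at this
  rw [this]; abel

lemma GH (i j : ℤ) (v : M) : X .G i (X .H j v) = X .H j (X .G i v) +
    (-(j : ℂ)) • X .Q (i + j) v := by
  have := congrArg (fun f => f v) (h.rel.comm_GH i j)
  simp only [LinearMap.sub_apply, LinearMap.smul_apply, Module.End.mul_apply,
    sub_eq_iff_eq_add] at this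
  rw [this]; abel

lemma HQ (i j : ℤ) (v : M) : X .H i (X .Q j v) = X .Q j (X .H i v) := by
  have := congrArg (fun f => f v) (h.rel.comm_HQ i j)
  simpa [sub_eq_zero] using this

lemma GQ (i j : ℤ) (v : M) : X .G i (X .Q j v) = -X .Q j (X .G i v) + X .H (i + j) v +
    (if i + j = 0 then (2 * (i : ℂ) - 1) * l else 0) • v := by
  have := congrArg (fun f => f v) (h.rel.comm_GQ i j)
  simp only [LinearMap.add_apply, LinearMap.smul_apply, Module.End.mul_apply,
    Module.End.one_apply, smul_smul, ite_mul, zero_mul] at this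
  rw [add_assoc, ← this]; abel

lemma GG (i j : ℤ) (v : M) : X .G i (X .G j v) = -X .G j (X .G i v) +
    (-2 : ℂ) • X .L (i + j) v +
    (if i + j = 0 then (4 * (i : ℂ) ^ 2 - 1) / 12 * c else 0) • v := by
  have := congrArg (fun f => f v) (h.rel.comm_GG i j)
  simp only [LinearMap.add_apply, LinearMap.smul_apply, Module.End.mul_apply,
    Module.End.one_apply, smul_smul, ite_mul, zero_mul] at this
  rw [add_assoc, ← this]; abel

lemma QQ (i j : ℤ) (v : M) : X .Q i (X .Q j v) = -X .Q j (X .Q i v) +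
    (if i + j = 0 then a else 0) • v := by
  have := congrArg (fun f => f v) (h.rel.comm_QQ i j)
  simp only [LinearMap.add_apply, LinearMap.smul_apply, Module.End.mul_apply,
    Module.End.one_apply, smul_smul, ite_mul, zero_mul, one_mul] at this
  rw [← this]; abel

/-- Uniform shape of the brackets. -/
lemma bracket (g g' : HVGen) (i j : ℤ) : ∃ (σ κ κ' : ℂ) (e : HVGen), (i + j ≠ 0 → κ' = 0) ∧
    ∀ v, X g i (X g' j v) = σ • X g' j (X g i v) + κ • X e (i + j) v + κ' • v := by
  have hc : ∀ z : ℂ, i + j ≠ 0 → (if i + j = 0 then z else 0) = 0 := fun z hz => if_neg hz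
  have hc' : ∀ z : ℂ, i + j ≠ 0 → (if j + i = 0 then z else 0) = 0 := fun z hz =>
    if_neg (by rwa [add_comm])
  have hn : ∀ z : ℂ, i + j ≠ 0 → -(if j + i = 0 then z else 0) = 0 := fun z hz => by
    rw [hc' z hz, neg_zero]
  cases g <;> cases g'
  · exact ⟨1, _, _, .L, hc _, fun v => by rw [h.LL, one_smul]⟩
  · exact ⟨1, _, _, .H, hc _, fun v => by rw [h.LH, one_smul]⟩
  · exact ⟨1, (j : ℂ) - i / 2, 0, .G, fun _ => rfl, fun v => by rw [h.LG, one_smul, zero_smul, add_zero]⟩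
  · exact ⟨1, (j : ℂ) + i / 2, 0, .Q, fun _ => rfl, fun v => by rw [h.LQ, one_smul, zero_smul, add_zero]⟩
  · refine ⟨1, -(i : ℂ), _, .H, hn (((j : ℂ) ^ 2 + j) * l), fun v => ?_⟩
    rw [h.LH j i, add_comm j i]; module
  · exact ⟨1, 0, _, .H, hc _, fun v => by rw [h.HH, one_smul, zero_smul, add_zero]⟩
  · refine ⟨1, (i : ℂ), 0, .Q, fun _ => rfl, fun v => ?_⟩
    rw [h.GH j i, add_comm j i]; module
  · exact ⟨1, 0, 0, .H, fun _ => rfl, fun v => by rw [h.HQ]; module⟩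
  · refine ⟨1, -((i : ℂ) - j / 2), 0, .G, fun _ => rfl, fun v => ?_⟩
    rw [h.LG j i, add_comm j i]; module
  · exact ⟨1, -(j : ℂ), 0, .Q, fun _ => rfl, fun v => by rw [h.GH, one_smul, zero_smul, add_zero]⟩
  · refine ⟨-1, _, _, .L, hc _, fun v => by rw [h.GG, neg_one_smul]⟩
  · refine ⟨-1, 1, _, .H, hc _, fun v => by rw [h.GQ, neg_one_smul, one_smul]⟩
  · refine ⟨1, -((i : ℂ) + j / 2), 0, .Q, fun _ => rfl, fun v => ?_⟩
    rw [h.LQ j i, add_comm j i]; module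
  · exact ⟨1, 0, 0, .H, fun _ => rfl, fun v => by rw [h.HQ]; module⟩
  · refine ⟨-1, 1, _, .H, hc' ((2 * (j : ℂ) - 1) * l), fun v => ?_⟩
    rw [h.GQ j i, add_comm j i]; module
  · exact ⟨-1, 0, _, .H, hc _, fun v => by rw [h.QQ, neg_one_smul, zero_smul, add_zero]⟩

lemma L0X (g : HVGen) (j : ℤ) (v : M) : X .L 0 (X g j v) = X g j (X .L 0 v) + (j : ℂ) • X g j v := by
  cases g
  · rw [h.LL]; simp
  · rw [h.LH]; simp
  · rw [h.LG]; simp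
  · rw [h.LQ]; simp

/-- Stability under generators of degree `s` and `2 * s` implies stability in degrees `sn`. -/
lemma generate {s : ℤ} (hs : s = 1 ∨ s = -1) {N : Submodule ℂ M}
    (h1 : ∀ g, ∀ v ∈ N, X g s v ∈ N) (h2 : ∀ g, ∀ v ∈ N, X g (2 * s) v ∈ N) (n : ℕ) :
    ∀ g, ∀ v ∈ N, X g (s * (n + 1)) v ∈ N := by
  have hsc : (s : ℂ) ≠ 0 := by rcases hs with rfl | rfl <;> norm_num
  induction n with
  | zero => simpa using h1
  | succ n ih =>
    have key : ∀ g e : HVGen, ∀ v ∈ N, ∀ κ : ℂ, κ ≠ 0 →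
        X .L s (X g (s * (n + 1)) v) = X g (s * (n + 1)) (X .L s v) +
          κ • X g (s * ((n + 1 : ℕ) + 1)) v → X g (s * ((n + 1 : ℕ) + 1)) v ∈ N := by
      intro g e v hv κ hκ he
      have : X g (s * ((n + 1 : ℕ) + 1)) v =
          κ⁻¹ • (X .L s (X g (s * (n + 1)) v) - X g (s * (n + 1)) (X .L s v)) := by
        rw [he, add_sub_cancel_left, smul_smul, inv_mul_cancel₀ hκ, one_smul]
      rw [this]
      exact N.smul_mem _ (N.sub_mem (h1 _ _ (ih _ _ hv)) (ih _ _ (h1 _ _ hv)))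
    have e1 : s * ((n + 1 : ℕ) + 1) = s + s * (n + 1) := by push_cast; ring
    have hne : s + s * (n + 1) ≠ 0 := by rcases hs with rfl | rfl <;> omega
    have hnc : (n : ℂ) + 1 ≠ 0 := by exact_mod_cast Nat.succ_ne_zero n
    intro g v hv
    cases g
    · rcases Nat.eq_zero_or_pos n with rfl | hn
      · have := h2 .L v hv
        rwa [show s * (((0 + 1 : ℕ) : ℤ) + 1) = 2 * s by push_cast; ring]
      · refine key .L .L v hv (s * n) (mul_ne_zero hsc (by exact_mod_cast hn.ne')) ?_
        rw [h.LL, if_neg hne, e1]; push_cast; module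
    · refine key .H .L v hv (s * (n + 1)) (mul_ne_zero hsc hnc) ?_
      rw [h.LH, if_neg hne, e1]; push_cast; module
    · refine key .G .L v hv (s * (n + 1 - 1 / 2)) (mul_ne_zero hsc ?_) ?_
      · intro h0
        have : ((2 * n + 1 : ℕ) : ℂ) = 0 := by push_cast; linear_combination 2 * h0
        exact absurd (Nat.cast_eq_zero.1 this) (by omega)
      · rw [h.LG, e1]; push_cast; module
    · refine key .Q .L v hv (s * (n + 1 + 1 / 2)) (mul_ne_zero hsc ?_) ?_
      · intro h0
        have : ((2 * n + 3 : ℕ) : ℂ) = 0 := by push_cast; linear_combination 2 * h0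
        exact absurd (Nat.cast_eq_zero.1 this) (by omega)
      · rw [h.LQ, e1]; push_cast; module

lemma generate_all {N : Submodule ℂ M}
    (hN : ∀ g (i : ℤ), -2 ≤ i → i ≤ 2 → ∀ v ∈ N, X g i v ∈ N) : ∀ g i, ∀ v ∈ N, X g i v ∈ N := by
  intro g i v hv
  rcases lt_trichotomy i 0 with hi | rfl | hi
  · have := h.generate (s := -1) (.inr rfl) (N := N) (fun g => hN g _ (by norm_num) (by norm_num))
      (fun g => hN g _ (by norm_num) (by norm_num)) (-i - 1).toNat g v hv
    rwa [show -1 * (((-i - 1).toNat : ℤ) + 1) = i by omega] at this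
  · exact hN g 0 (by norm_num) (by norm_num) v hv
  · have := h.generate (s := 1) (.inl rfl) (N := N) (fun g => hN g _ (by norm_num) (by norm_num))
      (fun g => hN g _ (by norm_num) (by norm_num)) (i - 1).toNat g v hv
    rwa [show 1 * (((i - 1).toNat : ℤ) + 1) = i by omega] at this
end basic
end HVRel

lemma HVData.parity {M : Type} [AddCommGroup M] [Module ℂ M] {X : HVGen → ℤ → End ℂ M}
    {c l a lam : ℂ} {p : End ℂ M} (h : HVData X c l a lam p) (g : HVGen) (i : ℤ) :
    (∀ v, p (X g i v) = X g i (p v)) ∨ (∀ v, p (X g i v) = X g i (v - p v)) := by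
  cases g
  · exact .inl (h.pL i)
  · exact .inl (h.pH i)
  · exact .inr (h.pG i)
  · exact .inr (h.pQ i)

/-- The weight space of weight `lam + k`. -/
abbrev hvWt {M : Type} [AddCommGroup M] [Module ℂ M] (X : HVGen → ℤ → End ℂ M) (lam : ℂ) (k : ℤ) :
    Submodule ℂ M := (X .L 0).eigenspace (lam + k)

/-- The smallest subspace containing `S` and stable under the operators in `F`. -/
def stableClosure {M : Type*} [AddCommGroup M] [Module ℂ M] (F : Set (End ℂ M)) (S : Set M) :
    Submodule ℂ M := sInf {N | S ⊆ N ∧ ∀ f ∈ F, ∀ v ∈ N, f v ∈ N}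

section
variable {M : Type*} [AddCommGroup M] [Module ℂ M] {F : Set (End ℂ M)} {S : Set M}

lemma subset_stableClosure : S ⊆ stableClosure F S := fun _ hv =>
  (Submodule.mem_sInf).2 fun _ hN => hN.1 hv

lemma stableClosure_stable {f : End ℂ M} (hf : f ∈ F) {v : M} (hv : v ∈ stableClosure F S) :
    f v ∈ stableClosure F S :=
  (Submodule.mem_sInf).2 fun N hN => hN.2 f hf v ((Submodule.mem_sInf).1 hv N hN)

lemma stableClosure_le {N : Submodule ℂ M} (h1 : S ⊆ N) (h2 : ∀ f ∈ F, ∀ v ∈ N, f v ∈ N) :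
    stableClosure F S ≤ N := sInf_le ⟨h1, h2⟩
end

namespace HVData
variable {M : Type} [AddCommGroup M] [Module ℂ M] {X : HVGen → ℤ → End ℂ M}
    {c l a lam : ℂ} {p : End ℂ M}

lemma mem_hvWt {k : ℤ} {v : M} : v ∈ hvWt X lam k ↔ X .L 0 v = (lam + k) • v :=
  Module.End.mem_eigenspace_iff

lemma iSupIndep_hvWt : iSupIndep (hvWt X lam) := by
  refine (Module.End.eigenspaces_iSupIndep (X .L 0)).comp (f := fun k : ℤ => lam + (k : ℂ)) ?_
  intro k l hkl
  simpa using hkl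

section basic
variable (h : HVData X c l a lam p)
include h

lemma X_mem {k j : ℤ} (g : HVGen) {v : M} (hv : v ∈ hvWt X lam k) : X g j v ∈ hvWt X lam (k + j) := by
  rw [mem_hvWt] at *
  rw [h.L0X, hv, map_smul]
  push_cast; module

lemma X_mem' {k j : ℤ} (g : HVGen) {v : M} (hv : v ∈ hvWt X lam k) {n : ℤ} (hn : k + j = n) :
    X g j v ∈ hvWt X lam n := hn ▸ h.X_mem g hv

lemma p_mem {k : ℤ} {v : M} (hv : v ∈ hvWt X lam k) : p v ∈ hvWt X lam k := by
  rw [mem_hvWt] at *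
  rw [← h.pL, hv, map_smul]

lemma p_killed {g : HVGen} {i : ℤ} {v : M} (hv : ∀ g, X g i v = 0) : X g i (p v) = 0 := by
  rcases h.parity g i with hp | hp
  · rw [← hp, hv, map_zero]
  · have := hp v
    rw [hv, map_zero, map_sub, hv, zero_sub] at this
    exact (neg_eq_zero.1 this.symm)

omit h in
lemma wt_eq_zero_of_mem {k : ℤ} {S : Set ℤ} (hk : k ∉ S) {v : M} (hv : v ∈ hvWt X lam k)
    (hv' : v ∈ ⨆ j ∈ S, hvWt X lam j) : v = 0 :=
  (Submodule.disjoint_def.1 (iSupIndep_hvWt.disjoint_biSup hk)) v hv hv'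

/-- If some nonzero vector is killed by all generators of large degree, then the weights are
bounded above. -/
theorem wt_eq_bot_of_killed {v₀ : M} (hv₀ : v₀ ≠ 0) {N₀ : ℤ}
    (hN₀ : ∀ g, ∀ j ≥ N₀, X g j v₀ = 0) : ∃ K : ℤ, ∀ k ≥ K, hvWt X lam k = ⊥ := by
  -- every vector is killed by all generators of large degree
  have hloc : ∀ v : M, ∃ N : ℤ, ∀ g, ∀ j ≥ N, X g j v = 0 := by
    let 𝒦 : Submodule ℂ M :=
      { carrier := {v | ∃ N : ℤ, ∀ g, ∀ j ≥ N, X g j v = 0}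
        zero_mem' := ⟨0, fun _ _ _ => map_zero _⟩
        add_mem' := by
          rintro u v ⟨N, hN⟩ ⟨N', hN'⟩
          refine ⟨max N N', fun g j hj => ?_⟩
          rw [map_add, hN g j (le_of_max_le_left hj), hN' g j (le_of_max_le_right hj), add_zero]
        smul_mem' := by
          rintro z v ⟨N, hN⟩
          exact ⟨N, fun g j hj => by rw [map_smul, hN g j hj, smul_zero]⟩ }
    have hst : ∀ g i, ∀ v ∈ 𝒦, X g i v ∈ 𝒦 := by
      rintro g i v ⟨N, hN⟩
      refine ⟨max (max N (N - i)) (1 - i), fun g' j hj => ?_⟩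
      obtain ⟨σ, κ, κ', e, hκ, hb⟩ := h.bracket g' g j i
      rw [hb, hκ (by omega), hN g' j (by omega), hN e (j + i) (by omega)]
      simp
    have hp : ∀ v ∈ 𝒦, p v ∈ 𝒦 := by
      rintro v ⟨N, hN⟩
      exact ⟨N, fun g j hj => h.p_killed fun g => hN g j hj⟩
    rcases h.simple 𝒦 hst hp with h0 | h1
    · exact absurd ((Submodule.mem_bot ℂ).1 (h0 ▸ (⟨N₀, hN₀⟩ : v₀ ∈ 𝒦))) hv₀
    · exact fun v => (h1 ▸ Submodule.mem_top : v ∈ 𝒦)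
  have hfd : ∀ F : Submodule ℂ M, F.FG → ∃ N : ℤ, ∀ v ∈ F, ∀ g, ∀ j ≥ N, X g j v = 0 := by
    intro F hF
    induction F, hF using Submodule.fg_induction with
    | singleton x =>
      obtain ⟨N, hN⟩ := hloc x
      refine ⟨N, fun v hv g j hj => ?_⟩
      obtain ⟨z, rfl⟩ := Submodule.mem_span_singleton.1 hv
      rw [map_smul, hN g j hj, smul_zero]
    | sup F₁ F₂ _ _ h1 h2 =>
      obtain ⟨N, hN⟩ := h1
      obtain ⟨N', hN'⟩ := h2
      refine ⟨max N N', fun v hv g j hj => ?_⟩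
      obtain ⟨y, hy, z, hz, rfl⟩ := Submodule.mem_sup.1 hv
      rw [map_add, hN y hy g j (le_of_max_le_left hj), hN' z hz g j (le_of_max_le_right hj),
        add_zero]
  have hfg : ∀ k, (hvWt X lam k).FG := fun k => by
    have := h.fin k
    exact IsNoetherian.noetherian _ |> fun h : (⊤ : Submodule ℂ (hvWt X lam k)).FG => by
      simpa using h.map (hvWt X lam k).subtype
  obtain ⟨n0, hn0⟩ := hfd _ (hfg 0)
  obtain ⟨n1, hn1⟩ := hfd _ (hfg 1)
  obtain ⟨n2, hn2⟩ := hfd _ (hfg 2)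
  set N : ℤ := max (max (max n0 n1) n2) 1 with hNdef
  -- the module is generated from the part of low weight by raising operators
  set F : Set (End ℂ M) := insert p {f | ∃ g, f = X g 1 ∨ f = X g 2} with hF
  set S : Set M := {v | ∃ k ≤ 2, v ∈ hvWt X lam k} with hS
  have h𝒫 : stableClosure F S = ⊤ := by
    have hst : ∀ g (i : ℤ), -2 ≤ i → i ≤ 2 → ∀ v ∈ stableClosure F S, X g i v ∈ stableClosure F S := by
      have hpos : ∀ g (i : ℤ), 1 ≤ i → i ≤ 2 → ∀ v ∈ stableClosure F S,
          X g i v ∈ stableClosure F S := by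
        intro g i h1 h2 v hv
        obtain rfl | rfl : i = 1 ∨ i = 2 := by omega
        · exact stableClosure_stable (.inr ⟨g, .inl rfl⟩) hv
        · exact stableClosure_stable (.inr ⟨g, .inr rfl⟩) hv
      let 𝒫' : Submodule ℂ M :=
        { carrier := {v | v ∈ stableClosure F S ∧
            ∀ g (i : ℤ), -2 ≤ i → i ≤ 0 → X g i v ∈ stableClosure F S}
          zero_mem' := ⟨zero_mem _, fun _ _ _ _ => by simp⟩
          add_mem' := by
            rintro u v ⟨hu, hu'⟩ ⟨hv, hv'⟩
            refine ⟨add_mem hu hv, fun g i h1 h2 => ?_⟩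
            rw [map_add]
            exact add_mem (hu' g i h1 h2) (hv' g i h1 h2)
          smul_mem' := by
            rintro z v ⟨hv, hv'⟩
            refine ⟨Submodule.smul_mem _ _ hv, fun g i h1 h2 => ?_⟩
            rw [map_smul]
            exact Submodule.smul_mem _ _ (hv' g i h1 h2) }
      have hle : stableClosure F S ≤ 𝒫' := by
        refine stableClosure_le ?_ ?_
        · rintro v ⟨k, hk, hv⟩
          exact ⟨subset_stableClosure ⟨k, hk, hv⟩, fun g i h1 h2 =>
            subset_stableClosure ⟨k + i, by omega, h.X_mem g hv⟩⟩
        · have hX : ∀ g (j : ℤ), 1 ≤ j → j ≤ 2 → ∀ v ∈ 𝒫', X g j v ∈ 𝒫' := by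
            rintro g j h1 h2 v ⟨hv, hv'⟩
            refine ⟨hpos g j h1 h2 v hv, fun g' i hi1 hi2 => ?_⟩
            obtain ⟨σ, κ, κ', e, -, hb⟩ := h.bracket g' g i j
            rw [hb]
            refine add_mem (add_mem (Submodule.smul_mem _ _ (hpos g j h1 h2 _ (hv' g' i hi1 hi2)))
              (Submodule.smul_mem _ _ ?_)) (Submodule.smul_mem _ _ hv)
            rcases le_or_gt (i + j) 0 with h0 | h0
            · exact hv' e _ (by omega) h0
            · exact hpos e _ (by omega) (by omega) v hv
          rintro f (rfl | ⟨g, rfl | rfl⟩)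
          · rintro v ⟨hv, hv'⟩
            have hps : ∀ w ∈ stableClosure F S, f w ∈ stableClosure F S := fun w hw =>
              stableClosure_stable (.inl rfl) hw
            refine ⟨hps _ hv, fun g i h1 h2 => ?_⟩
            rcases h.parity g i with hp | hp
            · rw [← hp]; exact hps _ (hv' g i h1 h2)
            · have := hp v
              rw [map_sub] at this
              rw [← sub_sub_cancel (X g i v) (X g i (f v)), ← this]
              exact sub_mem (hv' g i h1 h2) (hps _ (hv' g i h1 h2))
          · exact hX g 1 le_rfl (by norm_num)
          · exact hX g 2 (by norm_num) le_rfl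
      intro g i h1 h2 v hv
      rcases le_or_gt i 0 with h0 | h0
      · exact (hle hv).2 g i h1 h0
      · exact hpos g i h0 h2 v hv
    rcases h.simple (stableClosure F S) (h.generate_all hst)
      (fun v hv => stableClosure_stable (.inl rfl) hv) with h0 | h1
    · obtain ⟨w, hw, hw'⟩ := h.ne
      refine absurd ((Submodule.mem_bot ℂ).1 (h0 ▸ subset_stableClosure ?_)) hw
      exact ⟨0, by norm_num, mem_hvWt.2 (by simpa using hw')⟩
    · exact h1
  let Z : Submodule ℂ M :=
    { carrier := {v | ∀ g, ∀ j ≥ N, X g j v = 0}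
      zero_mem' := fun _ _ _ => map_zero _
      add_mem' := fun hu hv g j hj => by rw [map_add, hu g j hj, hv g j hj, add_zero]
      smul_mem' := fun z v hv g j hj => by rw [map_smul, hv g j hj, smul_zero] }
  have hZ012 : ∀ k, 0 ≤ k → k ≤ 2 → hvWt X lam k ≤ Z := by
    intro k h0 h2 v hv g j hj
    obtain rfl | rfl | rfl : k = 0 ∨ k = 1 ∨ k = 2 := by omega
    · exact hn0 v hv g j (by omega)
    · exact hn1 v hv g j (by omega)
    · exact hn2 v hv g j (by omega)
  have hlow : ∀ k, k ≤ 2 → hvWt X lam k ≤ (⨆ j ∈ Set.Iio (0 : ℤ), hvWt X lam j) ⊔ Z := by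
    intro k hk
    rcases lt_or_ge k 0 with h0 | h0
    · exact le_sup_of_le_left (le_biSup (fun j => hvWt X lam j) (show k ∈ Set.Iio (0 : ℤ) from h0))
    · exact le_sup_of_le_right (hZ012 k h0 hk)
  have hall : (⨆ j ∈ Set.Iio (0 : ℤ), hvWt X lam j) ⊔ Z = ⊤ := by
    rw [eq_top_iff, ← h𝒫]
    refine stableClosure_le ?_ ?_
    · rintro v ⟨k, hk, hv⟩
      exact hlow k hk hv
    · have hcomb : ∀ f : End ℂ M, (∀ j < 0, ∀ v ∈ hvWt X lam j,
          f v ∈ (⨆ j ∈ Set.Iio (0 : ℤ), hvWt X lam j) ⊔ Z) → (∀ v ∈ Z, f v ∈ Z) →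
          ∀ v ∈ (⨆ j ∈ Set.Iio (0 : ℤ), hvWt X lam j) ⊔ Z,
            f v ∈ (⨆ j ∈ Set.Iio (0 : ℤ), hvWt X lam j) ⊔ Z := by
        intro f h1 h2 v hv
        have : (⨆ j ∈ Set.Iio (0 : ℤ), hvWt X lam j) ⊔ Z ≤
            ((⨆ j ∈ Set.Iio (0 : ℤ), hvWt X lam j) ⊔ Z).comap f :=
          sup_le (iSup₂_le fun j hj v hv => h1 j hj v hv) fun v hv =>
            Submodule.mem_sup_right (h2 v hv)
        exact this hv
      have hXZ : ∀ g (i : ℤ), 1 ≤ i → ∀ v ∈ Z, X g i v ∈ Z := by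
        intro g i hi v hv g' j hj
        obtain ⟨σ, κ, κ', e, hκ, hb⟩ := h.bracket g' g j i
        rw [hb, hκ (by omega), hv g' j hj, hv e (j + i) (by omega)]
        simp
      rintro f (rfl | ⟨g, rfl | rfl⟩)
      · exact hcomb _ (fun j hj v hv => hlow j (by omega) (h.p_mem hv))
          fun v hv g j hj => h.p_killed fun g => hv g j hj
      · exact hcomb _ (fun j hj v hv => hlow (j + 1) (by omega) (h.X_mem g hv)) (hXZ g 1 le_rfl)
      · exact hcomb _ (fun j hj v hv => hlow (j + 2) (by omega) (h.X_mem g hv))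
          (hXZ g 2 (by norm_num))
  have hkill : ∀ k ≥ 0, ∀ v ∈ hvWt X lam k, ∀ g, ∀ j ≥ N, X g j v = 0 := by
    intro k hk v hv g j hj
    obtain ⟨u, hu, z, hz, huz⟩ := Submodule.mem_sup.1
      (hall ▸ Submodule.mem_top : v ∈ (⨆ j ∈ Set.Iio (0 : ℤ), hvWt X lam j) ⊔ Z)
    refine wt_eq_zero_of_mem (S := Set.Iio j) (k := k + j) (by simpa using hk) (h.X_mem g hv) ?_
    rw [← huz, map_add, hz g j hj, add_zero]
    have : (⨆ j ∈ Set.Iio (0 : ℤ), hvWt X lam j) ≤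
        (⨆ i ∈ Set.Iio j, hvWt X lam i).comap (X g j) :=
      iSup₂_le fun i hi w hw => Submodule.mem_iSup_of_mem (i + j)
        (Submodule.mem_iSup_of_mem (by simpa using hi) (h.X_mem g hw))
    exact this hu
  have hzero : ∀ k ≥ N + 2, hvWt X lam k ≠ ⊥ → lam + (k : ℂ) = 0 := by
    intro k hk hne
    obtain ⟨v, hv, hv0⟩ := Submodule.exists_mem_ne_zero_of_ne_bot hne
    have key : ∀ m : ℤ, N ≤ m → m ≤ k →
        (-2 * (m : ℂ)) * (lam + k) + ((m : ℂ) ^ 3 - m) / 12 * c = 0 := by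
      intro m h1 h2
      have e := h.LL m (-m) v
      rw [hkill (k + -m) (by omega) _ (h.X_mem .L hv) .L m h1, hkill k (by omega) v hv .L m h1,
        add_neg_cancel, if_pos rfl, mem_hvWt.1 hv, map_zero, zero_add, smul_smul, ← add_smul] at e
      have := (smul_eq_zero.1 e.symm).resolve_right hv0
      push_cast at this
      linear_combination this
    have k1 := key N le_rfl (by omega)
    have k2 := key (N + 1) (by omega) (by omega)
    have hN0 : (N : ℂ) ≠ 0 := by exact_mod_cast (by omega : N ≠ 0)
    have hN1 : (N : ℂ) + 1 ≠ 0 := by exact_mod_cast (by omega : N + 1 ≠ 0)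
    have hN2 : 2 * (N : ℂ) + 1 ≠ 0 := by exact_mod_cast (by omega : 2 * N + 1 ≠ 0)
    push_cast at k2
    have hc : c = 0 := by
      have : (N : ℂ) * (N + 1) * (2 * N + 1) * c = 0 := by
        linear_combination 12 * (N : ℂ) * k2 - 12 * ((N : ℂ) + 1) * k1
      simpa [hN0, hN1, hN2] using this
    rw [hc] at k1
    have : (N : ℂ) * (lam + k) = 0 := by linear_combination (-1 / 2) * k1
    exact (mul_eq_zero.1 this).resolve_left hN0
  by_cases hex : ∃ k ≥ N + 2, hvWt X lam k ≠ ⊥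
  · obtain ⟨k, hk, hne⟩ := hex
    refine ⟨k + 1, fun k' hk' => ?_⟩
    by_contra hne'
    have e1 := hzero k hk hne
    have e2 := hzero k' (by omega) hne'
    have : (k : ℂ) = k' := by linear_combination e1 - e2
    have : k = k' := by exact_mod_cast this
    omega
  · push Not at hex
    exact ⟨N + 2, hex⟩
end basic
end HVData

set_option linter.unusedSimpArgs false
set_option linter.unusedTactic false
set_option linter.unreachableTactic false
set_option linter.unusedSectionVars false

instance : Fintype HVGen := ⟨⟨([.L, .H, .G, .Q] : List HVGen), by simp⟩, fun x => by cases x <;> simp⟩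

/-- Existence of a generating extremal vector: of highest weight for `s = 1`, of lowest weight for
`s = -1`. -/
def HVExtremal {M : Type} [AddCommGroup M] [Module ℂ M] (X : HVGen → ℤ → End ℂ M) (s : ℤ) : Prop :=
  ∃ v : M, v ≠ 0 ∧ (∀ g i, 0 < s * i → X g i v = 0) ∧ (∃ z : ℂ, X .L 0 v = z • v) ∧
    (∃ z : ℂ, X .H 0 v = z • v) ∧
    ∀ N : Submodule ℂ M, (∀ g i, ∀ v ∈ N, X g i v ∈ N) → v ∈ N → N = ⊤

/-- The reflected generators. -/
def hvReflect {M : Type} [AddCommGroup M] [Module ℂ M] (X : HVGen → ℤ → End ℂ M) (l : ℂ) :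
    HVGen → ℤ → End ℂ M
  | .L, i => -X .L (-i)
  | .H, i => X .H (-i) - (if i = 0 then 2 * l else 0) • 1
  | .G, i => Complex.I • X .G (-i)
  | .Q, i => (-Complex.I) • X .Q (-i)

namespace HVData
variable {M : Type} [AddCommGroup M] [Module ℂ M] {X : HVGen → ℤ → End ℂ M}
    {c l a lam : ℂ} {p : End ℂ M}

section basic
variable (h : HVData X c l a lam p)
include h

lemma wt_zero_ne_bot : hvWt X lam 0 ≠ ⊥ := by
  obtain ⟨w, hw, hw'⟩ := h.ne
  exact Submodule.ne_bot_iff _ |>.2 ⟨w, mem_hvWt.2 (by simpa using hw'), hw⟩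

lemma exists_H_zero : ∃ d : ℂ, ∀ v, X .H 0 v = d • v := by
  have := h.fin 0
  have hm : ∀ v ∈ hvWt X lam 0, X .H 0 v ∈ hvWt X lam 0 := fun v hv => h.X_mem' .H hv (by simp)
  have : Nontrivial (hvWt X lam 0) := Submodule.nontrivial_iff_ne_bot.2 h.wt_zero_ne_bot
  obtain ⟨d, hd⟩ := Module.End.exists_eigenvalue ((X .H 0).restrict hm)
  obtain ⟨w, hw⟩ := hd.exists_hasEigenvector
  refine ⟨d, fun v => ?_⟩
  have hst : ∀ g i, ∀ v ∈ (X .H 0).eigenspace d, X g i v ∈ (X .H 0).eigenspace d := by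
    intro g i v hv
    rw [Module.End.mem_eigenspace_iff] at *
    rw [← map_smul, ← hv]
    cases g
    · rw [h.LH]; simp +contextual
    · rw [h.HH]; simp
    · rw [h.GH]; simp
    · rw [h.HQ]
  rcases h.simple _ hst (fun v hv => by
    rw [Module.End.mem_eigenspace_iff] at *
    rw [← h.pH, hv, map_smul]) with h0 | h1
  · refine absurd ?_ hw.2
    have : (w : M) ∈ (X .H 0).eigenspace d := by
      rw [Module.End.mem_eigenspace_iff]
      exact congrArg Subtype.val hw.apply_eq_smul
    rw [h0, Submodule.mem_bot] at this
    exact Subtype.ext this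
  · exact Module.End.mem_eigenspace_iff.1 (h1 ▸ Submodule.mem_top)

lemma extremal_of_wt_eq_bot {K : ℤ} (hK : ∀ k ≥ K, hvWt X lam k = ⊥) : HVExtremal X 1 := by
  obtain ⟨k, hk, hmax⟩ := Int.exists_greatest_of_bdd (P := fun k => hvWt X lam k ≠ ⊥)
    ⟨K, fun z hz => by by_contra hlt; exact hz (hK z (by omega))⟩ ⟨0, h.wt_zero_ne_bot⟩
  obtain ⟨u, hu, hu0⟩ := Submodule.exists_mem_ne_zero_of_ne_bot hk
  obtain ⟨v, hv, hv0, hpv⟩ : ∃ v ∈ hvWt X lam k, v ≠ 0 ∧ (p v = v ∨ p v = 0) := by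
    by_cases hp : p u = 0
    · exact ⟨u, hu, hu0, .inr hp⟩
    · exact ⟨p u, h.p_mem hu, hp, .inl (h.pp u)⟩
  obtain ⟨d, hd⟩ := h.exists_H_zero
  refine ⟨v, hv0, fun g i hi => ?_, ⟨_, mem_hvWt.1 hv⟩, ⟨d, hd v⟩, fun N hN hvN => ?_⟩
  · by_contra hne
    have := hmax (k + i) (Submodule.ne_bot_iff _ |>.2 ⟨_, h.X_mem g hv, hne⟩)
    omega
  · let N' : Submodule ℂ M := N ⊓ N.comap p
    have h1 : ∀ g i, ∀ v ∈ N', X g i v ∈ N' := by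
      rintro g i w ⟨hw, hw'⟩
      refine ⟨hN g i w hw, ?_⟩
      rw [SetLike.mem_coe, Submodule.mem_comap]
      rcases h.parity g i with hp | hp
      · rw [hp]; exact hN g i _ hw'
      · rw [hp]; exact hN g i _ (sub_mem hw hw')
    have h2 : ∀ w ∈ N', p w ∈ N' := by
      rintro w ⟨hw, hw'⟩
      refine ⟨hw', ?_⟩
      rw [SetLike.mem_coe, Submodule.mem_comap, h.pp]; exact hw'
    have h3 : v ∈ N' := ⟨hvN, by
      rw [SetLike.mem_coe, Submodule.mem_comap]
      rcases hpv with e | e <;> rw [e]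
      · exact hvN
      · exact N.zero_mem⟩
    rcases h.simple N' h1 h2 with e | e
    · rw [e, Submodule.mem_bot] at h3; exact absurd h3 hv0
    · rw [eq_top_iff, ← e]; exact inf_le_left

lemma mem_of_reflect {N : Submodule ℂ M} (hN : ∀ g i, ∀ v ∈ N, hvReflect X l g i v ∈ N) :
    ∀ g i, ∀ v ∈ N, X g i v ∈ N := by
  intro g i v hv
  have := hN g (-i) v hv
  cases g
  · simpa [hvReflect] using this
  · simp only [hvReflect, neg_neg, LinearMap.sub_apply, LinearMap.smul_apply,
      Module.End.one_apply] at this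
    have h2 := add_mem this (N.smul_mem (if -i = 0 then 2 * l else 0) hv)
    rwa [sub_add_cancel] at h2
  · simp only [hvReflect, neg_neg, LinearMap.smul_apply] at this
    simpa [smul_smul] using N.smul_mem (-Complex.I) this
  · simp only [hvReflect, neg_neg, LinearMap.smul_apply] at this
    simpa [smul_smul] using N.smul_mem (Complex.I) this

theorem reflect : HVData (hvReflect X l) (-c) (-l) (-a) (-lam) p where
  rel := by
    have e1 : ∀ i j : ℤ, -i + -j = -(i + j) := fun i j => by ring
    constructor
    · intro i j; ext v
      have hj : i + j = 0 → (j : ℂ) = -i := fun e => by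
        rw [eq_neg_iff_add_eq_zero, add_comm]; exact_mod_cast e
      simp only [hvReflect, LinearMap.sub_apply, LinearMap.add_apply, LinearMap.smul_apply,
        Module.End.mul_apply, LinearMap.neg_apply, map_neg, map_sub, map_smul, LinearMap.zero_apply,
        Module.End.one_apply, h.LL (-i) (-j), e1, neg_eq_zero]
      by_cases h1 : i + j = 0 <;> (try simp only [h1, if_true, if_false]) <;> push_cast <;>
        try rw [hj h1]
      all_goals match_scalars <;> ring
    · intro i j; ext v
      have hj : i + j = 0 → (j : ℂ) = -i := fun e => by
        rw [eq_neg_iff_add_eq_zero, add_comm]; exact_mod_cast e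
      simp only [hvReflect, LinearMap.sub_apply, LinearMap.add_apply, LinearMap.smul_apply,
        Module.End.mul_apply, LinearMap.neg_apply, map_neg, map_sub, map_smul, LinearMap.zero_apply,
        Module.End.one_apply, h.LH (-i) (-j), e1, neg_eq_zero]
      by_cases h1 : i + j = 0 <;> (try simp only [h1, if_true, if_false]) <;> push_cast <;>
        try rw [hj h1]
      all_goals match_scalars <;> ring
    · intro i j; ext v
      have hj : i + j = 0 → (j : ℂ) = -i := fun e => by
        rw [eq_neg_iff_add_eq_zero, add_comm]; exact_mod_cast e
      simp only [hvReflect, LinearMap.sub_apply, LinearMap.add_apply, LinearMap.smul_apply,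
        Module.End.mul_apply, LinearMap.neg_apply, map_neg, map_sub, map_smul, LinearMap.zero_apply,
        Module.End.one_apply, h.LG (-i) (-j), e1, neg_eq_zero]
      by_cases h1 : i + j = 0 <;> (try simp only [h1, if_true, if_false]) <;> push_cast <;>
        try rw [hj h1]
      all_goals match_scalars <;> ring
    · intro i j; ext v
      have hj : i + j = 0 → (j : ℂ) = -i := fun e => by
        rw [eq_neg_iff_add_eq_zero, add_comm]; exact_mod_cast e
      simp only [hvReflect, LinearMap.sub_apply, LinearMap.add_apply, LinearMap.smul_apply,
        Module.End.mul_apply, LinearMap.neg_apply, map_neg, map_sub, map_smul, LinearMap.zero_apply,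
        Module.End.one_apply, h.LQ (-i) (-j), e1, neg_eq_zero]
      by_cases h1 : i + j = 0 <;> (try simp only [h1, if_true, if_false]) <;> push_cast <;>
        try rw [hj h1]
      all_goals match_scalars <;> ring
    · intro i j; ext v
      have hj : i + j = 0 → (j : ℂ) = -i := fun e => by
        rw [eq_neg_iff_add_eq_zero, add_comm]; exact_mod_cast e
      simp only [hvReflect, LinearMap.sub_apply, LinearMap.add_apply, LinearMap.smul_apply,
        Module.End.mul_apply, LinearMap.neg_apply, map_neg, map_sub, map_smul, LinearMap.zero_apply,
        Module.End.one_apply, h.HH (-i) (-j), e1, neg_eq_zero]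
      by_cases h1 : i + j = 0 <;> (try simp only [h1, if_true, if_false]) <;> push_cast <;>
        try rw [hj h1]
      all_goals match_scalars <;> ring
    · intro i j; ext v
      have hj : i + j = 0 → (j : ℂ) = -i := fun e => by
        rw [eq_neg_iff_add_eq_zero, add_comm]; exact_mod_cast e
      simp only [hvReflect, LinearMap.sub_apply, LinearMap.add_apply, LinearMap.smul_apply,
        Module.End.mul_apply, LinearMap.neg_apply, map_neg, map_sub, map_smul, LinearMap.zero_apply,
        Module.End.one_apply, h.GH (-i) (-j), e1, neg_eq_zero]
      by_cases h1 : i + j = 0 <;> (try simp only [h1, if_true, if_false]) <;> push_cast <;>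
        try rw [hj h1]
      all_goals match_scalars <;> ring
    · intro i j; ext v
      have hj : i + j = 0 → (j : ℂ) = -i := fun e => by
        rw [eq_neg_iff_add_eq_zero, add_comm]; exact_mod_cast e
      simp only [hvReflect, LinearMap.sub_apply, LinearMap.add_apply, LinearMap.smul_apply,
        Module.End.mul_apply, LinearMap.neg_apply, map_neg, map_sub, map_smul, LinearMap.zero_apply,
        Module.End.one_apply, h.HQ (-i) (-j), e1, neg_eq_zero]
      by_cases h1 : i + j = 0 <;> (try simp only [h1, if_true, if_false]) <;> push_cast <;>
        try rw [hj h1]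
      all_goals match_scalars <;> ring
    · intro i j; ext v
      have hj : i + j = 0 → (j : ℂ) = -i := fun e => by
        rw [eq_neg_iff_add_eq_zero, add_comm]; exact_mod_cast e
      simp only [hvReflect, LinearMap.sub_apply, LinearMap.add_apply, LinearMap.smul_apply,
        Module.End.mul_apply, LinearMap.neg_apply, map_neg, map_sub, map_smul, LinearMap.zero_apply,
        Module.End.one_apply, h.GQ (-i) (-j), e1, neg_eq_zero]
      by_cases h1 : i + j = 0 <;> (try simp only [h1, if_true, if_false]) <;> push_cast <;>
        try rw [hj h1]
      all_goals match_scalars <;> ring_nf <;> try simp only [Complex.I_sq]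
      all_goals try ring
    · intro i j; ext v
      have hj : i + j = 0 → (j : ℂ) = -i := fun e => by
        rw [eq_neg_iff_add_eq_zero, add_comm]; exact_mod_cast e
      simp only [hvReflect, LinearMap.sub_apply, LinearMap.add_apply, LinearMap.smul_apply,
        Module.End.mul_apply, LinearMap.neg_apply, map_neg, map_sub, map_smul, LinearMap.zero_apply,
        Module.End.one_apply, h.GG (-i) (-j), e1, neg_eq_zero]
      by_cases h1 : i + j = 0 <;> (try simp only [h1, if_true, if_false]) <;> push_cast <;>
        try rw [hj h1]
      all_goals match_scalars <;> ring_nf <;> try simp only [Complex.I_sq]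
      all_goals try ring
    · intro i j; ext v
      have hj : i + j = 0 → (j : ℂ) = -i := fun e => by
        rw [eq_neg_iff_add_eq_zero, add_comm]; exact_mod_cast e
      simp only [hvReflect, LinearMap.sub_apply, LinearMap.add_apply, LinearMap.smul_apply,
        Module.End.mul_apply, LinearMap.neg_apply, map_neg, map_sub, map_smul, LinearMap.zero_apply,
        Module.End.one_apply, h.QQ (-i) (-j), e1, neg_eq_zero]
      by_cases h1 : i + j = 0 <;> (try simp only [h1, if_true, if_false]) <;> push_cast <;>
        try rw [hj h1]
      all_goals match_scalars <;> ring_nf <;> try simp only [Complex.I_sq]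
      all_goals try ring
    all_goals simp [mul_sub, sub_mul, smul_smul, mul_comm l c, mul_comm a c, mul_comm a l]
  pp := h.pp
  pL i v := by simp [hvReflect, h.pL]
  pH i v := by simp only [hvReflect, LinearMap.sub_apply, LinearMap.smul_apply, map_sub, map_smul, h.pH,
    Module.End.one_apply]
  pG i v := by simp [hvReflect, h.pG]
  pQ i v := by simp [hvReflect, h.pQ]
  simple N h1 h2 := h.simple N (h.mem_of_reflect h1) h2
  ne := by
    obtain ⟨v, hv, hv'⟩ := h.ne
    exact ⟨v, hv, by simp [hvReflect, hv']⟩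
  top := by
    rw [eq_top_iff, ← h.top]
    refine iSup_le fun k => le_iSup_of_le (-k) fun v hv => ?_
    rw [Module.End.mem_eigenspace_iff] at *
    simp only [hvReflect, neg_zero, LinearMap.neg_apply, hv]
    push_cast; module
  fin k := by
    have : (hvReflect X l .L 0).eigenspace (-lam + k) = (X .L 0).eigenspace (lam + (-k : ℤ)) := by
      ext v
      simp only [Module.End.mem_eigenspace_iff, hvReflect, neg_zero, LinearMap.neg_apply]
      rw [neg_eq_iff_eq_neg, ← neg_smul]
      push_cast
      rw [show -(-lam + (k : ℂ)) = lam + -k by ring]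
    rw [this]; exact h.fin _

lemma extremal_neg_of_reflect (hr : HVExtremal (hvReflect X l) 1) : HVExtremal X (-1) := by
  obtain ⟨v, hv, h1, ⟨z, hz⟩, -, h3⟩ := hr
  obtain ⟨d, hd⟩ := h.exists_H_zero
  refine ⟨v, hv, fun g i hi => ?_, ⟨-z, ?_⟩, ⟨d, hd v⟩, fun N hN => h3 N fun g i w hw => ?_⟩
  · have := h1 g (-i) (by omega)
    cases g <;> simpa [hvReflect, show i ≠ 0 by omega] using this
  · simpa [hvReflect, neg_eq_iff_eq_neg] using hz
  · cases g
    · exact N.neg_mem (hN _ _ _ hw)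
    · exact N.sub_mem (hN _ _ _ hw) (N.smul_mem _ hw)
    · exact N.smul_mem _ (hN _ _ _ hw)
    · exact N.smul_mem _ (hN _ _ _ hw)

/-- A vector killed by all generators of very negative degree forces a lowest weight vector. -/
lemma extremal_neg_of_killed {v₀ : M} (hv₀ : v₀ ≠ 0) {N₀ : ℤ}
    (hN₀ : ∀ g, ∀ j ≥ N₀, X g (-j) v₀ = 0) : HVExtremal X (-1) := by
  obtain ⟨K, hK⟩ := h.reflect.wt_eq_bot_of_killed hv₀ (N₀ := max N₀ 1) (fun g j hj => by
    have := hN₀ g j (le_of_max_le_left hj)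
    have hj : 1 ≤ j := le_of_max_le_right hj
    cases g <;> simp [hvReflect, this, show j ≠ 0 by omega])
  exact h.extremal_neg_of_reflect (h.reflect.extremal_of_wt_eq_bot hK)

lemma killed_add {v : M} {i j : ℤ} (hi : i < 0) (hj : j < 0) (h1 : ∀ g, X g i v = 0)
    (h2 : ∀ g, X g j v = 0) : ∀ g, X g (i + j) v = 0 := by
  have hne : i + j ≠ 0 := by omega
  have hj0 : (j : ℂ) ≠ 0 := by exact_mod_cast hj.ne
  intro g
  cases g
  · have := h.GG i j v
    rw [h1, h2, map_zero, map_zero, if_neg hne, zero_smul] at this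
    simpa using this
  · have := h.GQ i j v
    rw [h1, h2, map_zero, map_zero, if_neg hne, zero_smul] at this
    simpa using this.symm
  · have e1 := h.LG i j v
    have e2 := h.LG j i v
    rw [h1, h2, map_zero, map_zero, zero_add] at e1 e2
    rw [add_comm j i] at e2
    have e3 : (((j : ℂ) - i / 2) + (i - j / 2)) • X .G (i + j) v = 0 := by
      rw [add_smul, ← e1, ← e2, add_zero]
    refine (smul_eq_zero.1 e3).resolve_left fun e => hne ?_
    have : (i : ℂ) + j = 0 := by linear_combination 2 * e
    exact_mod_cast this
  · have := h.GH i j v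
    rw [h1, h2, map_zero, map_zero, zero_add] at this
    simpa [hj0] using this

lemma injective_of_not_extremal (hlw : ¬ HVExtremal X (-1)) {k : ℤ} (hk : 2 ≤ k) {v : M}
    (h1 : ∀ g, X g (-k) v = 0) (h2 : ∀ g, X g (1 - k) v = 0) : v = 0 := by
  by_contra hv
  refine hlw (h.extremal_neg_of_killed hv (N₀ := k * k) fun g j hj => ?_)
  have hmul : ∀ i : ℤ, i < 0 → (∀ g, X g i v = 0) → ∀ n : ℕ, ∀ g, X g (i * (n + 1)) v = 0 := by
    intro i hi h0 n
    induction n with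
    | zero => simpa using h0
    | succ n ih =>
      have := h.killed_add (i := i * (n + 1)) (j := i) (by nlinarith) hi ih h0
      rwa [show i * (n + 1) + i = i * (((n + 1 : ℕ) : ℤ) + 1) by push_cast; ring] at this
  obtain ⟨q, r, hqr, hr0, hr1⟩ : ∃ q r : ℤ, j = (k - 1) * q + r ∧ 0 ≤ r ∧ r < k - 1 :=
    ⟨j / (k - 1), j % (k - 1), (Int.mul_ediv_add_emod j (k - 1)).symm,
      Int.emod_nonneg _ (by omega), Int.emod_lt_of_pos _ (by omega)⟩
  have hq : r < q := by
    by_contra hle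
    nlinarith
  have e1 := hmul (1 - k) (by omega) h2 (q - r - 1).toNat
  rw [show (((q - r - 1).toNat : ℤ) + 1) = q - r by omega] at e1
  rcases hr0.eq_or_lt with rfl | hr
  · have := e1 g
    rwa [show (1 - k) * (q - 0) = -j by rw [hqr]; ring] at this
  · have e2 := hmul (-k) (by omega) h1 (r - 1).toNat
    rw [show (((r - 1).toNat : ℤ) + 1) = r by omega] at e2
    have := h.killed_add (by nlinarith) (by nlinarith) e1 e2 g
    rwa [show (1 - k) * (q - r) + -k * r = -j by rw [hqr]; ring] at this

lemma finrank_bound (hlw : ¬ HVExtremal X (-1)) :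
    ∃ C, ∀ k : ℤ, 2 ≤ k → finrank ℂ (hvWt X lam k) ≤ C := by
  have f0 := h.fin 0
  have f1 := h.fin 1
  refine ⟨finrank ℂ (HVGen → hvWt X lam 0 × hvWt X lam 1), fun k hk => ?_⟩
  let f : hvWt X lam k →ₗ[ℂ] (HVGen → hvWt X lam 0 × hvWt X lam 1) := LinearMap.pi fun g =>
    ((X g (-k)).restrict (p := hvWt X lam k) (q := hvWt X lam 0)
        fun v hv => h.X_mem' g hv (by omega)).prod
      ((X g (1 - k)).restrict (p := hvWt X lam k) (q := hvWt X lam 1)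
        fun v hv => h.X_mem' g hv (by omega))
  refine LinearMap.finrank_le_finrank_of_injective (f := f) ?_
  refine (injective_iff_map_eq_zero f).2 fun v hv => Subtype.ext ?_
  refine h.injective_of_not_extremal hlw hk (fun g => ?_) (fun g => ?_)
  · have := congrArg (fun w => ((w g).1 : M)) hv
    simpa [f] using this
  · have := congrArg (fun w => ((w g).2 : M)) hv
    simpa [f] using this

/-- A module which is neither of highest nor of lowest weight type is bounded, with nonzero weight
spaces in arbitrarily large degree. -/
theorem trichotomy : HVExtremal X 1 ∨ HVExtremal X (-1) ∨
    ((∃ C, ∀ k : ℤ, 2 ≤ k → finrank ℂ (hvWt X lam k) ≤ C) ∧ ∀ n, ∃ k ≥ n, hvWt X lam k ≠ ⊥) := by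
  by_cases h1 : HVExtremal X 1
  · exact .inl h1
  by_cases h2 : HVExtremal X (-1)
  · exact .inr (.inl h2)
  refine .inr (.inr ⟨h.finrank_bound h2, ?_⟩)
  by_contra hn
  push Not at hn
  obtain ⟨n, hn⟩ := hn
  exact h1 (h.extremal_of_wt_eq_bot hn)

end basic
end HVData

lemma eventually_eval_ne_zero {p : Polynomial ℂ} (hp : p ≠ 0) (x : ℂ) :
    ∀ᶠ k : ℕ in atTop, p.eval (x + k) ≠ 0 := by
  have hfin : {k : ℕ | p.eval (x + k) = 0}.Finite := by
    refine Set.Finite.of_injOn (f := fun k : ℕ => x + (k : ℂ)) (t := {z | p.IsRoot z})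
      (fun k hk => hk) ?_ (Polynomial.finite_setOfPred_isRoot hp)
    intro k _ l _ hkl
    simpa using hkl
  obtain ⟨N, hN⟩ := hfin.bddAbove
  filter_upwards [eventually_gt_atTop N] with k hk h0
  exact absurd (hN h0) (by omega)

open Polynomial in
lemma eventually_ladder_ne_zero (b b' x : ℂ) : ∀ᶠ k : ℕ in atTop,
    (x + k + 3 * b - 2) * (((x + k + b') * (x + k + 1 - b')) *
      ((x + k + 1 + b') * (x + k + 2 - b')) * ((x + k + 2 + b') * (x + k + 3 - b'))) -
    (x + k + b - 2) * (x + k + b - 1) * (x + k + b) *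
      ((x + k + 3 * b') * (x + k + 1 - b') * (x + k + 2 - b') * (x + k + 3 - b')) ≠ 0 := by
  let p : ℂ[X] := (X + C (3 * b - 2)) * (((X + C b') * (X + C (1 - b'))) *
      ((X + C (1 + b')) * (X + C (2 - b'))) * ((X + C (2 + b')) * (X + C (3 - b')))) -
    (X + C (b - 2)) * (X + C (b - 1)) * (X + C b) *
      ((X + C (3 * b')) * (X + C (1 - b')) * (X + C (2 - b')) * (X + C (3 - b')))
  have hp : p ≠ 0 := by
    intro h0
    have e : ∀ z : ℂ, p.eval z = 0 := fun z => by rw [h0, eval_zero]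
    simp only [p, eval_sub, eval_mul, eval_add, eval_X, eval_C] at e
    have h2 : (2880 : ℂ) = 0 := by
      linear_combination (e 6) - 6 * (e 5) + 15 * (e 4) - 20 * (e 3) + 15 * (e 2) - 6 * (e 1) + e 0
    norm_num at h2
  filter_upwards [eventually_eval_ne_zero hp x] with k hk h0
  apply hk
  simp only [p, eval_sub, eval_mul, eval_add, eval_X, eval_C]
  linear_combination h0

open Polynomial in
lemma eventually_locality_ne_zero (b b' s : ℂ) (hb : b ≠ 0) : ∀ᶠ q : ℕ in atTop, ∀ r ρ A A' K : ℂ,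
    r = s + q → ρ = b - r → A = b' * (1 - b') - ρ * (1 - ρ) →
    A' = b' * (1 - b') - (ρ - 1) * (2 - ρ) →
    (∀ ξ, K = (ξ + 2 * b') * (ξ + 1 - b') * (ξ + 2 - b') -
      3 * (ξ + b') * (ξ + 1 - b') * (ξ + 2 - ρ) + 3 * ξ * (ξ + 1 - ρ) * (ξ + 2 - ρ) -
      (ξ - ρ) * (ξ + 1 - ρ) * (ξ + 2 - ρ)) →
    (r + 2 * s) * A * A' + (r + s) * (r + 1 + s) * K ≠ 0 := by
  let p : ℂ[X] := (X + C (2 * s)) * (C (b' * (1 - b')) - (C b - X) * (C (1 - b) + X)) *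
      (C (b' * (1 - b')) - (C (b - 1) - X) * (C (2 - b) + X)) +
      (X + C s) * (X + C (1 + s)) * (C (2 * b' * (1 - b') * (2 - b')) -
      C (3 * b' * (1 - b')) * (C (2 - b) + X) - (X - C b) * (X + C (1 - b)) * (X + C (2 - b)))
  have hp : p ≠ 0 := by
    intro h0
    have e : ∀ z : ℂ, p.eval z = 0 := fun z => by rw [h0, eval_zero]
    simp only [p, eval_sub, eval_mul, eval_add, eval_X, eval_C] at e
    have h2 : b = 0 := by 
      linear_combination (-1 / 24) * (e 4 - 4 * (e 3) + 6 * (e 2) - 4 * (e 1) + e 0)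
    exact hb h2
  filter_upwards [eventually_eval_ne_zero hp s] with q hq r ρ A A' K hr hρ hA hA' hK h0
  apply hq
  simp only [p, eval_sub, eval_mul, eval_add, eval_X, eval_C]
  rw [hK 0, hA, hA', hρ, hr] at h0
  linear_combination h0

lemma ladder_elim {A₀ A₁ A₂ B₀ B₁ B₂ D E t₀ t₁ t₂ t₃ : ℂ} (h₀ : B₀ * t₀ = A₀ * t₁)
    (h₁ : B₁ * t₁ = A₁ * t₂) (h₂ : B₂ * t₂ = A₂ * t₃) (h : E * t₀ = D * t₃) :
    (E * (A₀ * A₁ * A₂) - B₀ * B₁ * B₂ * D) * t₀ = 0 := by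
  linear_combination (A₀ * A₁ * A₂) * h - D * (B₁ * B₂ * h₀ + A₀ * B₂ * h₁ + A₀ * A₁ * h₂)

section
variable {M : Type*} [AddCommGroup M] [Module ℂ M] {P : ℕ → End ℂ M} {Mk : ℕ → Submodule ℂ M}
  {lam : ℂ}

/-- A functional on a tail which transforms under `L_1` and `L_3` as if it had degree `-2` less is
zero. -/
theorem WTail.eventually_eq_zero_of_shift (h : WTail P Mk lam) (θ : Dual ℂ M) (b : ℂ)
    (h2 : ∀ᶠ k : ℕ in atTop, ∀ v ∈ Mk k, θ (P 2 v) = (lam + k + b - 2) * θ v)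
    (h4 : ∀ᶠ k : ℕ in atTop, ∀ v ∈ Mk k, θ (P 4 v) = (lam + k + 3 * b - 2) * θ v) :
    ∀ᶠ k : ℕ in atTop, ∀ v ∈ Mk k, θ v = 0 := by
  obtain ⟨q, hq⟩ := h.flag_induction (fun _ => θ) (by
    rintro b' K T v hF ⟨q₀, hT⟩
    refine ⟨0, fun _ _ => ?_⟩
    obtain ⟨N2, hN2⟩ := eventually_atTop.1 h2
    obtain ⟨N4, hN4⟩ := eventually_atTop.1 h4
    obtain ⟨NT, hNT⟩ := eventually_atTop.1 (hT q₀ le_rfl)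
    obtain ⟨NE, hNE⟩ := eventually_atTop.1 (eventually_ladder_ne_zero b b' lam)
    refine eventually_atTop.2 ⟨N2 + N4 + NT + NE + K, fun k hk => ?_⟩
    have two : ∀ j ≥ k, (lam + j + b - 2) * θ (v j) =
        ((lam + j + b') * (lam + j + 1 - b')) * θ (v (j + 1)) := by
      intro j hj
      have := hNT (j + 1) (by omega) _ (hF.vtwo j (by omega))
      rw [map_sub, map_smul, smul_eq_mul, hN2 j (by omega) _ (hF.mem j (by omega))] at this
      linear_combination this
    have four : (lam + k + 3 * b - 2) * θ (v k) =
        ((lam + k + 3 * b') * (lam + k + 1 - b') * (lam + k + 2 - b') * (lam + k + 3 - b')) *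
          θ (v (k + 3)) := by
      have e1 := h.comm_apply 2 3 (by norm_num) (v k)
      have t3 := hF.vthree k (by omega)
      have t2 := hF.vtwo k (by omega)
      have a1 := hNT _ (by omega) _ (hF.two _ (by omega) _ t3)
      have a2 := hNT _ (by omega) _ (hF.three _ (by omega) _ t2)
      have a3 := hNT _ (by omega) _ (hF.vtwo (k + 2) (by omega))
      have a4 := hNT _ (by omega) _ (hF.vthree (k + 1) (by omega))
      have e2 := congrArg θ e1
      simp only [map_sub, map_smul, smul_eq_mul, map_add, show 2 + 3 - 1 = 4 by norm_num] at e2 a1 a2 a3 a4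
      rw [hN4 k (by omega) _ (hF.mem k (by omega))] at e2
      push_cast at e2 a1 a2 a3 a4
      rw [show k + 1 + 2 = k + 3 by ring] at a4
      rw [show k + 2 + 1 = k + 3 by ring] at a3
      linear_combination a1 - a2 - e2 + (lam + k + 2 * b') * (lam + k + 1 - b') * (lam + k + 2 - b') * a3 -
        (lam + k + b') * (lam + k + 1 - b') * a4
    have t0 := two k le_rfl
    have t1 := two (k + 1) (by omega)
    have t2 := two (k + 2) (by omega)
    push_cast at t1 t2
    have := hNE k (by omega)
    refine (mul_eq_zero.1 (?_ : _ * θ (v k) = 0)).resolve_left this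
    rw [show k + 2 + 1 = k + 3 by ring] at t2
    rw [show k + 1 + 1 = k + 2 by ring] at t1
    have t1' : (lam + k + b - 1) * θ (v (k + 1)) = ((lam + k + 1 + b') * (lam + k + 2 - b')) *
        θ (v (k + 2)) := by linear_combination t1
    have t2' : (lam + k + b) * θ (v (k + 2)) = ((lam + k + 2 + b') * (lam + k + 3 - b')) *
        θ (v (k + 3)) := by linear_combination t2
    exact ladder_elim t0 t1' t2' four)
  exact hq q le_rfl

theorem WTail.eventually_eq_zero_of_locality (h : WTail P Mk lam) (Θ : ℕ → Dual ℂ M) (b s : ℂ)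
    (hb : b ≠ 0)
    (h0 : ∀ q : ℕ, ∀ᶠ k : ℕ in atTop, ∀ v ∈ Mk k,
      Θ q (P 1 v) - Θ q (P 0 v) = (b - (s + q)) * Θ q v)
    (h1 : ∀ q : ℕ, ∀ᶠ k : ℕ in atTop, ∀ v ∈ Mk k,
      Θ q (P 2 v) - 2 * Θ q (P 1 v) + Θ q (P 0 v) = -(s + q + s) * Θ (q + 1) v)
    (h2 : ∀ q : ℕ, ∀ᶠ k : ℕ in atTop, ∀ v ∈ Mk k,
      Θ q (P 3 v) - 3 * Θ q (P 2 v) + 3 * Θ q (P 1 v) - Θ q (P 0 v) =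
        -(s + q + 2 * s) * Θ (q + 2) v) :
    ∃ q₀, ∀ q ≥ q₀, ∀ᶠ k : ℕ in atTop, ∀ v ∈ Mk k, Θ q v = 0 := by
  refine h.flag_induction Θ ?_
  rintro b' K T v hF ⟨q₀, hT⟩
  obtain ⟨q₁, hq₁⟩ := eventually_atTop.1 (eventually_locality_ne_zero b b' s hb)
  have hall : ∀ q ≥ q₀, ∃ N ≥ K, ∀ k ≥ N,
      ((lam + k + 1) * Θ q (v (k + 1)) - Θ q (v k) = (b - (s + q)) * Θ q (v (k + 1))) ∧
      (((lam + k + 1 + b') * (lam + k + 2 - b')) * Θ q (v (k + 2)) -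
        2 * ((lam + k + 1) * Θ q (v (k + 1))) + Θ q (v k) =
        -(s + q + s) * Θ (q + 1) (v (k + 1))) ∧
      (((lam + k + 1 + 2 * b') * (lam + k + 2 - b') * (lam + k + 3 - b')) * Θ q (v (k + 3)) -
        3 * (((lam + k + 1 + b') * (lam + k + 2 - b')) * Θ q (v (k + 2))) +
        3 * ((lam + k + 1) * Θ q (v (k + 1))) - Θ q (v k) =
        -(s + q + 2 * s) * Θ (q + 2) (v (k + 1))) := by
    intro q hq
    obtain ⟨N0, hN0⟩ := eventually_atTop.1 (h0 q)
    obtain ⟨N1, hN1⟩ := eventually_atTop.1 (h1 q)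
    obtain ⟨N2, hN2⟩ := eventually_atTop.1 (h2 q)
    obtain ⟨NT, hNT⟩ := eventually_atTop.1 (hT q hq)
    refine ⟨N0 + N1 + N2 + NT + K, by omega, fun k hk => ?_⟩
    have hm := hF.mem (k + 1) (by omega)
    have e0 := hN0 (k + 1) (by omega) _ hm
    have e1 := hN1 (k + 1) (by omega) _ hm
    have e2 := hN2 (k + 1) (by omega) _ hm
    have a2 := hNT _ (by omega) _ (hF.vtwo (k + 1) (by omega))
    have a3 := hNT _ (by omega) _ (hF.vthree (k + 1) (by omega))
    have hd := h.diag _ _ hm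
    rw [hd, hF.vzero k (by omega)] at e0 e1 e2
    simp only [map_sub, map_smul, smul_eq_mul] at e0 e1 e2 a2 a3
    push_cast at e0 e1 e2 a2 a3
    rw [show k + 1 + 1 = k + 2 by ring] at a2
    rw [show k + 1 + 2 = k + 3 by ring] at a3
    refine ⟨?_, ?_, ?_⟩
    · linear_combination e0
    · linear_combination e1 - a2
    · linear_combination e2 - a3 + 3 * a2
  refine ⟨q₀ + q₁, fun q hq => ?_⟩
  obtain ⟨N, hNK, hN⟩ := hall q (by omega)
  obtain ⟨N', hNK', hN'⟩ := hall (q + 1) (by omega)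
  refine eventually_atTop.2 ⟨N + N' + 3, fun n hn => ?_⟩
  obtain ⟨k, rfl⟩ : ∃ k, n = k + 3 := ⟨n - 3, by omega⟩
  obtain ⟨a0, a1, a2⟩ := hN k (by omega)
  obtain ⟨b0, b1, -⟩ := hN (k + 1) (by omega)
  obtain ⟨c0, -, -⟩ := hN (k + 2) (by omega)
  obtain ⟨d0, d1, -⟩ := hN' k (by omega)
  obtain ⟨d0', -, -⟩ := hN' (k + 1) (by omega)
  rw [show k + 1 + 1 = k + 2 by ring] at b0 b1 d0'
  rw [show k + 1 + 2 = k + 3 by ring] at b1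
  rw [show k + 2 + 1 = k + 3 by ring] at c0
  rw [show q + 1 + 1 = q + 2 by ring] at d1
  push_cast at b0 b1 c0 d0 d1 d0'
  have hne := hq₁ q (by omega) (s + q) (b - (s + q))
    (b' * (1 - b') - (b - (s + q)) * (1 - (b - (s + q))))
    (b' * (1 - b') - ((b - (s + q)) - 1) * (2 - (b - (s + q)))) (2 * b' * (1 - b') * (2 - b') -
      3 * (b' * (1 - b')) * ((2 - b) + (s + q)) -
      ((s + q) - b) * ((s + q) + (1 - b)) * ((s + q) + (2 - b)))
    rfl rfl rfl rfl (fun ξ => by ring)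
  refine (mul_eq_zero.1 (?_ : _ * Θ q (v (k + 3)) = 0)).resolve_left hne
  set r : ℂ := s + q with hr
  set ρ : ℂ := b - r with hρ
  set x := Θ q (v (k + 3))
  set ξ : ℂ := lam + k + 1 with hξ
  have x2 : Θ q (v (k + 2)) = (ξ + 2 - ρ) * x := by linear_combination -c0
  have x1 : Θ q (v (k + 1)) = (ξ + 1 - ρ) * Θ q (v (k + 2)) := by linear_combination -b0
  have x0 : Θ q (v k) = (ξ - ρ) * Θ q (v (k + 1)) := by linear_combination -a0
  have y1 : Θ (q + 1) (v (k + 1)) = (ξ + 1 - (ρ - 1)) * Θ (q + 1) (v (k + 2)) := by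
    linear_combination -d0'
  have y0 : Θ (q + 1) (v k) = (ξ - (ρ - 1)) * Θ (q + 1) (v (k + 1)) := by linear_combination -d0
  have f1 : (b' * (1 - b') - ρ * (1 - ρ)) * x = -(r + s) * Θ (q + 1) (v (k + 2)) := by
    rw [x1, x2] at b1
    linear_combination b1
  have f2 : (b' * (1 - b') - (ρ - 1) * (2 - ρ)) * Θ (q + 1) (v (k + 2)) =
      -(r + 1 + s) * Θ (q + 2) (v (k + 1)) := by
    rw [y0, y1] at d1
    linear_combination d1
  have f3 : (2 * b' * (1 - b') * (2 - b') - 3 * (b' * (1 - b')) * (2 - b + r) -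
      (r - b) * (r + (1 - b)) * (r + (2 - b))) * x = -(r + 2 * s) * Θ (q + 2) (v (k + 1)) := by
    rw [x0, x1, x2] at a2
    linear_combination a2
  linear_combination (r + 2 * s) * (b' * (1 - b') - (ρ - 1) * (2 - ρ)) * f1 +
    (-(r + 2 * s) * (r + s)) * f2 + (r + s) * (r + 1 + s) * f3
end

section laurent
open LaurentPolynomial
variable {V : Type*} [AddCommGroup V] [Module ℂ V]

/-- The linear map on Laurent polynomials with prescribed values on monomials. -/
noncomputable def lpLift (y : ℤ → V) : LaurentPolynomial ℂ →ₗ[ℂ] V where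
  toFun f := f.coeff.sum fun n r => r • y n
  map_add' f g := by
    rw [AddMonoidAlgebra.coeff_add, Finsupp.sum_add_index'] <;> simp [add_smul]
  map_smul' r f := by
    rw [AddMonoidAlgebra.coeff_smul, Finsupp.sum_smul_index' (by simp), Finsupp.smul_sum]
    simp [smul_smul]

@[simp] lemma lpLift_T (y : ℤ → V) (n : ℤ) : lpLift y (T n) = y n := by
  have : (T n : LaurentPolynomial ℂ).coeff = Finsupp.single n 1 := rfl
  simp [lpLift, this]

lemma lp_induction {P : LaurentPolynomial ℂ → Prop} (hT : ∀ n, P (T n))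
    (hadd : ∀ f g, P f → P g → P (f + g)) (hs : ∀ (r : ℂ) f, P f → P (r • f)) (f) : P f := by
  induction f using LaurentPolynomial.induction_on' with
  | add p q hp hq => exact hadd _ _ hp hq
  | C_mul_T n r => rw [← smul_eq_C_mul]; exact hs _ _ (hT n)

/-- The diagonal operator `Tⁱ ↦ κ(i) Tⁱ`. -/
noncomputable def lpDiag (κ : ℤ → ℂ) : LaurentPolynomial ℂ →ₗ[ℂ] LaurentPolynomial ℂ := lpLift fun i => κ i • T i

/-- The Euler derivation `T d/dT`. -/
noncomputable def lpEuler : LaurentPolynomial ℂ →ₗ[ℂ] LaurentPolynomial ℂ := lpDiag fun i => (i : ℂ)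

/-- Evaluation at `1`. -/
noncomputable def lpOne : LaurentPolynomial ℂ →ₗ[ℂ] ℂ := lpLift fun _ => 1

/-- The constant term. -/
noncomputable def lpCT : LaurentPolynomial ℂ →ₗ[ℂ] ℂ := lpLift fun i => if i = 0 then 1 else 0

@[simp] lemma lpDiag_T (κ : ℤ → ℂ) (n : ℤ) : lpDiag κ (T n) = κ n • T n := lpLift_T _ _
@[simp] lemma lpEuler_T (n : ℤ) : lpEuler (T n) = (n : ℂ) • T n := lpLift_T _ _
@[simp] lemma lpOne_T (n : ℤ) : lpOne (T n) = 1 := lpLift_T _ _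
@[simp] lemma lpCT_T (n : ℤ) : lpCT (T n) = if n = 0 then 1 else 0 := lpLift_T _ _
@[simp] lemma lpOne_one : lpOne 1 = 1 := by rw [← T_zero, lpOne_T]
@[simp] lemma lpEuler_one : lpEuler 1 = 0 := by rw [← T_zero, lpEuler_T]; simp

@[simp] lemma lpEuler_mul (f g : LaurentPolynomial ℂ) :
    lpEuler (f * g) = lpEuler f * g + f * lpEuler g := by
  induction f using lp_induction with
  | hadd p q hp hq => simp only [add_mul, map_add, hp, hq]; ring
  | hs r p hp => simp only [smul_mul_assoc, map_smul, hp, smul_add]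
  | hT n =>
    induction g using lp_induction with
    | hadd p q hp hq => simp only [mul_add, map_add, hp, hq]; ring
    | hs r p hp => simp only [mul_smul_comm, map_smul, hp, smul_add]
    | hT m => 
      rw [← T_add, lpEuler_T, lpEuler_T, lpEuler_T, smul_mul_assoc, mul_smul_comm, ← T_add,
        ← add_smul]
      push_cast; rfl

@[simp] lemma lpOne_mul (f g : LaurentPolynomial ℂ) : lpOne (f * g) = lpOne f * lpOne g := by
  induction f using lp_induction with
  | hadd p q hp hq => simp only [add_mul, map_add, hp, hq]
  | hs r p hp => simp only [smul_mul_assoc, map_smul, hp, smul_eq_mul]; ring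
  | hT n =>
    induction g using lp_induction with
    | hadd p q hp hq => simp only [mul_add, map_add, hp, hq]
    | hs r p hp => simp only [mul_smul_comm, map_smul, hp, smul_eq_mul]; ring
    | hT m => rw [← T_add, lpOne_T, lpOne_T, lpOne_T, one_mul]

lemma lpEuler_pow (f : LaurentPolynomial ℂ) (n : ℕ) :
    lpEuler (f ^ (n + 1)) = ((n : ℂ) + 1) • (f ^ n * lpEuler f) := by
  induction n with
  | zero => simp
  | succ n ih =>
    rw [pow_succ, lpEuler_mul, ih]; push_cast
    rw [smul_mul_assoc, add_smul ((n : ℂ) + 1), one_smul]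
    congr 1
    rw [show f ^ n * lpEuler f * f = f ^ (n + 1) * lpEuler f by ring]

/-- The element `T - 1`. -/
noncomputable def lpU : LaurentPolynomial ℂ := T 1 - 1

@[simp] lemma lpEuler_lpU : lpEuler lpU = T 1 := by simp [lpU]
@[simp] lemma lpOne_lpU : lpOne lpU = 0 := by simp [lpU]

lemma lpOne_of_dvd {f : LaurentPolynomial ℂ} (h : lpU ∣ f) : lpOne f = 0 := by
  obtain ⟨g, rfl⟩ := h; simp

lemma dvd_lpEuler {f : LaurentPolynomial ℂ} {n : ℕ} (h : lpU ^ (n + 1) ∣ f) :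
    lpU ^ n ∣ lpEuler f := by
  obtain ⟨g, rfl⟩ := h
  rw [lpEuler_mul, lpEuler_pow, lpEuler_lpU]
  refine dvd_add ?_ ?_
  · exact ⟨((n : ℂ) + 1) • (T 1 * g), by rw [smul_mul_assoc, mul_smul_comm]; ring_nf⟩
  · exact ⟨lpU * lpEuler g, by ring⟩

lemma lpU_dvd_T_sub_one (k : ℤ) : lpU ∣ (T k - 1 : LaurentPolynomial ℂ) := by
  have hn : ∀ n : ℕ, lpU ∣ (T n - 1 : LaurentPolynomial ℂ) := fun n => by
    have := sub_dvd_pow_sub_pow (T 1 : LaurentPolynomial ℂ) 1 n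
    rwa [T_pow, one_pow, mul_one] at this
  rcases Int.eq_nat_or_neg k with ⟨n, rfl | rfl⟩
  · exact hn n
  · have := (hn n).mul_left (-(T (-n)))
    rwa [mul_sub, mul_one, neg_mul, ← T_add, neg_add_cancel, T_zero, sub_neg_eq_add,
      neg_add_eq_sub] at this

lemma lpU_pow_ne_zero (n : ℕ) : (lpU ^ n : LaurentPolynomial ℂ) ≠ 0 := by
  refine pow_ne_zero n ?_
  intro h
  have := congrArg lpEuler h
  rw [lpEuler_lpU, map_zero] at this
  have := congrArg lpOne this
  simp at this

/-- The constant term pairing is nondegenerate. -/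
lemma eq_zero_of_lpCT {f : LaurentPolynomial ℂ} (h : ∀ k, lpCT (f * T k) = 0) : f = 0 := by
  have key : ∀ k, lpCT (f * T k) = f.coeff (-k) := fun k => by
    clear h
    induction f using lp_induction with
    | hadd p q hp hq => rw [add_mul, map_add, hp, hq]; rfl
    | hs r p hp => rw [smul_mul_assoc, map_smul, hp]; rfl
    | hT n => rw [← T_add, lpCT_T, T_apply]; simp only [eq_neg_iff_add_eq_zero]
  ext k
  have := h (-k)
  rw [key, neg_neg] at this
  rw [this]; rfl

end laurent

open LaurentPolynomial

section opp
variable {V : Type*} [AddCommGroup V] [Module ℂ V]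

/-- The (opposite) bracket relation of the generators `e` and `e'`. -/
def OppBracket (x : HVGen → ℤ → End ℂ V) (e e' y : HVGen) (σ α β γ : ℂ) (κ : ℤ → ℂ) : Prop :=
  ∀ (i j : ℤ) (v : V), x e' j (x e i v) = σ • x e i (x e' j v) +
    (α * i + β * j + γ) • x y (i + j) v + (if i + j = 0 then κ i else 0) • v

/-- Right modules over the `N = 1` Heisenberg–Virasoro algebra. -/
structure HVOpp (x : HVGen → ℤ → End ℂ V) (c l a : ℂ) : Prop where
  LL : OppBracket x .L .L .L 1 (-1) 1 0 fun i => ((i : ℂ) ^ 3 - i) / 12 * c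
  LH : OppBracket x .L .H .H 1 0 1 0 fun i => ((i : ℂ) ^ 2 + i) * l
  LG : OppBracket x .L .G .G 1 (-1 / 2) 1 0 fun _ => 0
  LQ : OppBracket x .L .Q .Q 1 (1 / 2) 1 0 fun _ => 0
  HH : OppBracket x .H .H .H 1 0 0 0 fun i => i * a
  GH : OppBracket x .G .H .Q 1 0 (-1) 0 fun _ => 0
  HQ : OppBracket x .H .Q .H 1 0 0 0 fun _ => 0
  GQ : OppBracket x .G .Q .H (-1) 0 0 1 fun i => (2 * (i : ℂ) - 1) * l
  GG : OppBracket x .G .G .L (-1) 0 0 (-2) fun i => (4 * (i : ℂ) ^ 2 - 1) / 12 * c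
  QQ : OppBracket x .Q .Q .H (-1) 0 0 0 fun _ => a

/-- The action of Laurent polynomials. -/
noncomputable def lpAct (x : HVGen → ℤ → End ℂ V) (e : HVGen) : LaurentPolynomial ℂ →ₗ[ℂ] End ℂ V :=
  lpLift (x e)

variable {x : HVGen → ℤ → End ℂ V}

@[simp] lemma lpAct_T (e : HVGen) (n : ℤ) : lpAct x e (T n) = x e n := lpLift_T _ _

lemma OppBracket.act {e e' y : HVGen} {σ α β γ : ℂ} {κ : ℤ → ℂ}
    (h : OppBracket x e e' y σ α β γ κ) (f g : LaurentPolynomial ℂ) (v : V) :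
    lpAct x e' g (lpAct x e f v) = σ • lpAct x e f (lpAct x e' g v) +
      lpAct x y (α • (lpEuler f * g) + β • (f * lpEuler g) + γ • (f * g)) v +
      lpCT (lpDiag κ f * g) • v := by
  induction f using lp_induction with
  | hadd p q hp hq =>
    simp only [map_add, add_mul, LinearMap.add_apply, hp, hq, smul_add, add_smul]; abel
  | hs r p hp =>
    simp only [map_smul, map_add, smul_mul_assoc, LinearMap.smul_apply, hp, smul_add,
      LinearMap.add_apply, smul_comm _ r, smul_eq_mul, mul_smul]
  | hT n =>
    induction g using lp_induction with
    | hadd p q hp hq =>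
      simp only [map_add, mul_add, LinearMap.add_apply, hp, hq, smul_add, add_smul]; abel
    | hs r p hp =>
      simp only [map_smul, map_add, mul_smul_comm, LinearMap.smul_apply, hp, smul_add,
        LinearMap.add_apply, smul_comm _ r, smul_eq_mul, mul_smul]
    | hT m =>
      simp only [lpAct_T, lpEuler_T, lpDiag_T, smul_mul_assoc, mul_smul_comm, ← T_add, map_smul,
        map_add, lpCT_T, LinearMap.add_apply, LinearMap.smul_apply, h n m v, smul_smul, add_smul,
        smul_eq_mul, mul_ite, mul_one, mul_zero]

lemma OppBracket.swap {e e' y : HVGen} {σ α β γ : ℂ}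
    (h : OppBracket x e e' y σ α β γ fun _ => 0) (hσ : σ * σ = 1) :
    OppBracket x e' e y σ (-σ * β) (-σ * α) (-σ * γ) fun _ => 0 := by
  intro i j v
  have := h j i v
  rw [this]
  simp only [smul_add, smul_smul, hσ, add_comm j i, ite_self, zero_smul]
  module

/-- Uniform shape of the brackets when the centre acts by zero. -/
lemma HVOpp.uniform (h : HVOpp x 0 0 0) (e e' : HVGen) :
    ∃ (y : HVGen) (σ α β γ : ℂ), OppBracket x e e' y σ α β γ fun _ => 0 := by
  have LL := h.LL; have LH := h.LH; have HH := h.HH; have GQ := h.GQ; have GG := h.GG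
  have QQ := h.QQ
  simp only [mul_zero] at LL LH HH GQ GG QQ
  cases e <;> cases e'
  · exact ⟨_, _, _, _, _, LL⟩
  · exact ⟨_, _, _, _, _, LH⟩
  · exact ⟨_, _, _, _, _, h.LG⟩
  · exact ⟨_, _, _, _, _, h.LQ⟩
  · exact ⟨_, _, _, _, _, LH.swap (by norm_num)⟩
  · exact ⟨_, _, _, _, _, HH⟩
  · exact ⟨_, _, _, _, _, h.GH.swap (by norm_num)⟩
  · exact ⟨_, _, _, _, _, h.HQ⟩
  · exact ⟨_, _, _, _, _, h.LG.swap (by norm_num)⟩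
  · exact ⟨_, _, _, _, _, h.GH⟩
  · exact ⟨_, _, _, _, _, GG⟩
  · exact ⟨_, _, _, _, _, GQ⟩
  · exact ⟨_, _, _, _, _, h.LQ.swap (by norm_num)⟩
  · exact ⟨_, _, _, _, _, h.HQ.swap (by norm_num)⟩
  · exact ⟨_, _, _, _, _, GQ.swap (by norm_num)⟩
  · exact ⟨_, _, _, _, _, QQ⟩

/-- The functionals on which `L_i - L_0` acts by `i b`. -/
def HVEigen (x : HVGen → ℤ → End ℂ V) (b : ℂ) (φ : V) : Prop :=
  ∀ i : ℤ, x .L i φ = x .L 0 φ + (i * b) • φ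

lemma HVEigen.act {b : ℂ} {φ : V} (h : HVEigen x b φ) (f : LaurentPolynomial ℂ) :
    lpAct x .L f φ = lpOne f • x .L 0 φ + (lpOne (lpEuler f) * b) • φ := by
  induction f using lp_induction with
  | hadd p q hp hq => simp only [map_add, LinearMap.add_apply, hp, hq, add_smul, add_mul]; abel
  | hs r p hp =>
    simp only [map_smul, LinearMap.smul_apply, hp, smul_add, smul_smul, smul_eq_mul, mul_assoc]
  | hT n => simp [h n]

end opp

section opp
variable {V : Type*} [AddCommGroup V] [Module ℂ V] {x : HVGen → ℤ → End ℂ V}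

lemma lpDiag_zero : lpDiag (fun _ => 0) = 0 := by
  refine LinearMap.ext fun f => ?_
  induction f using lp_induction with
  | hadd p q hp hq => rw [map_add, hp, hq, map_add]
  | hs r p hp => rw [map_smul, hp, map_smul]
  | hT n => simp

lemma lpEuler_C (s : ℂ) : lpEuler (C s) = 0 := by
  rw [← mul_one (C s), ← smul_eq_C_mul, map_smul, lpEuler_one, smul_zero]

/-- The first order differential operator `f δ + s δ(f)`. -/
noncomputable def lpLie (s : ℂ) (f g : LaurentPolynomial ℂ) : LaurentPolynomial ℂ :=
  s • (lpEuler f * g) + f * lpEuler g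

lemma lpLie_identity (s : ℂ) (f f' u g : LaurentPolynomial ℂ) :
    lpLie s (f * u) (lpLie s f' g) - lpLie s f (lpLie s (u * f') g) +
      lpLie s (f * f' * lpEuler u) g =
    (s * s - s) • ((f * lpEuler f' - f' * lpEuler f) * lpEuler u * g) := by
  simp only [lpLie, lpEuler_mul, map_add, smul_eq_C_mul, map_sub, map_mul, lpEuler_C]
  ring

lemma HVEigen.lie_eq_zero {e : HVGen} {s b : ℂ} {φ : V} (hφ : HVEigen x b φ)
    (he : OppBracket x .L e e 1 s 1 0 fun _ => 0) {f g : LaurentPolynomial ℂ} (hf : lpU ∣ f)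
    (hg : lpAct x e g φ = 0) : lpAct x e (lpLie s f g) φ = 0 := by
  have h := he.act f g φ
  rw [hφ.act, lpOne_of_dvd hf, zero_smul, zero_add, map_smul, hg, smul_zero, map_zero, smul_zero,
    zero_add, one_smul, zero_smul, add_zero] at h
  rw [lpDiag_zero, LinearMap.zero_apply, zero_mul, map_zero, zero_smul, add_zero] at h
  exact h.symm

lemma HVEigen.ideal_eq_zero {e : HVGen} {s b : ℂ} {φ : V} (hφ : HVEigen x b φ)
    (he : OppBracket x .L e e 1 s 1 0 fun _ => 0) (hs : s * s - s ≠ 0) {g : LaurentPolynomial ℂ}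
    (hg : lpAct x e g φ = 0) (u : LaurentPolynomial ℂ) : lpAct x e (lpU ^ 2 * g * u) φ = 0 := by
  induction u using lp_induction with
  | hadd p q hp hq => rw [mul_add, map_add, LinearMap.add_apply, hp, hq, add_zero]
  | hs r p hp => rw [mul_smul_comm, map_smul, LinearMap.smul_apply, hp, smul_zero]
  | hT m =>
    obtain ⟨r, hr, hmr⟩ : ∃ r : ℤ, (r : ℂ) ≠ 0 ∧ ((m - r : ℤ) : ℂ) ≠ 0 := by
      by_cases h : m = 1
      · exact ⟨2, by norm_num, by subst h; norm_num⟩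
      · exact ⟨1, by norm_num, by rw [Int.cast_ne_zero]; omega⟩
    have h1 := hφ.lie_eq_zero he (f := lpU * T r) ⟨_, rfl⟩ hg
    have h2 := hφ.lie_eq_zero he (f := lpU * T (m - r)) ⟨_, rfl⟩ h1
    have h3 := hφ.lie_eq_zero he (f := T (m - r) * (lpU * T r)) ⟨T (m - r) * T r, by ring⟩ hg
    have h4 := hφ.lie_eq_zero he (f := lpU) ⟨1, by ring⟩ h3
    have h5 := hφ.lie_eq_zero he (f := lpU * (lpU * T r) * lpEuler (T (m - r)))
      ⟨lpU * T r * lpEuler (T (m - r)), by ring⟩ hg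
    have h6 := congrArg (fun z => lpAct x e z φ)
      (lpLie_identity s lpU (lpU * T r) (T (m - r)) g)
    simp only [map_add, map_sub, LinearMap.add_apply, LinearMap.sub_apply, h2, h4, h5, sub_zero,
      add_zero, map_smul, LinearMap.smul_apply] at h6
    have h7 := (smul_eq_zero.1 h6.symm).resolve_left hs
    have h8 : (lpU * lpEuler (lpU * T r) - lpU * T r * lpEuler lpU) * lpEuler (T (m - r)) * g =
        ((r : ℂ) * ((m - r : ℤ) : ℂ)) • (lpU ^ 2 * g * T m) := by
      have : (T m : LaurentPolynomial ℂ) = T (m - r) * T r := by rw [← T_add]; ring_nf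
      rw [this]
      simp only [lpEuler_mul, lpEuler_lpU, lpEuler_T, smul_eq_C_mul, map_mul]
      ring
    rw [h8, map_smul, LinearMap.smul_apply] at h7
    exact (smul_eq_zero.1 h7).resolve_left (mul_ne_zero hr hmr)

/-- The element `T + 1`. -/
noncomputable def lpW : LaurentPolynomial ℂ := T 1 + 1

lemma HVEigen.local_of_eq_zero {e : HVGen} {s b : ℂ} {φ : V} (hφ : HVEigen x b φ)
    (he : OppBracket x .L e e 1 s 1 0 fun _ => 0) (hs : s * s - s ≠ 0) {q : ℕ} {k : ℤ}
    (hg : lpAct x e ((T 2 - 1) ^ q * T k) φ = 0) :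
    ∃ N, ∀ f, lpU ^ N ∣ f → lpAct x e f φ = 0 := by
  have key : ∀ n m : ℕ, (∀ u, lpAct x e (lpU ^ m * lpW ^ n * u) φ = 0) →
      ∀ u, lpAct x e (lpU ^ (m + n) * u) φ = 0 := by
    intro n
    induction n with
    | zero => intro m h u; simpa using h u
    | succ n ih =>
      intro m h u
      have := ih (m + 1) (fun u => ?_) u
      · rwa [show m + (n + 1) = m + 1 + n by ring]
      have h1 := hφ.lie_eq_zero he (f := lpU) ⟨1, by ring⟩
        (h (((n : ℂ) + 1)⁻¹ • (T (-1) * u)))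
      have hw : lpEuler lpW = T 1 := by simp [lpW]
      have hn : ((n : ℂ) + 1) ≠ 0 := by exact_mod_cast n.succ_ne_zero
      have hTT : (T 1 * T (-1) : LaurentPolynomial ℂ) = 1 := by rw [← T_add]; simp
      have hm : ∃ r : LaurentPolynomial ℂ, lpEuler (lpU ^ m) * lpU = r * lpU ^ m := by
        cases m with
        | zero => exact ⟨0, by simp⟩
        | succ m => 
          refine ⟨((m : ℂ) + 1) • T 1, ?_⟩
          rw [lpEuler_pow, lpEuler_lpU, smul_mul_assoc, smul_mul_assoc]
          ring_nf
      obtain ⟨r, hr⟩ := hm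
      set ν : LaurentPolynomial ℂ := C ((n : ℂ) + 1) with hν
      set w : LaurentPolynomial ℂ := ((n : ℂ) + 1)⁻¹ • (T (-1) * u) with hw'
      have hνw : ν * w * T 1 = u := by
        rw [hν, hw', smul_eq_C_mul, ← mul_assoc, ← map_mul, mul_inv_cancel₀ hn, map_one, one_mul,
          mul_comm, ← mul_assoc, hTT, one_mul]
      have e1 : lpLie s lpU (lpU ^ m * lpW ^ (n + 1) * w) = lpU ^ m * lpW ^ (n + 1) *
          (C s * T 1 * w + r * w + lpU * lpEuler w) + lpU ^ (m + 1) * lpW ^ n * u := by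
        rw [lpLie, lpEuler_lpU, lpEuler_mul, lpEuler_mul, lpEuler_pow lpW n, hw]
        simp only [smul_eq_C_mul]
        rw [← hν]
        linear_combination (lpW ^ (n + 1) * w) * hr + lpU ^ (m + 1) * lpW ^ n * hνw
      rw [e1, map_add, LinearMap.add_apply, h, zero_add] at h1
      exact h1
  refine ⟨q + 2 + q, fun f ⟨u, hu⟩ => hu ▸ key q (q + 2) (fun u => ?_) u⟩
  have h1 := hφ.ideal_eq_zero he hs hg (T (-k) * u)
  convert h1 using 3
  have h2 : (T 2 - 1 : LaurentPolynomial ℂ) = lpU * lpW := by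
    rw [lpU, lpW, show (2 : ℤ) = 1 + 1 by norm_num, T_add]; ring
  have h3 : (T k * T (-k) : LaurentPolynomial ℂ) = 1 := by rw [← T_add]; simp
  rw [h2, mul_pow]
  linear_combination (-lpU ^ (q + 2) * lpW ^ q * u) * h3

end opp

section opp
variable {V : Type*} [AddCommGroup V] [Module ℂ V] {x : HVGen → ℤ → End ℂ V}

/-- The vector `φ` is killed by all `X ⊗ f` for `f` divisible by a high power of `T - 1`. -/
def HVLocal (x : HVGen → ℤ → End ℂ V) (φ : V) : Prop :=
  ∃ N, ∀ e f, lpU ^ N ∣ f → lpAct x e f φ = 0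

lemma lpDiag_congr {κ : ℤ → ℂ} (α β : ℂ) (hκ : ∀ i, κ i = α * i + β) (f : LaurentPolynomial ℂ) :
    lpDiag κ f = α • lpEuler f + β • f := by
  induction f using lp_induction with
  | hadd p q hp hq => rw [map_add, hp, hq, map_add]; simp only [smul_add]; abel
  | hs r p hp => rw [map_smul, hp, map_smul, smul_add, smul_comm r, smul_comm r]
  | hT n => rw [lpDiag_T, lpEuler_T, hκ, add_smul, mul_smul]

lemma lpCT_lpEuler (f : LaurentPolynomial ℂ) : lpCT (lpEuler f) = 0 := by
  induction f using lp_induction with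
  | hadd p q hp hq => rw [map_add, map_add, hp, hq, add_zero]
  | hs r p hp => rw [map_smul, map_smul, hp, smul_zero]
  | hT n => 
    rw [lpEuler_T, map_smul, lpCT_T]
    split_ifs with h <;> simp [h]

theorem HVOpp.local_of_eigen {l a b : ℂ} (h : HVOpp x 0 l a) {φ : V} (hφ0 : φ ≠ 0)
    (hφ : HVEigen x b φ) (hG : ∃ (q : ℕ) (k : ℤ), lpAct x .G ((T 2 - 1) ^ q * T k) φ = 0)
    (hQ : ∃ (q : ℕ) (k : ℤ), lpAct x .Q ((T 2 - 1) ^ q * T k) φ = 0) :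
    l = 0 ∧ a = 0 ∧ HVLocal x φ := by
  obtain ⟨_, _, hG⟩ := hG
  obtain ⟨_, _, hQ⟩ := hQ
  obtain ⟨NG, hNG⟩ := hφ.local_of_eq_zero h.LG (by norm_num) hG
  obtain ⟨NQ, hNQ⟩ := hφ.local_of_eq_zero h.LQ (by norm_num) hQ
  set N := NG + NQ + 1 with hN
  have gG : ∀ f, lpU ^ N ∣ f → lpAct x .G f φ = 0 := fun f hf =>
    hNG f ((pow_dvd_pow _ (by omega)).trans hf)
  have gQ : ∀ f, lpU ^ N ∣ f → lpAct x .Q f φ = 0 := fun f hf =>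
    hNQ f ((pow_dvd_pow _ (by omega)).trans hf)
  have hH : ∀ f g, lpU ^ N ∣ f → lpU ^ N ∣ g →
      lpAct x .H (f * g) φ + (l * lpCT ((2 : ℂ) • (lpEuler f * g) - f * g)) • φ = 0 := by
    intro f g hf hg
    have e := h.GQ.act f g φ
    rw [gG f hf, gQ g hg, map_zero, map_zero, smul_zero, zero_add, zero_smul, zero_smul, zero_add,
      zero_add, one_smul, lpDiag_congr (2 * l) (-l) (fun i => by ring)] at e
    rw [e]
    congr 2
    rw [← smul_eq_mul l, ← map_smul]
    congr 1
    simp only [smul_eq_C_mul, map_mul, map_neg]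
    ring
  have hl : l = 0 := by
    by_contra hl
    have h1 : ∀ k, lpCT (lpU ^ (N + N) * lpEuler (T k)) = 0 := by
      intro k
      have e1 := hH (lpU ^ N * T k) (lpU ^ N) ⟨_, rfl⟩ dvd_rfl
      have e2 := hH (lpU ^ N) (lpU ^ N * T k) dvd_rfl ⟨_, rfl⟩
      rw [show lpU ^ N * T k * lpU ^ N = lpU ^ N * (lpU ^ N * T k) by ring] at e1
      have e3 := sub_eq_zero.2 (e1.trans e2.symm)
      rw [add_sub_add_left_eq_sub, ← sub_smul, ← mul_sub, ← map_sub] at e3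
      have e4 := (mul_eq_zero.1 ((smul_eq_zero.1 e3).resolve_right hφ0)).resolve_left hl
      rw [show (2 : ℂ) • (lpEuler (lpU ^ N * T k) * lpU ^ N) - lpU ^ N * (lpU ^ N * T k) -
          ((2 : ℂ) • (lpEuler (lpU ^ N) * (lpU ^ N * T k)) - lpU ^ N * (lpU ^ N * T k)) =
          (2 : ℂ) • (lpU ^ (N + N) * lpEuler (T k)) by
        simp only [smul_eq_C_mul, lpEuler_mul]; ring, map_smul] at e4
      exact (smul_eq_zero.1 e4).resolve_left two_ne_zero
    have h2 : lpEuler (lpU ^ (N + N)) = 0 := by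
      refine eq_zero_of_lpCT fun k => ?_
      have := lpCT_lpEuler (lpU ^ (N + N) * T k)
      rw [lpEuler_mul, map_add, h1, add_zero] at this
      exact this
    rw [show N + N = (NG + NQ + N) + 1 by omega, lpEuler_pow, lpEuler_lpU] at h2
    have h3 := (smul_eq_zero.1 h2).resolve_left (Nat.cast_add_one_ne_zero _)
    have h4 := congrArg (· * (T (-1) : LaurentPolynomial ℂ)) h3
    simp only [zero_mul, mul_assoc, ← T_add] at h4
    rw [add_neg_cancel, T_zero, mul_one] at h4
    exact lpU_pow_ne_zero _ h4
  have ha : a = 0 := by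
    by_contra ha
    refine lpU_pow_ne_zero (N + N) (eq_zero_of_lpCT fun k => ?_)
    have e := h.QQ.act (lpU ^ N * T k) (lpU ^ N) φ
    rw [gQ _ ⟨_, rfl⟩, gQ _ dvd_rfl, map_zero, map_zero, smul_zero, zero_add, zero_smul, zero_smul,
      zero_smul, zero_add, zero_add, map_zero, LinearMap.zero_apply, zero_add,
      lpDiag_congr 0 a (fun i => by ring), zero_smul, zero_add, smul_mul_assoc,
      map_smul] at e
    have := (mul_eq_zero.1 ((smul_eq_zero.1 e.symm).resolve_right hφ0)).resolve_left ha
    refine Eq.trans (congrArg lpCT ?_) this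
    ring
  refine ⟨hl, ha, N + N, ?_⟩
  rintro e f hf
  have hfN : lpU ^ N ∣ f := (pow_dvd_pow _ (by omega)).trans hf
  cases e
  · have h2 : lpU ^ (0 + 1 + 1) ∣ f := (pow_dvd_pow _ (by omega)).trans hf
    rw [hφ.act, lpOne_of_dvd ((dvd_pow_self _ (by omega)).trans h2),
      lpOne_of_dvd ((dvd_pow_self _ (by omega)).trans (dvd_lpEuler h2))]
    simp
  · obtain ⟨u, rfl⟩ := hf
    have := hH (lpU ^ N) (lpU ^ N * u) dvd_rfl ⟨_, rfl⟩
    rw [hl, zero_mul, zero_smul, add_zero] at this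
    rwa [pow_add, mul_assoc]
  · exact gG f hfN
  · exact gQ f hfN

end opp

section opp
variable {V : Type*} [AddCommGroup V] [Module ℂ V] {x : HVGen → ℤ → End ℂ V}

lemma lpU_dvd_sub_C (f : LaurentPolynomial ℂ) : lpU ∣ f - C (lpOne f) := by
  induction f using lp_induction with
  | hadd p q hp hq => rw [map_add, map_add]; convert dvd_add hp hq using 1; ring
  | hs r p hp => 
    rw [map_smul, smul_eq_mul, map_mul, smul_eq_C_mul, ← mul_sub]; exact hp.mul_left _
  | hT n => rw [lpOne_T, map_one]; exact lpU_dvd_T_sub_one n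

lemma lpU_pow_dvd_lie (s : ℂ) (i : ℤ) (n : ℕ) : lpU ^ (n + 1) ∣
    s • (lpEuler (T i) * lpU ^ n) + (T i - 1) * lpEuler (lpU ^ n) - ((s + n) * i) • lpU ^ n := by
  obtain ⟨z, hz, hz1⟩ : ∃ z, (T i - 1) * lpEuler (lpU ^ n) = z * lpU ^ n ∧
      lpOne z = n * i := by
    cases n with
    | zero => exact ⟨0, by simp, by simp⟩
    | succ n =>
      obtain ⟨r, hr⟩ := lpU_dvd_T_sub_one i
      have hr1 : lpOne r = i := by
        have := congrArg (fun f => lpOne (lpEuler f)) hr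
        simpa using this.symm
      refine ⟨((n : ℂ) + 1) • (r * T 1), ?_, ?_⟩
      · rw [lpEuler_pow, lpEuler_lpU, hr, smul_mul_assoc, mul_smul_comm]; congr 1; ring
      · rw [map_smul, lpOne_mul, hr1, lpOne_T]; push_cast; simp
  obtain ⟨w, hw⟩ := lpU_dvd_sub_C ((s * i) • T i + z)
  refine ⟨w, ?_⟩
  rw [pow_succ, mul_assoc, ← hw, hz]
  rw [map_add, map_smul, lpOne_T, hz1]
  simp only [lpEuler_T, smul_eq_C_mul, map_mul, map_add, smul_eq_mul, mul_one]
  ring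

theorem HVOpp.descent (h : HVOpp x 0 0 0) {b s : ℂ} {φ : V} (hφ : HVEigen x b φ)
    (hloc : HVLocal x φ) {e : HVGen} (he : OppBracket x .L e e 1 s 1 0 fun _ => 0) (n : ℕ)
    (hn : ∀ f, lpU ^ (n + 1) ∣ f → lpAct x e f φ = 0) :
    HVEigen x (b - (n + s)) (lpAct x e (lpU ^ n) φ) ∧ HVLocal x (lpAct x e (lpU ^ n) φ) := by
  constructor
  · intro i
    have e1 := fun j : ℤ => he.act (T j) (lpU ^ n) φ
    simp only [lpAct_T, lpDiag_zero, LinearMap.zero_apply, zero_mul, map_zero, zero_smul,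
      add_zero, one_smul] at e1
    have ei := e1 i
    have e0 := e1 0
    rw [hφ i, map_add, map_smul, e0] at ei
    have e2 := hn _ (lpU_pow_dvd_lie s i n)
    simp only [T_zero, lpEuler_one, zero_mul, smul_zero, zero_add, one_mul, map_add, map_sub,
      LinearMap.add_apply, LinearMap.sub_apply, sub_mul, map_smul, LinearMap.smul_apply] at ei e2
    rw [sub_eq_zero] at e2
    have e3 : x .L i (lpAct x e (lpU ^ n) φ) = x .L 0 (lpAct x e (lpU ^ n) φ) +
      (i * b) • lpAct x e (lpU ^ n) φ - ((s + n) * i) • lpAct x e (lpU ^ n) φ := by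
      rw [← e2, ← sub_eq_zero]
      rw [← sub_eq_zero] at ei
      rw [← neg_eq_zero, ← ei]
      abel
    rw [e3]
    module
  · obtain ⟨N, hN⟩ := hloc
    refine ⟨N + 1, fun e' f hf => ?_⟩
    obtain ⟨y, σ, α, β, γ, hb⟩ := h.uniform e e'
    have hf' : lpU ^ N ∣ f := (pow_dvd_pow _ (by omega)).trans hf
    rw [hb.act, hN e' f hf', hN y, lpDiag_zero, LinearMap.zero_apply, zero_mul, map_zero, map_zero,
      smul_zero, zero_smul, add_zero, add_zero]
    simp only [smul_eq_C_mul]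
    exact dvd_add (dvd_add ((hf'.mul_left _).mul_left _) (((dvd_lpEuler hf).mul_left _).mul_left _))
      ((hf'.mul_left _).mul_left _)

theorem HVOpp.exists_tensor (h : HVOpp x 0 0 0)
    (hfin : {b : ℂ | ∃ φ, φ ≠ 0 ∧ HVEigen x b φ}.Finite)
    (hne : ∃ (b : ℂ) (φ : V), φ ≠ 0 ∧ HVEigen x b φ ∧ HVLocal x φ) :
    ∃ (b : ℂ) (φ : V), φ ≠ 0 ∧ (∀ i : ℤ, x .L i φ = x .L 0 φ + (i * b) • φ) ∧
      (∀ i, x .G i φ = x .G 0 φ) ∧ (∀ i, x .H i φ = x .H 0 φ) ∧ ∀ i, x .Q i φ = 0 := by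
  have hfin' : {b : ℂ | ∃ φ, φ ≠ 0 ∧ HVEigen x b φ ∧ HVLocal x φ}.Finite :=
    hfin.subset fun b ⟨φ, h0, h1, _⟩ => ⟨φ, h0, h1⟩
  obtain ⟨b, ⟨φ, hφ0, hφ, hloc⟩, hmin⟩ := Set.exists_min_image _ Complex.re hfin' hne
  refine ⟨b, φ, hφ0, hφ, ?_⟩
  have key : ∀ (e : HVGen) (s : ℂ), OppBracket x .L e e 1 s 1 0 (fun _ => 0) → ∀ n : ℕ,
      0 < (n : ℝ) + s.re → ∀ f, lpU ^ n ∣ f → lpAct x e f φ = 0 := by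
    intro e s he n hn
    obtain ⟨N, hN⟩ := hloc
    have : ∀ m : ℕ, ∀ f, lpU ^ (n + (N - m)) ∣ f → lpAct x e f φ = 0 := by
      intro m
      induction m with
      | zero => exact fun f hf => hN e f ((pow_dvd_pow _ (by omega)).trans hf)
      | succ m ih =>
        by_cases hm : N ≤ m
        · rwa [show N - (m + 1) = N - m by omega]
        · set r := n + (N - (m + 1)) with hr
          rw [show n + (N - m) = r + 1 by omega] at ih
          obtain ⟨h1, h2⟩ := h.descent hφ ⟨N, hN⟩ he r ih
          have h3 : lpAct x e (lpU ^ r) φ = 0 := by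
            by_contra h3
            have := hmin _ ⟨_, h3, h1, h2⟩
            have hnr : (n : ℝ) ≤ r := by exact_mod_cast (show n ≤ r by omega)
            simp at this
            linarith
          rintro f ⟨u, rfl⟩
          obtain ⟨w, hw⟩ := lpU_dvd_sub_C u
          rw [show lpU ^ r * u = lpU ^ (r + 1) * w + lpOne u • lpU ^ r by
            rw [smul_eq_C_mul]; linear_combination lpU ^ r * hw, map_add, LinearMap.add_apply,
            ih _ ⟨w, rfl⟩, map_smul, LinearMap.smul_apply, h3, smul_zero, zero_add]
    have := this N
    rwa [Nat.sub_self, add_zero] at this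
  have LH := h.LH
  simp only [mul_zero] at LH
  have hsub : ∀ (e : HVGen) (s : ℂ), OppBracket x .L e e 1 s 1 0 (fun _ => 0) →
      0 < (1 : ℝ) + s.re → ∀ i, x e i φ = x e 0 φ := by
    intro e s he hs i
    have := key e s he 1 (by simpa using hs) (T i - 1) (by rw [pow_one]; exact lpU_dvd_T_sub_one i)
    rwa [map_sub, LinearMap.sub_apply, ← T_zero, lpAct_T, lpAct_T, sub_eq_zero] at this
  refine ⟨hsub _ _ h.LG (by norm_num), hsub _ _ LH (by simp), fun i => ?_⟩
  have := key _ _ h.LQ 0 (by norm_num) (T i) (by simp)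
  rwa [lpAct_T] at this

end opp

/-- Functionals vanishing on all weight spaces of large degree. -/
def hvNull {M : Type} [AddCommGroup M] [Module ℂ M] (X : HVGen → ℤ → End ℂ M) (lam : ℂ) :
    Submodule ℂ (Dual ℂ M) where
  carrier := {φ | ∃ K : ℤ, ∀ k ≥ K, ∀ v ∈ hvWt X lam k, φ v = 0}
  zero_mem' := ⟨0, fun _ _ _ _ => rfl⟩
  add_mem' := by
    rintro φ ψ ⟨K, hK⟩ ⟨K', hK'⟩
    refine ⟨max K K', fun k hk v hv => ?_⟩
    rw [LinearMap.add_apply, hK k (le_trans (le_max_left _ _) hk) v hv,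
      hK' k (le_trans (le_max_right _ _) hk) v hv, add_zero]
  smul_mem' := by
    rintro r φ ⟨K, hK⟩
    exact ⟨K, fun k hk v hv => by rw [LinearMap.smul_apply, hK k hk v hv, smul_zero]⟩

/-- Germs of functionals at infinity. -/
abbrev HVGerm {M : Type} [AddCommGroup M] [Module ℂ M] (X : HVGen → ℤ → End ℂ M) (lam : ℂ) : Type :=
  Dual ℂ M ⧸ hvNull X lam

namespace HVData
variable {M : Type} [AddCommGroup M] [Module ℂ M] {X : HVGen → ℤ → End ℂ M}
    {c l a lam : ℂ} {p : End ℂ M}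

lemma mem_hvNull_iff {m : ℕ} (hm : m ≠ 0) {φ : Dual ℂ M} : φ ∈ hvNull X lam ↔
    ∀ ε < m, ∀ᶠ n : ℕ in atTop, ∀ v ∈ hvWt X lam (2 + ε + m * n), φ v = 0 := by
  constructor
  · rintro ⟨K, hK⟩ ε -
    filter_upwards [eventually_ge_atTop K.toNat] with n hn v hv
    refine hK _ ?_ v hv
    have h1 : (n : ℤ) ≤ m * n := by
      have : (1 : ℤ) ≤ m := by omega
      nlinarith
    omega
  · intro h
    choose! N hN using fun ε hε => eventually_atTop.1 (h ε hε)
    refine ⟨2 + m + m * ((∑ ε ∈ Finset.range m, N ε : ℕ) : ℤ), fun k hk v hv => ?_⟩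
    have hm' : (0 : ℤ) < m := by omega
    have h1 := Int.emod_nonneg (k - 2) hm'.ne'
    have h2 := Int.emod_lt_of_pos (k - 2) hm'
    have h3 := Int.emod_add_mul_ediv (k - 2) m
    set ε := ((k - 2) % m).toNat with hε
    have hεm : ε < m := by omega
    have h4 : N ε ≤ ∑ ε ∈ Finset.range m, N ε :=
      Finset.single_le_sum (fun _ _ => Nat.zero_le _) (Finset.mem_range.2 hεm)
    have h5 : ((∑ ε ∈ Finset.range m, N ε : ℕ) : ℤ) ≤ (k - 2) / m := by
      by_contra hlt
      push Not at hlt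
      nlinarith
    set q := ((k - 2) / m).toNat with hq
    have hq' : ((k - 2) / m : ℤ) = q := by omega
    have hk2 : k = 2 + ε + m * q := by rw [← hq']; omega
    exact hN ε hεm q (by omega) v (hk2 ▸ hv)

section basic
variable (h : HVData X c l a lam p)
include h

/-- The action on germs of functionals. -/
noncomputable def germAct (g : HVGen) (i : ℤ) : End ℂ (HVGerm X lam) :=
  (hvNull X lam).mapQ (hvNull X lam) (X g i).dualMap (by
    rintro φ ⟨K, hK⟩
    refine ⟨K - i, fun k hk v hv => ?_⟩
    exact hK (k + i) (by omega) _ (h.X_mem g hv))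

lemma germAct_mk (g : HVGen) (i : ℤ) (φ : Dual ℂ M) :
    h.germAct g i (Submodule.Quotient.mk φ) = Submodule.Quotient.mk (φ ∘ₗ X g i) := rfl

lemma germ_bracket {e e' y : HVGen} {σ α β γ : ℂ} {κ : ℤ → ℂ} (hX : ∀ i j v,
    X e i (X e' j v) = σ • X e' j (X e i v) + (α * i + β * j + γ) • X y (i + j) v +
      (if i + j = 0 then κ i else 0) • v) : OppBracket h.germAct e e' y σ α β γ κ := by
  intro i j w
  obtain ⟨φ, rfl⟩ := Submodule.Quotient.mk_surjective _ w
  simp only [germAct_mk, ← Submodule.Quotient.mk_smul, ← Submodule.Quotient.mk_add]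
  congr 1
  ext v
  simp only [LinearMap.comp_apply, hX, map_add, map_smul, LinearMap.add_apply, LinearMap.smul_apply]

lemma germ : HVOpp h.germAct c l a where
  LL := h.germ_bracket fun i j v => by rw [h.LL]; module
  LH := h.germ_bracket fun i j v => by rw [h.LH]; module
  LG := h.germ_bracket fun i j v => by rw [h.LG, ite_self]; module
  LQ := h.germ_bracket fun i j v => by rw [h.LQ, ite_self]; module
  HH := h.germ_bracket fun i j v => by rw [h.HH]; module
  GH := h.germ_bracket fun i j v => by rw [h.GH, ite_self]; module
  HQ := h.germ_bracket fun i j v => by rw [h.HQ, ite_self]; module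
  GQ := h.germ_bracket fun i j v => by rw [h.GQ]; module
  GG := h.germ_bracket fun i j v => by rw [h.GG]; module
  QQ := h.germ_bracket fun i j v => by rw [h.QQ]; module

lemma tail {C : ℕ} (hC : ∀ k : ℤ, 2 ≤ k → finrank ℂ (hvWt X lam k) ≤ C) {m : ℕ} (hm : m ≠ 0)
    (hc : m = 1 ∨ c = 0) (ε : ℕ) :
    WTail (fun a : ℕ => (m : ℂ)⁻¹ • X .L (m * ((a : ℤ) - 1)))
      (fun n : ℕ => hvWt X lam (2 + ε + m * n)) ((lam + 2 + ε) / m) where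
  maps := fun a k v hv hak => by
    refine Submodule.smul_mem _ _ (h.X_mem' .L hv ?_)
    push_cast [Nat.cast_sub hak]; ring
  diag := fun k v hv => by
    have hm' : (m : ℂ) ≠ 0 := by exact_mod_cast hm
    have := mem_hvWt.1 hv
    simp only [LinearMap.smul_apply, Nat.cast_one, sub_self, mul_zero, this, smul_smul]
    congr 1
    push_cast; field_simp; ring
  comm := fun a c' hac => by
    have hm' : (m : ℂ) ≠ 0 := by exact_mod_cast hm
    ext v
    simp only [LinearMap.sub_apply, Module.End.mul_apply, LinearMap.smul_apply, map_smul]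
    rw [h.LL]
    have hz : (if (m : ℤ) * ((a : ℤ) - 1) + m * ((c' : ℤ) - 1) = 0 then
        ((((m : ℤ) * ((a : ℤ) - 1) : ℤ) : ℂ) ^ 3 - ((m : ℤ) * ((a : ℤ) - 1) : ℤ)) / 12 * c
        else 0) = 0 := by
      split_ifs with hs
      · rcases hc with rfl | rfl
        · obtain rfl | rfl | rfl : a = 0 ∨ a = 1 ∨ a = 2 := by omega
          all_goals norm_num
        · ring
      · rfl
    rw [hz, zero_smul, add_zero, show (m : ℤ) * ((a : ℤ) - 1) + m * ((c' : ℤ) - 1) =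
      m * (((a + c' - 1 : ℕ) : ℤ) - 1) by push_cast [Nat.cast_sub hac]; ring]
    simp only [smul_add, smul_smul, add_sub_cancel_left]
    congr 1
    push_cast; field_simp; ring
  fin := fun k => h.fin _
  bdd := ⟨C, fun k => by
    refine hC _ ?_
    have h0 : (0 : ℤ) ≤ (m : ℤ) * (k : ℤ) := by positivity
    linarith [Int.natCast_nonneg ε]⟩

omit h in
/-- Relations between germs in terms of functionals. -/
lemma germ_eventually {m : ℕ} (hm : m ≠ 0) {ε : ℕ} (hε : ε < m) {φ : Dual ℂ M}
    (hφ : (Submodule.Quotient.mk φ : HVGerm X lam) = 0) :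
    ∀ᶠ n : ℕ in atTop, ∀ v ∈ hvWt X lam (2 + ε + m * n), φ v = 0 :=
  (mem_hvNull_iff hm).1 ((Submodule.Quotient.mk_eq_zero _).1 hφ) ε hε

end basic
end HVData

section opp
variable {V : Type*} [AddCommGroup V] [Module ℂ V] {x : HVGen → ℤ → End ℂ V} {c l a : ℂ}

/-- The eigenvalue relation for a single index. -/
def HVEigenAt (x : HVGen → ℤ → End ℂ V) (b : ℂ) (φ : V) (i : ℤ) : Prop :=
  x .L i φ = x .L 0 φ + (i * b) • φ

lemma HVOpp.L_swap (h : HVOpp x c l a) {i j k : ℤ} (hk : i + j = k) (hc : k ≠ 0) (v : V) :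
    x .L j (x .L i v) = x .L i (x .L j v) + ((j : ℂ) - i) • x .L k v := by
  have := h.LL i j v
  rw [if_neg (by omega), hk] at this
  rw [this]; module

lemma HVOpp.L_zero_swap (h : HVOpp x c l a) (j : ℤ) (v : V) :
    x .L j (x .L 0 v) = x .L 0 (x .L j v) + (j : ℂ) • x .L j v := by
  have := h.LL 0 j v
  simp only [Int.cast_zero, zero_add] at this
  rw [this]
  split_ifs <;> simp

lemma HVOpp.eigenAt_add (h : HVOpp x c l a) {b : ℂ} {φ : V} {i j k : ℤ}
    (hi : HVEigenAt x b φ i) (hj : HVEigenAt x b φ j) (hij : i ≠ j) (hk : i + j = k) (hk0 : k ≠ 0) :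
    HVEigenAt x b φ k := by
  have hne : ((j : ℂ) - i) ≠ 0 := by
    rw [sub_ne_zero]; exact_mod_cast hij.symm
  unfold HVEigenAt at *
  have h1 := h.L_swap hk hk0 φ
  rw [hi, hj, map_add, map_add, map_smul, map_smul, h.L_zero_swap, h.L_zero_swap, hi, hj] at h1
  simp only [map_add, map_smul] at h1
  have h2 : ((j : ℂ) - i) • x .L k φ = ((j : ℂ) - i) • (x .L 0 φ + (k * b) • φ) := by
    have h3 : (k : ℂ) = i + j := by rw [← hk]; push_cast; ring
    rw [h3]
    linear_combination (norm := module) -h1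
  exact smul_right_injective _ hne h2

lemma HVOpp.eigenAt_of_ge (h : HVOpp x c l a) {b : ℂ} {φ : V} (hm : HVEigenAt x b φ (-1))
    (h1 : HVEigenAt x b φ 1) (h2 : HVEigenAt x b φ 2) : ∀ i : ℤ, -1 ≤ i → HVEigenAt x b φ i := by
  have hn : ∀ n : ℕ, HVEigenAt x b φ ((n : ℤ) + 2) := by
    intro n
    induction n with
    | zero => simpa using h2
    | succ n ih => exact h.eigenAt_add ih h1 (by omega) (by push_cast; ring) (by omega)
  intro i hi
  obtain rfl | rfl | rfl | h3 : i = -1 ∨ i = 0 ∨ i = 1 ∨ 2 ≤ i := by omega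
  · exact hm
  · simp [HVEigenAt]
  · exact h1
  · obtain ⟨n, hn'⟩ := Int.eq_ofNat_of_zero_le (show 0 ≤ i - 2 by omega)
    rw [show i = n + 2 by omega]
    exact hn n

lemma HVOpp.shift_of_eigenAt (h : HVOpp x c l a) {b : ℂ} {φ : V} {j : ℤ} (hj2 : j ≠ 2)
    (hj : HVEigenAt x b φ j) (hj' : HVEigenAt x b φ (j - 2)) :
    let θ := x .L (-2) φ - x .L 0 φ + (2 * b) • φ
    x .L j θ = x .L 0 θ + (j * b - 2) • θ := by
  intro θ
  have h1 := h.L_swap (i := -2) (j := j) (k := j - 2) (by ring) (by omega) φ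
  have h2 := h.L_zero_swap (-2) φ
  have h3 := h.L_zero_swap j φ
  unfold HVEigenAt at *
  rw [hj, hj', map_add, map_smul] at h1
  simp only [θ, map_add, map_sub, map_smul]
  rw [hj, map_add, map_smul] at h3
  rw [h1, h2, h3, hj]
  push_cast
  module

lemma HVOpp.eigen_of_eigenAt (h : HVOpp x c l a) {b : ℂ} {φ : V}
    (h0 : ∀ i : ℤ, -1 ≤ i → HVEigenAt x b φ i) (hm : HVEigenAt x b φ (-2)) : HVEigen x b φ := by
  have hn : ∀ n : ℕ, HVEigenAt x b φ (-2 - (n : ℤ)) := by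
    intro n
    induction n with
    | zero => simpa using hm
    | succ n ih =>
      exact h.eigenAt_add ih (h0 (-1) le_rfl) (by omega) (by push_cast; ring) (by omega)
  intro i
  rcases le_or_gt (-1) i with h1 | h1
  · exact h0 i h1
  · obtain ⟨n, hn'⟩ := Int.eq_ofNat_of_zero_le (show 0 ≤ -2 - i by omega)
    have := hn n
    rwa [show -2 - (n : ℤ) = i by omega] at this

lemma HVOpp.charge_zero (h : HVOpp x c l a) {b : ℂ} {φ : V} (hφ0 : φ ≠ 0) (hφ : HVEigen x b φ) :
    c = 0 := by
  have h1 := h.LL (-2) 2 φ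
  rw [hφ (-2), hφ 2] at h1
  simp only [map_add, map_smul] at h1
  rw [h.L_zero_swap, h.L_zero_swap, hφ (-2), hφ 2] at h1
  simp only [map_add, map_smul] at h1
  have h2 : (c / 2) • φ = 0 := by
    norm_num at h1
    linear_combination (norm := module) h1
  simpa using (smul_eq_zero.1 h2).resolve_right hφ0

lemma HVOpp.eigen_shift (h : HVOpp x c l a) {φ : V} (hφ : HVEigen x 0 φ) :
    HVEigen x 1 (x .L 0 φ) := by
  intro i
  rw [h.L_zero_swap, hφ i]
  simp

end opp

namespace HVData
variable {M : Type} [AddCommGroup M] [Module ℂ M] {X : HVGen → ℤ → End ℂ M}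
    {c l a lam : ℂ} {p : End ℂ M}

lemma L0_eventually {m ε n : ℕ} {v : M} (hv : v ∈ hvWt X lam (2 + ε + m * n)) (φ : Dual ℂ M) :
    φ (X .L 0 v) = (lam + 2 + ε + m * n) * φ v := by
  rw [mem_hvWt.1 hv, map_smul, smul_eq_mul]
  push_cast; ring

/-- Existence of an eigenfunctional of nonzero eigenvalue. -/
theorem exists_eigen (h : HVData X c l a lam p) {C : ℕ}
    (hC : ∀ k : ℤ, 2 ≤ k → finrank ℂ (hvWt X lam k) ≤ C)
    (hne : ∀ n : ℤ, ∃ k ≥ n, hvWt X lam k ≠ ⊥) :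
    c = 0 ∧ ∃ (b : ℂ) (φ : HVGerm X lam), b ≠ 0 ∧ φ ≠ 0 ∧ HVEigen h.germAct b φ := by
  have ht := h.tail hC one_ne_zero (Or.inl rfl) 0
  obtain ⟨φ, b, K, hφ⟩ := ht.exists_functional (fun n => by
    obtain ⟨k, hk, hk0⟩ := hne (n + 2)
    refine ⟨(k - 2).toNat, by omega, ?_⟩
    rwa [show (2 : ℤ) + (0 : ℕ) + (1 : ℕ) * ((k - 2).toNat : ℤ) = k by omega])
  have hmk : ∀ Φ : Dual ℂ M, (∀ n : ℕ, K ≤ n → ∀ v ∈ hvWt X lam (2 + (0 : ℕ) + (1 : ℕ) * n),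
      Φ v = 0) → (Submodule.Quotient.mk Φ : HVGerm X lam) = 0 := by
    intro Φ hΦ
    refine (Submodule.Quotient.mk_eq_zero _).2 ((mem_hvNull_iff one_ne_zero).2 fun ε hε => ?_)
    obtain rfl : ε = 0 := by omega
    exact eventually_atTop.2 ⟨K, hΦ⟩
  set ψ : HVGerm X lam := Submodule.Quotient.mk φ with hψ
  have hψ0 : ψ ≠ 0 := by
    intro h0
    obtain ⟨N, hN⟩ := eventually_atTop.1 (germ_eventually (m := 1) one_ne_zero zero_lt_one h0)
    obtain ⟨⟨v, hv, hv0⟩, -⟩ := hφ (max K N) (le_max_left _ _)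
    exact hv0 (hN _ (le_max_right _ _) v hv)
  have hat : ∀ i : ℤ, (∀ n : ℕ, K ≤ n → ∀ v ∈ hvWt X lam (2 + (0 : ℕ) + (1 : ℕ) * n),
      φ (X .L i v) = (lam + 2 + n + i * b) * φ v) → HVEigenAt h.germAct b ψ i := by
    intro i hi
    unfold HVEigenAt
    rw [← sub_eq_zero, hψ, germAct_mk, germAct_mk, ← Submodule.Quotient.mk_smul,
      ← Submodule.Quotient.mk_add, ← Submodule.Quotient.mk_sub]
    refine hmk _ fun n hn v hv => ?_
    simp only [LinearMap.sub_apply, LinearMap.add_apply, LinearMap.comp_apply,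
      LinearMap.smul_apply, hi n hn v hv, L0_eventually hv, smul_eq_mul]
    push_cast; ring
  have hge := h.germ.eigenAt_of_ge (φ := ψ) (b := b)
    (hat _ fun n hn v hv => by
      have := (hφ n hn).2.1 v hv
      norm_num at this
      rw [this]; push_cast; ring)
    (hat _ fun n hn v hv => by
      have := (hφ n hn).2.2.1 v hv
      norm_num at this
      rw [this]; push_cast; ring)
    (hat _ fun n hn v hv => by
      have := (hφ n hn).2.2.2 v hv
      norm_num at this
      rw [this]; push_cast; ring)
  have hm2 : HVEigenAt h.germAct b ψ (-2) := by
    have s1 := h.germ.shift_of_eigenAt (j := 1) (by norm_num) (hge 1 (by norm_num))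
      (hge _ (by norm_num))
    have s3 := h.germ.shift_of_eigenAt (j := 3) (by norm_num) (hge 3 (by norm_num))
      (hge _ (by norm_num))
    simp only at s1 s3
    set θ := h.germAct .L (-2) ψ - h.germAct .L 0 ψ + (2 * b) • ψ with hθ
    obtain ⟨Θ, hΘ⟩ := Submodule.Quotient.mk_surjective _ θ
    rw [← hΘ] at s1 s3
    simp only [germAct_mk] at s1 s3
    rw [← sub_eq_zero, ← Submodule.Quotient.mk_smul,
      ← Submodule.Quotient.mk_add, ← Submodule.Quotient.mk_sub] at s1 s3
    have e1 := germ_eventually (m := 1) one_ne_zero zero_lt_one s1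
    have e3 := germ_eventually (m := 1) one_ne_zero zero_lt_one s3
    have := ht.eventually_eq_zero_of_shift Θ b (by
        filter_upwards [e1] with n hn v hv
        have h1 := hn v hv
        simp only [LinearMap.sub_apply, LinearMap.add_apply, LinearMap.comp_apply,
          LinearMap.smul_apply, L0_eventually hv, smul_eq_mul] at h1
        norm_num at h1 ⊢
        linear_combination h1) (by
        filter_upwards [e3] with n hn v hv
        have h1 := hn v hv
        simp only [LinearMap.sub_apply, LinearMap.add_apply, LinearMap.comp_apply,
          LinearMap.smul_apply, L0_eventually hv, smul_eq_mul] at h1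
        norm_num at h1 ⊢
        linear_combination h1)
    have hθ0 : θ = 0 := by
      rw [← hΘ]
      refine (Submodule.Quotient.mk_eq_zero _).2 ((mem_hvNull_iff one_ne_zero).2 fun ε hε => ?_)
      obtain rfl : ε = 0 := by omega
      exact this
    unfold HVEigenAt
    rw [← sub_eq_zero, ← hθ0, hθ]
    push_cast
    module
  have hE := h.germ.eigen_of_eigenAt hge hm2
  refine ⟨h.germ.charge_zero hψ0 hE, ?_⟩
  by_cases hb : b = 0
  · subst hb
    refine ⟨1, _, one_ne_zero, fun h0 => hψ0 ?_, h.germ.eigen_shift hE⟩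
    rw [hψ, germAct_mk] at h0
    have := germ_eventually (m := 1) one_ne_zero zero_lt_one h0
    refine (Submodule.Quotient.mk_eq_zero _).2 ((mem_hvNull_iff one_ne_zero).2 fun ε hε => ?_)
    obtain rfl : ε = 0 := by omega
    obtain ⟨N, hN⟩ := exists_nat_gt ‖lam + 2‖
    filter_upwards [this, eventually_ge_atTop N] with n hn hnN v hv
    have h1 := hn v hv
    rw [LinearMap.comp_apply, L0_eventually hv] at h1
    refine (mul_eq_zero.1 h1).resolve_left fun hz => ?_
    have h2 : lam + 2 = -(n : ℂ) := by
      push_cast at hz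
      linear_combination hz
    rw [h2, norm_neg, Complex.norm_natCast] at hN
    exact absurd hnN (not_le.2 (by exact_mod_cast hN))
  · exact ⟨b, ψ, hb, hψ0, hE⟩

end HVData

lemma mul_lpEuler_pow (f : LaurentPolynomial ℂ) (n : ℕ) :
    f * lpEuler (f ^ n) = (n : ℂ) • (f ^ n * lpEuler f) := by
  cases n with
  | zero => simp
  | succ n =>
    rw [lpEuler_pow, mul_smul_comm, ← mul_assoc, ← pow_succ']
    push_cast; rfl

lemma lpLie_T_two_sub_one_pow {s : ℂ} {k : ℤ} (hk : (k : ℂ) = 2 * s) (i q : ℕ) :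
    lpLie s ((T 2 - 1) ^ (i + 1) * T (-2)) ((T 2 - 1) ^ q * T k) =
      (2 * (q + s * (i + 1))) • ((T 2 - 1) ^ (q + i) * T k) := by
  have hU : lpEuler (T 2 - 1) = C 2 * T 2 := by simp [smul_eq_C_mul]
  have hT : (T 2 * T (-2) : LaurentPolynomial ℂ) = 1 := by rw [← T_add]; simp
  have h1 := mul_lpEuler_pow (T 2 - 1) q
  have h2 := lpEuler_pow (T 2 - 1) i
  rw [hU] at h1 h2
  rw [lpLie, lpEuler_mul, lpEuler_mul, h2, lpEuler_T, lpEuler_T, hk]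
  simp only [smul_eq_C_mul, map_mul, map_add, map_natCast, map_one, Int.cast_neg, Int.cast_ofNat,
    map_neg, map_ofNat] at h1 ⊢
  rw [pow_succ, pow_add]
  linear_combination ((T 2 - 1) ^ i * T (-2) * T k) * h1 +
    (2 * (q + C s * (i + 1)) * ((T 2 - 1) ^ i * (T 2 - 1) ^ q * T k)) * hT

section opp
variable {V : Type*} [AddCommGroup V] [Module ℂ V] {x : HVGen → ℤ → End ℂ V}

lemma HVEigen.act_lie {e : HVGen} {s b : ℂ} {φ : V} (hφ : HVEigen x b φ)
    (he : OppBracket x .L e e 1 s 1 0 fun _ => 0) {f : LaurentPolynomial ℂ} (hf : lpOne f = 0)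
    (g : LaurentPolynomial ℂ) : lpAct x .L f (lpAct x e g φ) =
      (lpOne (lpEuler f) * b) • lpAct x e g φ - lpAct x e (lpLie s f g) φ := by
  have h := he.act f g φ
  rw [hφ.act, hf, zero_smul, zero_add, map_smul, lpDiag_zero, LinearMap.zero_apply, zero_mul,
    map_zero, zero_smul, add_zero, one_smul, one_smul, zero_smul, add_zero] at h
  rw [h, lpLie, add_sub_cancel_right]

end opp

namespace HVData
variable {M : Type} [AddCommGroup M] [Module ℂ M] {X : HVGen → ℤ → End ℂ M}
    {c l a lam : ℂ} {p : End ℂ M}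

theorem exists_locality (h : HVData X 0 l a lam p) {C : ℕ}
    (hC : ∀ k : ℤ, 2 ≤ k → finrank ℂ (hvWt X lam k) ≤ C) {b : ℂ} {φ : HVGerm X lam} (hb : b ≠ 0)
    (hφ : HVEigen h.germAct b φ) {e : HVGen} {s : ℂ} {k : ℤ} (hk : (k : ℂ) = 2 * s)
    (he : OppBracket h.germAct .L e e 1 s 1 0 fun _ => 0) :
    ∃ (q : ℕ) (k : ℤ), lpAct h.germAct e ((T 2 - 1) ^ q * T k) φ = 0 := by
  set u : ℕ → HVGerm X lam := fun q => lpAct h.germAct e ((T 2 - 1) ^ q * T k) φ with hu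
  choose Θ hΘ using fun q => Submodule.Quotient.mk_surjective _ (u q)
  have key : ∀ i q : ℕ, lpAct h.germAct .L ((T 2 - 1) ^ (i + 1) * T (-2)) (u q) =
      (lpOne (lpEuler ((T 2 - 1) ^ (i + 1) * T (-2))) * b) • u q -
        (2 * (q + s * (i + 1))) • u (q + i) := by
    intro i q
    rw [hu]
    simp only
    rw [hφ.act_lie he (lpOne_of_dvd (((lpU_dvd_T_sub_one 2).trans
      (dvd_pow_self _ i.succ_ne_zero)).mul_right _)), lpLie_T_two_sub_one_pow hk, map_smul, LinearMap.smul_apply]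
  have f0 : ((T 2 - 1) ^ (0 + 1) * T (-2) : LaurentPolynomial ℂ) = T 0 - T (-2) := by
    rw [zero_add, pow_one, sub_mul, one_mul, ← T_add]; norm_num
  have hT : (T 2 * T (-2) : LaurentPolynomial ℂ) = 1 := by rw [← T_add]; simp
  have hT4 : (T 4 : LaurentPolynomial ℂ) = T 2 * T 2 := by rw [← T_add]; norm_num
  have f1 : ((T 2 - 1) ^ (1 + 1) * T (-2) : LaurentPolynomial ℂ) =
      T 2 - (2 : ℂ) • T 0 + T (-2) := by
    rw [smul_eq_C_mul, T_zero, map_ofNat]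
    linear_combination (T 2 - 2) * hT
  have f2 : ((T 2 - 1) ^ (2 + 1) * T (-2) : LaurentPolynomial ℂ) =
      T 4 - (3 : ℂ) • T 2 + (3 : ℂ) • T 0 - T (-2) := by
    rw [smul_eq_C_mul, smul_eq_C_mul, T_zero, map_ofNat, hT4]
    linear_combination (T 2 * T 2 - 3 * T 2 + 3) * hT
  have k0 : ∀ q, h.germAct .L 0 (u q) - h.germAct .L (-2) (u q) =
      (2 * (b - (s + q))) • u q := by
    intro q
    have := key 0 q
    rw [f0] at this
    simp only [map_sub, lpAct_T, LinearMap.sub_apply, lpEuler_T, map_smul, lpOne_T] at this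
    rw [this]
    push_cast [add_zero, smul_eq_mul]
    module
  have k1 : ∀ q, h.germAct .L 2 (u q) - (2 : ℂ) • h.germAct .L 0 (u q) + h.germAct .L (-2) (u q) =
      (2 * (-(s + q + s))) • u (q + 1) := by
    intro q
    have := key 1 q
    rw [f1] at this
    simp only [map_sub, map_add, lpAct_T, LinearMap.sub_apply, LinearMap.add_apply,
      LinearMap.smul_apply, lpEuler_T, map_smul, lpOne_T] at this
    rw [this]
    push_cast [add_zero, smul_eq_mul]
    module
  have k2 : ∀ q, h.germAct .L 4 (u q) - (3 : ℂ) • h.germAct .L 2 (u q) +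
      (3 : ℂ) • h.germAct .L 0 (u q) - h.germAct .L (-2) (u q) =
      (2 * (-(s + q + 2 * s))) • u (q + 2) := by
    intro q
    have := key 2 q
    rw [f2] at this
    simp only [map_sub, map_add, lpAct_T, LinearMap.sub_apply, LinearMap.add_apply,
      LinearMap.smul_apply, lpEuler_T, map_smul, lpOne_T] at this
    rw [this]
    push_cast [add_zero, smul_eq_mul]
    module
  simp only [← hΘ, germAct_mk] at k0 k1 k2
  have loc : ∀ ε : ℕ, ε < 2 → ∃ q₀, ∀ q ≥ q₀, ∀ᶠ n : ℕ in atTop, ∀ v ∈ hvWt X lam (2 + ε + (2 : ℕ) * n),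
      Θ q v = 0 := by
    intro ε hε
    refine (h.tail hC two_ne_zero (Or.inr rfl) ε).eventually_eq_zero_of_locality Θ b s hb ?_ ?_ ?_
    · intro q
      have e0 := k0 q
      rw [← sub_eq_zero, ← Submodule.Quotient.mk_smul, ← Submodule.Quotient.mk_sub,
        ← Submodule.Quotient.mk_sub] at e0
      filter_upwards [germ_eventually two_ne_zero hε e0] with n hn v hv
      have := hn v hv
      simp only [LinearMap.sub_apply, LinearMap.comp_apply, LinearMap.smul_apply, map_smul,
        smul_eq_mul] at this ⊢
      norm_num at this ⊢
      linear_combination this / 2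
    · intro q
      have e0 := k1 q
      rw [← sub_eq_zero, ← Submodule.Quotient.mk_smul, ← Submodule.Quotient.mk_smul,
        ← Submodule.Quotient.mk_sub, ← Submodule.Quotient.mk_add,
        ← Submodule.Quotient.mk_sub] at e0
      filter_upwards [germ_eventually two_ne_zero hε e0] with n hn v hv
      have := hn v hv
      simp only [LinearMap.sub_apply, LinearMap.add_apply, LinearMap.comp_apply,
        LinearMap.smul_apply, map_smul, smul_eq_mul] at this ⊢
      norm_num at this ⊢
      linear_combination this / 2
    · intro q
      have e0 := k2 q
      rw [← sub_eq_zero, ← Submodule.Quotient.mk_smul, ← Submodule.Quotient.mk_smul,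
        ← Submodule.Quotient.mk_smul, ← Submodule.Quotient.mk_sub, ← Submodule.Quotient.mk_add,
        ← Submodule.Quotient.mk_sub, ← Submodule.Quotient.mk_sub] at e0
      filter_upwards [germ_eventually two_ne_zero hε e0] with n hn v hv
      have := hn v hv
      simp only [LinearMap.sub_apply, LinearMap.add_apply, LinearMap.comp_apply,
        LinearMap.smul_apply, map_smul, smul_eq_mul] at this ⊢
      norm_num at this ⊢
      linear_combination this / 2
  choose! Q hQ using loc
  refine ⟨max (Q 0) (Q 1), k, ?_⟩
  have : u (max (Q 0) (Q 1)) = 0 := by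
    rw [← hΘ]
    refine (Submodule.Quotient.mk_eq_zero _).2 ((mem_hvNull_iff two_ne_zero).2 fun ε hε => ?_)
    refine hQ ε hε _ ?_
    obtain rfl | rfl : ε = 0 ∨ ε = 1 := by omega
    · exact le_max_left _ _
    · exact le_max_right _ _
  exact this

lemma mk_eq_zero_iff {φ : Dual ℂ M} : (Submodule.Quotient.mk φ : HVGerm X lam) = 0 ↔
    ∃ K : ℤ, ∀ k ≥ K, ∀ v ∈ hvWt X lam k, φ v = 0 :=
  Submodule.Quotient.mk_eq_zero _

lemma apply_L0 {k : ℤ} {v : M} (hv : v ∈ hvWt X lam k) (φ : Dual ℂ M) :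
    φ (X .L 0 v) = (lam + k) * φ v := by
  rw [mem_hvWt.1 hv, map_smul, smul_eq_mul]

lemma HVEigen_lift (h : HVData X c l a lam p) {b : ℂ} {φ : Dual ℂ M}
    (hφ : HVEigen h.germAct b (Submodule.Quotient.mk φ)) (i : ℤ) :
    ∃ K : ℤ, ∀ k ≥ K, ∀ v ∈ hvWt X lam k, φ (X .L i v) = (lam + k + i * b) * φ v := by
  have h1 := hφ i
  rw [germAct_mk, germAct_mk, ← sub_eq_zero, ← Submodule.Quotient.mk_smul,
    ← Submodule.Quotient.mk_add, ← Submodule.Quotient.mk_sub] at h1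
  obtain ⟨K, hK⟩ := mk_eq_zero_iff.1 h1
  refine ⟨K, fun k hk v hv => ?_⟩
  have := hK k hk v hv
  simp only [LinearMap.sub_apply, LinearMap.add_apply, LinearMap.comp_apply, LinearMap.smul_apply,
    smul_eq_mul, apply_L0 hv] at this
  linear_combination this

theorem finite_eigen (h : HVData X c l a lam p) {C : ℕ}
    (hC : ∀ k : ℤ, 2 ≤ k → finrank ℂ (hvWt X lam k) ≤ C) :
    {b : ℂ | ∃ φ : HVGerm X lam, φ ≠ 0 ∧ HVEigen h.germAct b φ}.Finite := by
  set S := {b : ℂ | ∃ φ : HVGerm X lam, φ ≠ 0 ∧ HVEigen h.germAct b φ} with hS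
  have hfun : ∀ b ∈ S, ∃ (φ : Dual ℂ M) (K : ℤ), ∀ k ≥ K, (∃ v ∈ hvWt X lam k, φ v ≠ 0) ∧
      ∀ v ∈ hvWt X lam k, φ (X .L (-1) (X .L 1 v)) =
        ((lam + k) ^ 2 + (lam + k) + b * (1 - b)) * φ v := by
    rintro b ⟨ψ, hψ0, hψ⟩
    obtain ⟨φ, rfl⟩ := Submodule.Quotient.mk_surjective _ ψ
    obtain ⟨K₁, h1⟩ := h.HVEigen_lift hψ 1
    obtain ⟨K₂, h2⟩ := h.HVEigen_lift hψ (-1)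
    obtain ⟨N, hN⟩ := exists_nat_gt ‖lam + b‖
    set K := max (max K₁ K₂) N
    have hK : ∀ k ≥ K, K₁ ≤ k ∧ K₂ ≤ k ∧ (N : ℤ) ≤ k := fun k hk => by omega
    have hx : ∀ k ≥ K, lam + (k : ℂ) + b ≠ 0 := by
      intro k hk hz
      have h2 : lam + b = -(k : ℂ) := by linear_combination hz
      rw [h2, norm_neg, Complex.norm_intCast] at hN
      have h3 : ((N : ℤ) : ℝ) ≤ k := by exact_mod_cast (hK k hk).2.2
      have := le_abs_self (k : ℝ)
      push_cast at h3
      linarith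
    obtain ⟨k₀, hk₀, v₀, hv₀, hφ₀⟩ : ∃ k ≥ K, ∃ v ∈ hvWt X lam k, φ v ≠ 0 := by
      by_contra! hcon
      exact hψ0 (mk_eq_zero_iff.2 ⟨K, hcon⟩)
    have hex : ∀ n : ℕ, ∃ v ∈ hvWt X lam (k₀ + n), φ v ≠ 0 := by
      intro n
      induction n with
      | zero => exact ⟨v₀, by simpa using hv₀, hφ₀⟩
      | succ n ih =>
        obtain ⟨v, hv, hv0⟩ := ih
        have hkn : k₀ + n ≥ K := by omega
        refine ⟨_, h.X_mem' .L (j := 1) hv (by push_cast; ring), ?_⟩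
        rw [h1 _ (hK _ hkn).1 v hv]
        refine mul_ne_zero ?_ hv0
        simpa using hx _ hkn
    refine ⟨φ, k₀, fun k hk => ⟨?_, fun v hv => ?_⟩⟩
    · have := hex (k - k₀).toNat
      rwa [show k₀ + ((k - k₀).toNat : ℤ) = k by omega] at this
    · have hkK : k ≥ K := by omega
      rw [h2 (k + 1) (by have := (hK _ hkK).2.1; omega) _ (h.X_mem' .L (j := 1) hv rfl),
        h1 k (hK _ hkK).1 v hv]
      push_cast; ring
  have himg : ((fun b : ℂ => b * (1 - b)) '' S).Finite := by
    by_contra hinf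
    obtain ⟨F, hFs, hFc⟩ := Set.Infinite.exists_subset_card_eq hinf (C + 1)
    choose g hg hgF using fun y : F => hFs y.2
    choose φ K hφ using fun y : F => hfun (g y) (hg y)
    obtain ⟨k, hk2, hkK⟩ : ∃ k : ℤ, 2 ≤ k ∧ ∀ y, K y ≤ k := by
      obtain ⟨k, hk⟩ := (Finset.univ.image K).bddAbove
      exact ⟨max 2 k, le_max_left _ _, fun y => le_trans (hk (by simp)) (le_max_right _ _)⟩
    have hmap : ∀ v ∈ hvWt X lam k, X .L (-1) (X .L 1 v) ∈ hvWt X lam k := fun v hv =>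
      h.X_mem' .L (h.X_mem' .L (j := 1) hv rfl) (by ring)
    set τ : End ℂ (hvWt X lam k) := (X .L (-1) * X .L 1).restrict hmap with hτ
    have := h.fin k
    have hli := Module.End.eigenvectors_linearIndependent' τ.dualMap
      (fun y : F => (lam + k) ^ 2 + (lam + k) + (y : ℂ))
      (fun y z hyz => Subtype.ext (by simpa using hyz))
      (fun y => (φ y).comp (hvWt X lam k).subtype) (fun y => by
        refine ⟨Module.End.mem_eigenspace_iff.2 ?_, fun h0 => ?_⟩
        · ext v
          have := (hφ y k (hkK y)).2 v v.2
          simp only at hgF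
          rw [hgF] at this
          simpa [hτ] using this
        · obtain ⟨v, hv, hv0⟩ := (hφ y k (hkK y)).1
          exact hv0 (by simpa using congrArg (fun f => f ⟨v, hv⟩) h0))
    have := hli.fintype_card_le_finrank
    rw [Subspace.dual_finrank_eq, Fintype.card_coe, hFc] at this
    have := hC k hk2
    omega
  refine Set.Finite.of_finite_fibers _ himg (fun z _ => ?_)
  refine Set.Finite.subset (Polynomial.finite_setOfPred_isRoot
    (p := (Polynomial.X * (1 - Polynomial.X) - Polynomial.C z : Polynomial ℂ)) ?_) ?_
  · intro h0
    have := congrArg (fun q => q.coeff 2) h0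
    simp [mul_sub, ← sq, Polynomial.coeff_X] at this
  · rintro b ⟨-, hb⟩
    simp only [Set.mem_preimage, Set.mem_singleton_iff] at hb
    simp [hb]

end HVData

namespace HVData
variable {M : Type} [AddCommGroup M] [Module ℂ M] {X : HVGen → ℤ → End ℂ M}
    {c l a lam : ℂ} {p : End ℂ M}

/-- Exchanging the even and the odd part. -/
lemma flip (h : HVData X c l a lam p) : HVData X c l a lam (1 - p) where
  rel := h.rel
  pp v := by simp [h.pp]
  pL i v := by simp [h.pL]
  pH i v := by simp [h.pH]
  pG i v := by simp [h.pG]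
  pQ i v := by simp [h.pQ]
  simple N hN hp := h.simple N hN fun v hv => by
    have := N.sub_mem hv (hp v hv)
    simpa using this
  ne := h.ne
  top := h.top
  fin := h.fin

/-- A pair of functionals intertwining `M` with a tensor module in large degrees. -/
structure TensorPair (X : HVGen → ℤ → End ℂ M) (lam : ℂ) (p : End ℂ M) (b d : ℂ)
    (φ φ' : Dual ℂ M) (K : ℤ) : Prop where
  ne : ∀ n : ℤ, ∃ k ≥ n, ∃ v ∈ hvWt X lam k, φ v ≠ 0
  even : ∀ v, φ (p v) = φ v
  odd : ∀ v, φ' (p v) = 0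
  L : ∀ k ≥ K, ∀ i : ℤ, -2 ≤ i → i ≤ 2 → ∀ v ∈ hvWt X lam k,
    φ (X .L i v) = (lam + k + i * b) * φ v
  L' : ∀ k ≥ K, ∀ i : ℤ, -2 ≤ i → i ≤ 2 → ∀ v ∈ hvWt X lam k,
    φ' (X .L i v) = (lam + k + i * b + i / 2) * φ' v
  G : ∀ k ≥ K, ∀ i : ℤ, -2 ≤ i → i ≤ 2 → ∀ v ∈ hvWt X lam k, φ (X .G i v) = -φ' v
  G' : ∀ k ≥ K, ∀ i : ℤ, -2 ≤ i → i ≤ 2 → ∀ v ∈ hvWt X lam k,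
    φ' (X .G i v) = (lam + k + 2 * i * b) * φ v
  H : ∀ k ≥ K, ∀ i : ℤ, -2 ≤ i → i ≤ 2 → ∀ v ∈ hvWt X lam k, φ (X .H i v) = d * φ v
  H' : ∀ k ≥ K, ∀ i : ℤ, -2 ≤ i → i ≤ 2 → ∀ v ∈ hvWt X lam k, φ' (X .H i v) = d * φ' v
  Q : ∀ k ≥ K, ∀ i : ℤ, -2 ≤ i → i ≤ 2 → ∀ v ∈ hvWt X lam k, φ (X .Q i v) = 0
  Q' : ∀ k ≥ K, ∀ i : ℤ, -2 ≤ i → i ≤ 2 → ∀ v ∈ hvWt X lam k, φ' (X .Q i v) = -d * φ v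

lemma exists_uniform {P : ℤ → ℤ → Prop} (hP : ∀ i, ∃ K : ℤ, ∀ k ≥ K, P i k) :
    ∃ K : ℤ, ∀ k ≥ K, ∀ i : ℤ, -2 ≤ i → i ≤ 2 → P i k := by
  choose K hK using hP
  obtain ⟨B, hB⟩ := ((Finset.Icc (-2 : ℤ) 2).image K).bddAbove
  exact ⟨B, fun k hk i h1 h2 => hK i k
    (le_trans (hB (Finset.mem_coe.2 (Finset.mem_image_of_mem K (Finset.mem_Icc.2 ⟨h1, h2⟩)))) hk)⟩

lemma tensorPair_of_functional (h : HVData X 0 0 0 lam p) {b d : ℂ}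
    (hd : ∀ v, X .H 0 v = d • v) {φ : Dual ℂ M} (hev : ∀ v, φ (p v) = φ v)
    (hne : ∀ n : ℤ, ∃ k ≥ n, ∃ v ∈ hvWt X lam k, φ v ≠ 0)
    (hL : ∀ i : ℤ, ∃ K : ℤ, ∀ k ≥ K, ∀ v ∈ hvWt X lam k, φ (X .L i v) = (lam + k + i * b) * φ v)
    (hG : ∀ i : ℤ, ∃ K : ℤ, ∀ k ≥ K, ∀ v ∈ hvWt X lam k, φ (X .G i v) = φ (X .G 0 v))
    (hH : ∀ i : ℤ, ∃ K : ℤ, ∀ k ≥ K, ∀ v ∈ hvWt X lam k, φ (X .H i v) = φ (X .H 0 v))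
    (hQ : ∀ i : ℤ, ∃ K : ℤ, ∀ k ≥ K, ∀ v ∈ hvWt X lam k, φ (X .Q i v) = 0) :
    ∃ K, TensorPair X lam p b d φ (-(φ ∘ₗ X .G 0)) K := by
  obtain ⟨KL, hL⟩ := exists_uniform hL
  obtain ⟨KG, hG⟩ := exists_uniform hG
  obtain ⟨KH, hH⟩ := exists_uniform hH
  obtain ⟨KQ, hQ⟩ := exists_uniform hQ
  set K := max (max KL KG) (max KH KQ) with hK
  have hm : ∀ k ≥ K, k ≥ KL ∧ k ≥ KG ∧ k ≥ KH ∧ k ≥ KQ := fun k hk => by omega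
  have g0 : ∀ {k : ℤ} {v}, v ∈ hvWt X lam k → X .G 0 v ∈ hvWt X lam k := fun hv =>
    h.X_mem' .G hv (by ring)
  refine ⟨K, ⟨hne, hev, fun v => ?_, fun k hk i h1 h2 v hv => hL k (hm k hk).1 i h1 h2 v hv,
    fun k hk i h1 h2 v hv => ?_, fun k hk i h1 h2 v hv => ?_, fun k hk i h1 h2 v hv => ?_,
    fun k hk i h1 h2 v hv => by
      rw [hH k (hm k hk).2.2.1 i h1 h2 v hv, hd, map_smul, smul_eq_mul],
    fun k hk i h1 h2 v hv => ?_,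
    fun k hk i h1 h2 v hv => hQ k (hm k hk).2.2.2 i h1 h2 v hv, fun k hk i h1 h2 v hv => ?_⟩⟩ <;>
  simp only [LinearMap.neg_apply, LinearMap.comp_apply, neg_neg]
  · rw [← hev, h.pG, h.pp, sub_self, map_zero, map_zero, neg_zero]
  · have h3 := congrArg φ (h.LG i 0 v)
    rw [map_add, map_smul, hL k (hm k hk).1 i h1 h2 _ (g0 hv), add_zero,
      hG k (hm k hk).2.1 i h1 h2 v hv, smul_eq_mul] at h3
    push_cast at h3
    linear_combination h3
  · exact hG k (hm k hk).2.1 i h1 h2 v hv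
  · have h3 := congrArg φ (h.GG 0 i v)
    have h4 := congrArg φ (h.GG 0 0 v)
    simp only [map_add, map_neg, map_smul, hG k (hm k hk).2.1 i h1 h2 _ (g0 hv), zero_add,
      hL k (hm k hk).1 i h1 h2 v hv, apply_L0 hv, smul_eq_mul, mul_zero, ite_self, zero_mul,
      add_zero] at h3 h4
    linear_combination -h3 + h4 / 2
  · rw [h.GH, map_add, map_smul, hH k (hm k hk).2.2.1 i h1 h2 _ (g0 hv), hd, map_smul, smul_eq_mul,
      zero_add, hQ k (hm k hk).2.2.2 i h1 h2 v hv, smul_zero]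
    ring
  · rw [h.GQ, map_add, map_add, map_neg, hQ k (hm k hk).2.2.2 i h1 h2 _ (g0 hv), zero_add,
      hH k (hm k hk).2.2.1 i h1 h2 v hv, hd, map_smul]
    simp

/-- Relations for the composite of a germ with the parity projection. -/
lemma exists_tensorPair_of_germ (h : HVData X 0 0 0 lam p) {b d : ℂ}
    (hd : ∀ v, X .H 0 v = d • v) {φ : Dual ℂ M}
    (hL : ∀ i : ℤ, ∃ K : ℤ, ∀ k ≥ K, ∀ v ∈ hvWt X lam k, φ (X .L i v) = (lam + k + i * b) * φ v)
    (hG : ∀ i : ℤ, ∃ K : ℤ, ∀ k ≥ K, ∀ v ∈ hvWt X lam k, φ (X .G i v) = φ (X .G 0 v))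
    (hH : ∀ i : ℤ, ∃ K : ℤ, ∀ k ≥ K, ∀ v ∈ hvWt X lam k, φ (X .H i v) = φ (X .H 0 v))
    (hQ : ∀ i : ℤ, ∃ K : ℤ, ∀ k ≥ K, ∀ v ∈ hvWt X lam k, φ (X .Q i v) = 0)
    (hne : ∀ n : ℤ, ∃ k ≥ n, ∃ v ∈ hvWt X lam k, φ (p v) ≠ 0) :
    ∃ φ₀ φ₁ K, TensorPair X lam p b d φ₀ φ₁ K := by
  refine ⟨φ ∘ₗ p, _, h.tensorPair_of_functional (b := b) hd (fun v => ?_) hne (fun i => ?_)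
    (fun i => ?_) (fun i => ?_) (fun i => ?_)⟩
  · simp only [LinearMap.comp_apply, h.pp]
  · obtain ⟨K, hK⟩ := hL i
    exact ⟨K, fun k hk v hv => by
      simp only [LinearMap.comp_apply, h.pL]; exact hK k hk _ (h.p_mem hv)⟩
  · obtain ⟨K, hK⟩ := hG i
    exact ⟨K, fun k hk v hv => by
      simp only [LinearMap.comp_apply, h.pG]
      exact hK k hk _ (Submodule.sub_mem _ hv (h.p_mem hv))⟩
  · obtain ⟨K, hK⟩ := hH i
    exact ⟨K, fun k hk v hv => by
      simp only [LinearMap.comp_apply, h.pH]; exact hK k hk _ (h.p_mem hv)⟩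
  · obtain ⟨K, hK⟩ := hQ i
    exact ⟨K, fun k hk v hv => by
      simp only [LinearMap.comp_apply, h.pQ]
      exact hK k hk _ (Submodule.sub_mem _ hv (h.p_mem hv))⟩

theorem exists_tensorPair (h : HVData X c l a lam p) {C : ℕ}
    (hC : ∀ k : ℤ, 2 ≤ k → finrank ℂ (hvWt X lam k) ≤ C)
    (hne : ∀ n : ℤ, ∃ k ≥ n, hvWt X lam k ≠ ⊥) :
    c = 0 ∧ l = 0 ∧ a = 0 ∧ ∃ (p' : End ℂ M) (b d : ℂ) (φ₀ φ₁ : Dual ℂ M) (K : ℤ),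
      (p' = p ∨ p' = 1 - p) ∧ TensorPair X lam p' b d φ₀ φ₁ K := by
  obtain ⟨rfl, b₀, ψ, hb₀, hψ0, hψ⟩ := h.exists_eigen hC hne
  obtain ⟨rfl, rfl, hloc⟩ := h.germ.local_of_eigen hψ0 hψ
    (h.exists_locality hC hb₀ hψ (s := -1 / 2) (k := -1) (by norm_num) h.germ.LG)
    (h.exists_locality hC hb₀ hψ (s := 1 / 2) (k := 1) (by norm_num) h.germ.LQ)
  refine ⟨rfl, rfl, rfl, ?_⟩
  obtain ⟨b, χ, hχ0, hL, hG, hH, hQ⟩ := h.germ.exists_tensor (h.finite_eigen hC)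
    ⟨b₀, ψ, hψ0, hψ, hloc⟩
  obtain ⟨d, hd⟩ := h.exists_H_zero
  obtain ⟨φ, rfl⟩ := Submodule.Quotient.mk_surjective _ χ
  have hL' := fun i => h.HVEigen_lift hL i
  have hG' : ∀ i : ℤ, ∃ K : ℤ, ∀ k ≥ K, ∀ v ∈ hvWt X lam k, φ (X .G i v) = φ (X .G 0 v) := by
    intro i
    have h1 := hG i
    rw [germAct_mk, germAct_mk, ← sub_eq_zero, ← Submodule.Quotient.mk_sub] at h1
    obtain ⟨K, hK⟩ := mk_eq_zero_iff.1 h1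
    exact ⟨K, fun k hk v hv => sub_eq_zero.1 (hK k hk v hv)⟩
  have hH' : ∀ i : ℤ, ∃ K : ℤ, ∀ k ≥ K, ∀ v ∈ hvWt X lam k, φ (X .H i v) = φ (X .H 0 v) := by
    intro i
    have h1 := hH i
    rw [germAct_mk, germAct_mk, ← sub_eq_zero, ← Submodule.Quotient.mk_sub] at h1
    obtain ⟨K, hK⟩ := mk_eq_zero_iff.1 h1
    exact ⟨K, fun k hk v hv => sub_eq_zero.1 (hK k hk v hv)⟩
  have hQ' : ∀ i : ℤ, ∃ K : ℤ, ∀ k ≥ K, ∀ v ∈ hvWt X lam k, φ (X .Q i v) = 0 := by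
    intro i
    have h1 := hQ i
    rw [germAct_mk] at h1
    exact mk_eq_zero_iff.1 h1
  by_cases hp : ∀ n : ℤ, ∃ k ≥ n, ∃ v ∈ hvWt X lam k, φ (p v) ≠ 0
  · obtain ⟨φ₀, φ₁, K, hT⟩ := h.exists_tensorPair_of_germ hd hL' hG' hH' hQ' hp
    exact ⟨p, b, d, φ₀, φ₁, K, .inl rfl, hT⟩
  · push Not at hp
    obtain ⟨N, hN⟩ := hp
    obtain ⟨φ₀, φ₁, K, hT⟩ := h.flip.exists_tensorPair_of_germ hd hL' hG' hH' hQ' (fun n => by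
      by_contra! hcon
      refine hχ0 (mk_eq_zero_iff.2 ⟨max N n, fun k hk v hv => ?_⟩)
      have h1 := hN k (le_trans (le_max_left _ _) hk) v hv
      have h2 := hcon k (le_trans (le_max_right _ _) hk) v hv
      simpa [h1] using h2)
    exact ⟨1 - p, b, d, φ₀, φ₁, K, .inr rfl, hT⟩

end HVData

/-- The action on `Γ(λ, b, d)`. -/
noncomputable def hvAct (lam b d : ℂ) : HVGen → ℤ → End ℂ HVCar
  | .L => hvL lam b
  | .H => hvH d
  | .G => hvG lam b
  | .Q => hvQ d

/-- The projection of `Γ(λ, b, d)` onto its even part. -/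
noncomputable def hvEven : End ℂ HVCar :=
  Finsupp.lsum ℂ fun p : ℤ × Fin 2 => if p.2 = 0 then Finsupp.lsingle p else 0

section
variable (lam b d : ℂ)

lemma hvL_single (i k : ℤ) (r : Fin 2) (z : ℂ) : hvAct lam b d .L i (Finsupp.single (k, r) z) =
    Finsupp.single (k + i, r) ((lam + k + i * b + if r = 1 then (i : ℂ) / 2 else 0) * z) := by
  simp [hvAct, hvL]

lemma hvH_single (i k : ℤ) (r : Fin 2) (z : ℂ) : hvAct lam b d .H i (Finsupp.single (k, r) z) =
    Finsupp.single (k + i, r) (d * z) := by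
  simp [hvAct, hvH]

lemma hvG_single_zero (i k : ℤ) (z : ℂ) : hvAct lam b d .G i (Finsupp.single (k, 0) z) =
    Finsupp.single (k + i, 1) ((lam + k + 2 * i * b) * z) := by
  simp [hvAct, hvG]

lemma hvG_single_one (i k : ℤ) (z : ℂ) : hvAct lam b d .G i (Finsupp.single (k, 1) z) =
    Finsupp.single (k + i, 0) (-z) := by
  simp [hvAct, hvG]

lemma hvQ_single_zero (i k : ℤ) (z : ℂ) : hvAct lam b d .Q i (Finsupp.single (k, 0) z) =
    Finsupp.single (k + i, 1) (-d * z) := by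
  simp [hvAct, hvQ]

lemma hvQ_single_one (i k : ℤ) (z : ℂ) : hvAct lam b d .Q i (Finsupp.single (k, 1) z) = 0 := by
  simp [hvAct, hvQ]

lemma hvEven_single_zero (k : ℤ) (z : ℂ) :
    hvEven (Finsupp.single (k, 0) z) = Finsupp.single (k, 0) z := by
  simp [hvEven]

lemma hvEven_single_one (k : ℤ) (z : ℂ) : hvEven (Finsupp.single (k, 1) z) = 0 := by
  simp [hvEven]

lemma hvCar_hom_ext {N : Type*} [AddCommGroup N] [Module ℂ N] {f g : HVCar →ₗ[ℂ] N}
    (h0 : ∀ k, f (Finsupp.single (k, 0) 1) = g (Finsupp.single (k, 0) 1))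
    (h1 : ∀ k, f (Finsupp.single (k, 1) 1) = g (Finsupp.single (k, 1) 1)) : f = g := by
  refine Finsupp.lhom_ext' fun ⟨k, r⟩ => LinearMap.ext_ring ?_
  fin_cases r
  · exact h0 k
  · exact h1 k

lemma hvRel : HVRel (hvAct lam b d) 0 0 0 where
  rel := by
    constructor
    case central_CL | central_CLa | central_Ca => simp
    all_goals
      intro i j
      refine hvCar_hom_ext (fun k => ?_) (fun k => ?_)
      all_goals
        have e : k + i + j = k + (i + j) := by ring
        have e' : k + j + i = k + (i + j) := by ring
        simp only [LinearMap.sub_apply, LinearMap.add_apply, LinearMap.smul_apply,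
          Module.End.mul_apply, hvL_single, hvH_single, hvG_single_zero, hvG_single_one,
          hvQ_single_zero, hvQ_single_one, e, e', ← Finsupp.single_sub, ← Finsupp.single_add,
          Finsupp.smul_single, smul_eq_mul, zero_smul, smul_zero, add_zero, sub_self, map_zero,
          LinearMap.zero_apply, zero_add, zero_ne_one, if_true,
          if_false]
        try refine (congrArg (Finsupp.single _) ?_).trans (Finsupp.single_zero _)
        try refine congrArg (Finsupp.single _) ?_
        try (push_cast; ring)

lemma hvEven_L (i : ℤ) (w : HVCar) :
    hvEven (hvAct lam b d .L i w) = hvAct lam b d .L i (hvEven w) :=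
  LinearMap.congr_fun (f := hvEven * hvAct lam b d .L i) (g := hvAct lam b d .L i * hvEven)
    (hvCar_hom_ext
    (fun k => by simp only [Module.End.mul_apply, hvEven_single_zero, hvL_single])
    (fun k => by simp only [Module.End.mul_apply, hvEven_single_one, hvL_single, map_zero])) w

lemma hvEven_H (i : ℤ) (w : HVCar) :
    hvEven (hvAct lam b d .H i w) = hvAct lam b d .H i (hvEven w) :=
  LinearMap.congr_fun (f := hvEven * hvAct lam b d .H i) (g := hvAct lam b d .H i * hvEven)
    (hvCar_hom_ext
    (fun k => by simp only [Module.End.mul_apply, hvEven_single_zero, hvH_single])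
    (fun k => by simp only [Module.End.mul_apply, hvEven_single_one, hvH_single, map_zero])) w

lemma hvEven_G (i : ℤ) (w : HVCar) :
    hvEven (hvAct lam b d .G i w) = hvAct lam b d .G i (w - hvEven w) :=
  LinearMap.congr_fun (f := hvEven * hvAct lam b d .G i)
    (g := hvAct lam b d .G i * (1 - hvEven)) (hvCar_hom_ext
    (fun k => by simp only [Module.End.mul_apply, LinearMap.sub_apply, Module.End.one_apply,
      hvEven_single_zero, hvEven_single_one, hvG_single_zero, sub_self, map_zero])
    (fun k => by simp only [Module.End.mul_apply, LinearMap.sub_apply, Module.End.one_apply,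
      hvEven_single_zero, hvEven_single_one, hvG_single_one, sub_zero])) w

lemma hvEven_Q (i : ℤ) (w : HVCar) :
    hvEven (hvAct lam b d .Q i w) = hvAct lam b d .Q i (w - hvEven w) :=
  LinearMap.congr_fun (f := hvEven * hvAct lam b d .Q i)
    (g := hvAct lam b d .Q i * (1 - hvEven)) (hvCar_hom_ext
    (fun k => by simp [hvEven_single_zero, hvEven_single_one, hvQ_single_zero])
    (fun k => by simp [hvEven_single_one, hvQ_single_one])) w

end

lemma hvEven_apply (w : HVCar) (k : ℤ) (r : Fin 2) :
    hvEven w (k, r) = if r = 0 then w (k, r) else 0 := by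
  have : (Finsupp.lapply (k, r) : HVCar →ₗ[ℂ] ℂ) ∘ₗ hvEven =
      (if r = 0 then 1 else 0 : ℂ) • Finsupp.lapply (k, r) := by
    refine hvCar_hom_ext (fun j => ?_) (fun j => ?_)
    · fin_cases r <;> simp [hvEven_single_zero]
    · fin_cases r <;> simp [hvEven_single_one]
  have := LinearMap.congr_fun this w
  rw [LinearMap.smul_apply] at this
  simpa [ite_mul] using this

/-- The diagonal action on a product. -/
noncomputable def prodAct {M N : Type} [AddCommGroup M] [Module ℂ M] [AddCommGroup N] [Module ℂ N]
    (X : HVGen → ℤ → End ℂ M) (Y : HVGen → ℤ → End ℂ N) (g : HVGen) (i : ℤ) : End ℂ (M × N) :=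
  (X g i).prodMap (Y g i)

lemma HVRel.prod {M N : Type} [AddCommGroup M] [Module ℂ M] [AddCommGroup N] [Module ℂ N]
    {X : HVGen → ℤ → End ℂ M} {Y : HVGen → ℤ → End ℂ N} {c l a : ℂ} (h : HVRel X c l a)
    (h' : HVRel Y c l a) : HVRel (prodAct X Y) c l a where
  rel := by
    have key : ∀ {f g : End ℂ (M × N)} {f₁ g₁ : End ℂ M} {f₂ g₂ : End ℂ N}, f₁ = g₁ → f₂ = g₂ →
        (∀ v, f v = (f₁ v.1, f₂ v.2)) → (∀ v, g v = (g₁ v.1, g₂ v.2)) → f = g := by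
      rintro f g f₁ g₁ f₂ g₂ rfl rfl h1 h2
      exact LinearMap.ext fun v => (h1 v).trans (h2 v).symm
    exact {
      comm_LL := fun i j => key (h.rel.comm_LL i j) (h'.rel.comm_LL i j)
        (fun _ => rfl) (fun _ => rfl)
      comm_LH := fun i j => key (h.rel.comm_LH i j) (h'.rel.comm_LH i j)
        (fun _ => rfl) (fun _ => rfl)
      comm_LG := fun i j => key (h.rel.comm_LG i j) (h'.rel.comm_LG i j)
        (fun _ => rfl) (fun _ => rfl)
      comm_LQ := fun i j => key (h.rel.comm_LQ i j) (h'.rel.comm_LQ i j)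
        (fun _ => rfl) (fun _ => rfl)
      comm_HH := fun i j => key (h.rel.comm_HH i j) (h'.rel.comm_HH i j)
        (fun _ => rfl) (fun _ => rfl)
      comm_GH := fun i j => key (h.rel.comm_GH i j) (h'.rel.comm_GH i j)
        (fun _ => rfl) (fun _ => rfl)
      comm_HQ := fun i j => key (h.rel.comm_HQ i j) (h'.rel.comm_HQ i j)
        (fun _ => rfl) (fun _ => rfl)
      comm_GQ := fun i j => key (h.rel.comm_GQ i j) (h'.rel.comm_GQ i j)
        (fun _ => rfl) (fun _ => rfl)
      comm_GG := fun i j => key (h.rel.comm_GG i j) (h'.rel.comm_GG i j)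
        (fun _ => rfl) (fun _ => rfl)
      comm_QQ := fun i j => key (h.rel.comm_QQ i j) (h'.rel.comm_QQ i j)
        (fun _ => rfl) (fun _ => rfl)
      central_CL := by simp [smul_comm c]
      central_CLa := by simp [smul_comm l]
      central_Ca := by simp }

section
variable (lam b d : ℂ)

/-- Each coefficient of the action is a multiple of a single coefficient of the argument. -/
lemma hvAct_coeff (g : HVGen) (j k : ℤ) (r : Fin 2) : ∃ (κ : ℂ) (r' : Fin 2),
    ∀ w, hvAct lam b d g j w (k, r) = κ * w (k - j, r') := by
  suffices hs : ∃ (κ : ℂ) (r' : Fin 2), (Finsupp.lapply (k, r) : HVCar →ₗ[ℂ] ℂ) ∘ₗ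
      hvAct lam b d g j = κ • Finsupp.lapply (k - j, r') by
    obtain ⟨κ, r', h⟩ := hs
    exact ⟨κ, r', fun w => LinearMap.congr_fun h w⟩
  have e : ∀ (n : ℤ) (s t : Fin 2) (z y : ℂ), (s = t → n = k - j → z = y) →
      (Finsupp.single (n + j, s) z : HVCar) (k, t) = if n = k - j ∧ s = t then y else 0 := by
    intro n s t z y hzy
    rw [Finsupp.single_apply]
    by_cases h1 : n = k - j ∧ s = t
    · rw [if_pos h1, if_pos (by rw [h1.1, h1.2, sub_add_cancel]), hzy h1.2 h1.1]
    · rw [if_neg h1, if_neg]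
      rintro h
      rw [Prod.mk.injEq] at h
      exact h1 ⟨by rw [← h.1, add_sub_cancel_right], h.2⟩
  have e' : ∀ (n : ℤ) (s t : Fin 2), (Finsupp.single (n, s) 1 : HVCar) (k - j, t) =
      if n = k - j ∧ s = t then 1 else 0 := by
    intro n s t
    rw [Finsupp.single_apply]
    simp only [Prod.mk.injEq]
  cases g
  · refine ⟨lam + (k - j : ℤ) + j * b + if r = 1 then (j : ℂ) / 2 else 0, r,
      hvCar_hom_ext (fun n => ?_) (fun n => ?_)⟩
    all_goals
      simp only [LinearMap.comp_apply, LinearMap.smul_apply, Finsupp.lapply_apply, hvL_single, e',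
        smul_eq_mul]
      rw [e _ _ _ _ (lam + (k - j : ℤ) + j * b + if r = 1 then (j : ℂ) / 2 else 0)
        (by rintro rfl rfl; simp only [mul_one])]
      split_ifs <;> simp
  · refine ⟨d, r, hvCar_hom_ext (fun n => ?_) (fun n => ?_)⟩
    all_goals
      simp only [LinearMap.comp_apply, LinearMap.smul_apply, Finsupp.lapply_apply, hvH_single, e',
        smul_eq_mul]
      rw [e _ _ _ _ d (by rintro rfl rfl; rw [mul_one])]
      split_ifs <;> simp
  · fin_cases r
    · refine ⟨-1, 1, hvCar_hom_ext (fun n => ?_) (fun n => ?_)⟩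
      · simp [hvG_single_zero]
      · simp only [LinearMap.comp_apply, LinearMap.smul_apply, Finsupp.lapply_apply,
          hvG_single_one, e', smul_eq_mul]
        exact (e _ 0 0 _ (-1) (fun _ _ => rfl)).trans (by simp)
    · refine ⟨lam + (k - j : ℤ) + 2 * j * b, 0, hvCar_hom_ext (fun n => ?_) (fun n => ?_)⟩
      · simp only [LinearMap.comp_apply, LinearMap.smul_apply, Finsupp.lapply_apply,
          hvG_single_zero, e', smul_eq_mul]
        exact (e _ 1 1 _ (lam + (k - j : ℤ) + 2 * j * b) (by rintro - rfl; rw [mul_one])).trans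
          (by simp)
      · simp [hvG_single_one]
  · fin_cases r
    · refine ⟨0, 1, hvCar_hom_ext (fun n => ?_) (fun n => ?_)⟩
      · simp [hvQ_single_zero]
      · simp [hvQ_single_one]
    · refine ⟨-d, 0, hvCar_hom_ext (fun n => ?_) (fun n => ?_)⟩
      · simp only [LinearMap.comp_apply, LinearMap.smul_apply, Finsupp.lapply_apply,
          hvQ_single_zero, e', smul_eq_mul]
        exact (e _ 1 1 _ (-d) (fun _ _ => mul_one _)).trans (by simp)
      · simp [hvQ_single_one]

end

namespace HVData
variable {M : Type} [AddCommGroup M] [Module ℂ M] {X : HVGen → ℤ → End ℂ M}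
    {lam : ℂ} {p : End ℂ M}

/-- The map from the `k`-th weight space to the `k`-th weight space of the tensor module. -/
noncomputable def tensorMap (φ φ' : Dual ℂ M) (k : ℤ) : M →ₗ[ℂ] HVCar :=
  Finsupp.lsingle (k, 0) ∘ₗ φ + Finsupp.lsingle (k, 1) ∘ₗ φ'

lemma tensorMap_apply (φ φ' : Dual ℂ M) (k : ℤ) (v : M) : tensorMap φ φ' k v =
    Finsupp.single (k, 0) (φ v) + Finsupp.single (k, 1) (φ' v) := rfl

lemma tensorMap_coeff (φ φ' : Dual ℂ M) (k : ℤ) (v : M) (n : ℤ) (r : Fin 2) :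
    tensorMap φ φ' k v (n, r) = if n = k then (if r = 0 then φ v else φ' v) else 0 := by
  rw [tensorMap_apply, Finsupp.add_apply, Finsupp.single_apply, Finsupp.single_apply]
  simp only [Prod.mk.injEq, eq_comm (a := k)]
  fin_cases r <;> simp

variable {b d : ℂ} {φ φ' : Dual ℂ M} {K : ℤ}

lemma TensorPair.map_act (T : TensorPair X lam p b d φ φ' K) (g : HVGen) {k : ℤ} (hk : K ≤ k)
    {i : ℤ} (h1 : -2 ≤ i) (h2 : i ≤ 2) {v : M} (hv : v ∈ hvWt X lam k) :
    tensorMap φ φ' (k + i) (X g i v) = hvAct lam b d g i (tensorMap φ φ' k v) := by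
  simp only [tensorMap_apply, map_add]
  cases g
  · rw [T.L k hk i h1 h2 v hv, T.L' k hk i h1 h2 v hv, hvL_single, hvL_single]
    simp
  · rw [T.H k hk i h1 h2 v hv, T.H' k hk i h1 h2 v hv, hvH_single, hvH_single]
  · rw [T.G k hk i h1 h2 v hv, T.G' k hk i h1 h2 v hv, hvG_single_zero, hvG_single_one, add_comm]
  · rw [T.Q k hk i h1 h2 v hv, T.Q' k hk i h1 h2 v hv, hvQ_single_zero, hvQ_single_one,
      Finsupp.single_zero, zero_add, add_zero]

lemma TensorPair.map_even (T : TensorPair X lam p b d φ φ' K) (k : ℤ) (v : M) :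
    tensorMap φ φ' k (p v) = hvEven (tensorMap φ φ' k v) := by
  rw [tensorMap_apply, tensorMap_apply, T.even, T.odd, map_add, hvEven_single_zero,
    hvEven_single_one, Finsupp.single_zero]

/-- The parity projection of the product. -/
noncomputable def prodEven (p : End ℂ M) : End ℂ (M × HVCar) := p.prodMap hvEven

lemma prodEven_parity (h : HVData X 0 0 0 lam p) (g : HVGen) (i : ℤ) :
    (∀ x, prodEven p (prodAct X (hvAct lam b d) g i x) =
      prodAct X (hvAct lam b d) g i (prodEven p x)) ∨
    (∀ x, prodEven p (prodAct X (hvAct lam b d) g i x) =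
      prodAct X (hvAct lam b d) g i (x - prodEven p x)) := by
  cases g
  · exact .inl fun x => Prod.ext (h.pL i _) (hvEven_L lam b d i _)
  · exact .inl fun x => Prod.ext (h.pH i _) (hvEven_H lam b d i _)
  · exact .inr fun x => Prod.ext (h.pG i _) (hvEven_G lam b d i _)
  · exact .inr fun x => Prod.ext (h.pQ i _) (hvEven_Q lam b d i _)

/-- The lowering operators of a product. -/
def lowering (X : HVGen → ℤ → End ℂ M) (lam b d : ℂ) : Set (End ℂ (M × HVCar)) :=
  {f | ∃ g, ∃ i : ℤ, -2 ≤ i ∧ i ≤ 0 ∧ f = prodAct X (hvAct lam b d) g i}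

/-- The graphs of the maps between weight spaces of large weight. -/
def graphGens (X : HVGen → ℤ → End ℂ M) (lam : ℂ) (φ φ' : Dual ℂ M) (K : ℤ) : Set (M × HVCar) :=
  {x | ∃ k ≥ K, x.1 ∈ hvWt X lam k ∧ x.2 = tensorMap φ φ' k x.1}

/-- The submodule of the product generated by the graphs. -/
noncomputable def graphSub (X : HVGen → ℤ → End ℂ M) (lam b d : ℂ) (φ φ' : Dual ℂ M) (K : ℤ) :
    Submodule ℂ (M × HVCar) :=
  stableClosure (lowering X lam b d) (graphGens X lam φ φ' K)

lemma graphSub_lower {g : HVGen} {i : ℤ} (h1 : -2 ≤ i) (h2 : i ≤ 0) {x : M × HVCar}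
    (hx : x ∈ graphSub X lam b d φ φ' K) :
    prodAct X (hvAct lam b d) g i x ∈ graphSub X lam b d φ φ' K :=
  stableClosure_stable (F := lowering X lam b d) ⟨g, i, h1, h2, rfl⟩ hx

lemma graphSub_invariant (h : HVData X 0 0 0 lam p) (T : TensorPair X lam p b d φ φ' K) :
    ∀ g i, ∀ x ∈ graphSub X lam b d φ φ' K,
      prodAct X (hvAct lam b d) g i x ∈ graphSub X lam b d φ φ' K := by
  have hZ := h.toHVRel.prod (hvRel lam b d)
  set Z := prodAct X (hvAct lam b d) with hZdef
  set 𝒟 := graphSub X lam b d φ φ' K with h𝒟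
  refine hZ.generate_all ?_
  let 𝒟' : Submodule ℂ (M × HVCar) :=
    { carrier := {x | x ∈ 𝒟 ∧ ∀ g (i : ℤ), 1 ≤ i → i ≤ 2 → Z g i x ∈ 𝒟}
      zero_mem' := ⟨zero_mem _, fun _ _ _ _ => by rw [map_zero]; exact zero_mem _⟩
      add_mem' := by
        rintro u v ⟨hu, hu'⟩ ⟨hv, hv'⟩
        refine ⟨add_mem hu hv, fun g i h1 h2 => ?_⟩
        rw [map_add]
        exact add_mem (hu' g i h1 h2) (hv' g i h1 h2)
      smul_mem' := by
        rintro z v ⟨hv, hv'⟩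
        refine ⟨Submodule.smul_mem _ _ hv, fun g i h1 h2 => ?_⟩
        rw [map_smul]
        exact Submodule.smul_mem _ _ (hv' g i h1 h2) }
  have hle : 𝒟 ≤ 𝒟' := by
    refine stableClosure_le ?_ ?_
    · rintro x ⟨k, hk, hx, hx'⟩
      refine ⟨subset_stableClosure ⟨k, hk, hx, hx'⟩, fun g i h1 h2 => ?_⟩
      refine subset_stableClosure ⟨k + i, by omega, h.X_mem g hx, ?_⟩
      change hvAct lam b d g i x.2 = tensorMap φ φ' (k + i) (X g i x.1)
      rw [hx', T.map_act g hk (by omega) h2 hx]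
    · rintro f ⟨g, j, hj1, hj2, rfl⟩ x ⟨hx, hx'⟩
      refine ⟨graphSub_lower hj1 hj2 hx, fun g' i h1 h2 => ?_⟩
      obtain ⟨σ, κ, κ', e, -, hb⟩ := hZ.bracket g' g i j
      rw [hb]
      refine add_mem (add_mem (Submodule.smul_mem _ _ (graphSub_lower hj1 hj2 (hx' g' i h1 h2)))
        (Submodule.smul_mem _ _ ?_)) (Submodule.smul_mem _ _ hx)
      rcases le_or_gt (i + j) 0 with h0 | h0
      · exact graphSub_lower (by omega) h0 hx
      · exact hx' e _ (by omega) (by omega)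
  intro g i h1 h2 x hx
  rcases le_or_gt i 0 with h0 | h0
  · exact graphSub_lower h1 h0 hx
  · exact (hle hx).2 g i h0 h2

lemma graphSub_even (h : HVData X 0 0 0 lam p) (T : TensorPair X lam p b d φ φ' K)
    {x : M × HVCar} (hx : x ∈ graphSub X lam b d φ φ' K) :
    prodEven p x ∈ graphSub X lam b d φ φ' K := by
  suffices hle : graphSub X lam b d φ φ' K ≤
      graphSub X lam b d φ φ' K ⊓ (graphSub X lam b d φ φ' K).comap (prodEven p) from (hle hx).2
  refine stableClosure_le ?_ ?_
  · rintro x ⟨k, hk, hx, hx'⟩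
    refine ⟨subset_stableClosure ⟨k, hk, hx, hx'⟩,
      subset_stableClosure ⟨k, hk, h.p_mem hx, ?_⟩⟩
    change hvEven x.2 = tensorMap φ φ' k (p x.1)
    rw [hx', T.map_even]
  · rintro f ⟨g, j, hj1, hj2, rfl⟩ x ⟨hx, hx'⟩
    refine ⟨graphSub_lower hj1 hj2 hx, ?_⟩
    change prodEven p (prodAct X (hvAct lam b d) g j x) ∈ graphSub X lam b d φ φ' K
    rcases h.prodEven_parity (b := b) (d := d) g j with hp | hp
    · rw [hp]; exact graphSub_lower hj1 hj2 hx'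
    · rw [hp]; exact graphSub_lower hj1 hj2 (sub_mem hx hx')

/-- The coefficients of large degree of a vector in the tensor module are determined by the
corresponding vector of `M`. -/
lemma graphSub_coeff (h : HVData X 0 0 0 lam p) (T : TensorPair X lam p b d φ φ' K) :
    ∃ Φ : ℤ → Fin 2 → Dual ℂ M, (∀ k, ∀ v ∈ hvWt X lam k, Φ k 0 v = φ v) ∧
      ∀ x ∈ graphSub X lam b d φ φ' K, ∀ k ≥ K, ∀ r, x.2 (k, r) = Φ k r x.1 := by
  have hex : ∀ (k : ℤ) (r : Fin 2), ∃ Φ : Dual ℂ M, ∀ n, ∀ v ∈ hvWt X lam n,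
      Φ v = if k = n then (if r = 0 then φ v else φ' v) else 0 := by
    intro k r
    obtain ⟨Φ, hΦ⟩ := exists_dual_extension (iSupIndep_hvWt (X := X) (lam := lam))
      fun n => (if k = n then (if r = 0 then φ else φ') else 0) ∘ₗ (hvWt X lam n).subtype
    refine ⟨Φ, fun n v hv => (hΦ n ⟨v, hv⟩).trans ?_⟩
    change (if k = n then (if r = 0 then φ else φ') else 0 : Dual ℂ M) v = _
    split_ifs <;> rfl
  choose Φ hΦ using hex
  refine ⟨Φ, fun k v hv => by rw [hΦ k 0 k v hv, if_pos rfl, if_pos rfl], ?_⟩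
  let 𝒯 : Submodule ℂ (M × HVCar) :=
    { carrier := {x | ∀ k ≥ K, ∀ r, x.2 (k, r) = Φ k r x.1}
      zero_mem' := fun k _ r => by simp
      add_mem' := fun hx hy k hk r => by simp [hx k hk r, hy k hk r]
      smul_mem' := fun z x hx k hk r => by simp [hx k hk r] }
  suffices hle : graphSub X lam b d φ φ' K ≤ 𝒯 from fun x hx => hle hx
  refine stableClosure_le ?_ ?_
  · rintro x ⟨k, hk, hx, hx'⟩ n hn r
    rw [hx', tensorMap_coeff, hΦ n r k _ hx]
  · rintro f ⟨g, j, hj1, hj2, rfl⟩ x hx k hk r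
    change hvAct lam b d g j x.2 (k, r) = Φ k r (X g j x.1)
    obtain ⟨κ, r', hκ⟩ := hvAct_coeff lam b d g j k r
    rw [hκ, hx (k - j) (by omega) r']
    have : Φ k r ∘ₗ X g j = κ • Φ (k - j) r' := by
      refine LinearMap.ext fun m => ?_
      have hm : m ∈ ⨆ n : ℤ, hvWt X lam n := by
        have := h.top
        exact this ▸ Submodule.mem_top
      induction hm using Submodule.iSup_induction' with
      | mem n v hv =>
        rw [LinearMap.comp_apply, hΦ k r (n + j) _ (h.X_mem g hv), LinearMap.smul_apply,
          hΦ _ _ n v hv]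
        by_cases hn : n = k - j
        · have e1 := hκ (tensorMap φ φ' n v)
          rw [← T.map_act g (by omega) hj1 (by omega) hv, tensorMap_coeff, tensorMap_coeff] at e1
          rw [e1, smul_eq_mul]
        · rw [if_neg (by omega), if_neg (by omega), smul_zero]
      | zero => simp
      | add u v _ _ hu hv => rw [map_add, hu, hv, map_add]
    exact (LinearMap.congr_fun this x.1).symm

/-- A module with a tensor pair is a subquotient of the tensor module. -/
theorem exists_subquotient (h : HVData X 0 0 0 lam p) (T : TensorPair X lam p b d φ φ' K) :
    ∃ (W : Submodule ℂ HVCar) (θ : HVCar →ₗ[ℂ] M),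
      (∀ g i, ∀ w ∈ W, hvAct lam b d g i w ∈ W) ∧ (∀ w ∈ W, hvEven w ∈ W) ∧ W.map θ = ⊤ ∧
      (∀ w ∈ W, ∀ g i, θ (hvAct lam b d g i w) = X g i (θ w)) ∧
      ∀ w ∈ W, θ (hvEven w) = p (θ w) := by
  set 𝒟 := graphSub X lam b d φ φ' K with h𝒟
  have hinv := h.graphSub_invariant T
  have heven : ∀ x ∈ 𝒟, prodEven p x ∈ 𝒟 := fun x hx => h.graphSub_even T hx
  obtain ⟨Φ, hΦ, hcoeff⟩ := h.graphSub_coeff T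
  obtain ⟨k, hk, v, hv, hφv⟩ := T.ne K
  have hN : ∀ m : M, (m, (0 : HVCar)) ∈ 𝒟 → m = 0 := by
    rcases h.simple (𝒟.comap (LinearMap.inl ℂ M HVCar))
      (fun g i m hm => by
        have := hinv g i _ hm
        simpa [prodAct] using this)
      (fun m hm => by
        have := heven _ hm
        simpa [prodEven] using this) with h0 | h1
    · intro m hm
      exact (Submodule.mem_bot ℂ).1 (h0 ▸ hm)
    · have hv0 : (v, (0 : HVCar)) ∈ 𝒟 :=
        (h1 ▸ Submodule.mem_top : v ∈ 𝒟.comap (LinearMap.inl ℂ M HVCar))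
      have := hcoeff _ hv0 k hk 0
      rw [hΦ k v hv] at this
      exact absurd this.symm hφv
  have hfst : 𝒟.map (LinearMap.fst ℂ M HVCar) = ⊤ := by
    refine (h.simple _ ?_ ?_).resolve_left fun h0 => ?_
    · rintro g i _ ⟨x, hx, rfl⟩
      exact ⟨_, hinv g i x hx, rfl⟩
    · rintro _ ⟨x, hx, rfl⟩
      exact ⟨_, heven x hx, rfl⟩
    · have hx : (v, tensorMap φ φ' k v) ∈ 𝒟 := subset_stableClosure ⟨k, hk, hv, rfl⟩
      have : v ∈ 𝒟.map (LinearMap.fst ℂ M HVCar) := ⟨_, hx, rfl⟩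
      rw [h0, Submodule.mem_bot] at this
      exact hφv (by rw [this, map_zero])
  let f : 𝒟 →ₗ[ℂ] HVCar := LinearMap.snd ℂ M HVCar ∘ₗ 𝒟.subtype
  have hf : LinearMap.ker f = ⊥ := by
    rw [LinearMap.ker_eq_bot']
    rintro ⟨⟨m, w⟩, hx⟩ hw
    obtain rfl : w = 0 := hw
    have := hN m hx
    subst this
    rfl
  obtain ⟨ℓ, hℓ⟩ := LinearMap.exists_leftInverse_of_injective (K := ℂ) (V := 𝒟) (V' := HVCar) f hf
  set θ : HVCar →ₗ[ℂ] M := LinearMap.fst ℂ M HVCar ∘ₗ 𝒟.subtype ∘ₗ ℓ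
  have hθ : ∀ x ∈ 𝒟, θ x.2 = x.1 := by
    intro x hx
    have : ℓ x.2 = ⟨x, hx⟩ := LinearMap.congr_fun hℓ ⟨x, hx⟩
    change ((ℓ x.2 : 𝒟) : M × HVCar).1 = x.1
    rw [this]
  refine ⟨𝒟.map (LinearMap.snd ℂ M HVCar), θ, ?_, ?_, ?_, ?_, ?_⟩
  · rintro g i _ ⟨x, hx, rfl⟩
    exact ⟨_, hinv g i x hx, rfl⟩
  · rintro _ ⟨x, hx, rfl⟩
    exact ⟨_, heven x hx, rfl⟩
  · rw [eq_top_iff, ← hfst]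
    rintro _ ⟨x, hx, rfl⟩
    exact ⟨x.2, ⟨x, hx, rfl⟩, hθ x hx⟩
  · rintro _ ⟨x, hx, rfl⟩ g i
    exact (hθ _ (hinv g i x hx)).trans (congrArg (X g i) (hθ x hx).symm)
  · rintro _ ⟨x, hx, rfl⟩
    exact (hθ _ (heven x hx)).trans (congrArg p (hθ x hx).symm)

end HVData

section parity
variable {M : Type} [AddCommGroup M] [Module ℂ M] {gr : Fin 2 → Submodule ℂ M}

/-- `p` is the projection onto the even part of a graded space. -/
structure IsEvenProj (gr : Fin 2 → Submodule ℂ M) (p : End ℂ M) : Prop where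
  mem : ∀ v, p v ∈ gr 0
  sub_mem : ∀ v, v - p v ∈ gr 1
  even : ∀ v ∈ gr 0, p v = v
  odd : ∀ v ∈ gr 1, p v = 0

lemma exists_isEvenProj (hgr : DirectSum.IsInternal gr) : ∃ p, IsEvenProj gr p := by
  have hc : IsCompl (gr 0) (gr 1) := hgr.isCompl (by decide) (by ext q; fin_cases q <;> simp)
  set p : End ℂ M := LinearMap.ofIsCompl hc (gr 0).subtype 0
  have h0 : ∀ v ∈ gr 0, p v = v := fun v hv => LinearMap.ofIsCompl_apply_left hc ⟨v, hv⟩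
  have h1 : ∀ v ∈ gr 1, p v = 0 := fun v hv => LinearMap.ofIsCompl_apply_right hc ⟨v, hv⟩
  have key : ∀ v, p v ∈ gr 0 ∧ v - p v ∈ gr 1 := by
    intro v
    obtain ⟨x, hx, y, hy, rfl⟩ := Submodule.mem_sup.1
      (hc.sup_eq_top ▸ Submodule.mem_top : v ∈ gr 0 ⊔ gr 1)
    rw [map_add, h0 x hx, h1 y hy, add_zero, add_sub_cancel_left]
    exact ⟨hx, hy⟩
  exact ⟨p, fun v => (key v).1, fun v => (key v).2, h0, h1⟩

namespace IsEvenProj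
variable {p : End ℂ M} (hp : IsEvenProj gr p)
include hp

lemma comm_even {f : End ℂ M} (hf : MapsGr gr 0 f) (v : M) : p (f v) = f (p v) := by
  have h0 : f (p v) ∈ gr 0 := hf 0 ⟨_, hp.mem v, rfl⟩
  have h1 : f (v - p v) ∈ gr 1 := hf 1 ⟨_, hp.sub_mem v, rfl⟩
  rw [← hp.even _ h0, ← sub_eq_zero, ← map_sub, ← map_sub, hp.odd _ h1]

lemma comm_odd {f : End ℂ M} (hf : MapsGr gr 1 f) (v : M) : p (f v) = f (v - p v) := by
  have h0 : f (v - p v) ∈ gr 0 := hf 1 ⟨_, hp.sub_mem v, rfl⟩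
  have h1 : f (p v) ∈ gr 1 := hf 0 ⟨_, hp.mem v, rfl⟩
  rw [← hp.even _ h0, ← sub_eq_zero, ← map_sub, ← map_sub, sub_sub_cancel, hp.odd _ h1]

lemma gradedSub {N : Submodule ℂ M} (hN : ∀ v ∈ N, p v ∈ N) : GradedSub gr N := fun v hv =>
  Submodule.mem_sup.2 ⟨p v, ⟨hN v hv, hp.mem v⟩, v - p v, ⟨N.sub_mem hv (hN v hv), hp.sub_mem v⟩,
    add_sub_cancel _ _⟩

end IsEvenProj

lemma isEvenProj_hvEven : IsEvenProj hvGr hvEven where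
  mem v := by
    rw [hvGr, Finsupp.mem_supported']
    rintro ⟨k, r⟩ hr
    exact (hvEven_apply v k r).trans (if_neg hr)
  sub_mem v := by
    rw [hvGr, Finsupp.mem_supported']
    rintro ⟨k, r⟩ hr
    have : r = 0 := by
      have : r ≠ 1 := hr
      omega
    rw [Finsupp.sub_apply, hvEven_apply, if_pos this, sub_self]
  even v hv := by
    rw [hvGr, Finsupp.mem_supported'] at hv
    ext ⟨k, r⟩
    rw [hvEven_apply]
    split_ifs with hr
    · rfl
    · exact (hv (k, r) hr).symm
  odd v hv := by
    rw [hvGr, Finsupp.mem_supported'] at hv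
    ext ⟨k, r⟩
    rw [hvEven_apply]
    split_ifs with hr
    · exact hv (k, r) (by rw [hr]; exact zero_ne_one)
    · rfl

end parity

section
variable {M : Type} [AddCommGroup M] [Module ℂ M] {L H G Q : ℤ → End ℂ M} {CL CLa Ca : End ℂ M}
  {gr : Fin 2 → Submodule ℂ M}

/-- The operators of a module as a single family. -/
def hvFam (L H G Q : ℤ → End ℂ M) : HVGen → ℤ → End ℂ M
  | .L => L
  | .H => H
  | .G => G
  | .Q => Q

lemma invariantUnder_sOps {N : Submodule ℂ M} (hN : ∀ g i, ∀ v ∈ N, hvFam L H G Q g i v ∈ N)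
    (h1 : ∀ v ∈ N, CL v ∈ N) (h2 : ∀ v ∈ N, CLa v ∈ N) (h3 : ∀ v ∈ N, Ca v ∈ N) :
    InvariantUnder (sOps L H G Q CL CLa Ca) N := by
  rintro f hf _ ⟨v, hv, rfl⟩
  rcases hf with (((⟨i, rfl⟩ | ⟨i, rfl⟩) | ⟨i, rfl⟩) | ⟨i, rfl⟩) | (rfl | rfl | rfl)
  · exact hN .L i v hv
  · exact hN .H i v hv
  · exact hN .G i v hv
  · exact hN .Q i v hv
  · exact h1 v hv
  · exact h2 v hv
  · exact h3 v hv

lemma InvariantUnder.hvFam_mem {N : Submodule ℂ M}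
    (hN : InvariantUnder (sOps L H G Q CL CLa Ca) N) (g : HVGen) (i : ℤ) (v : M) (hv : v ∈ N) :
    hvFam L H G Q g i v ∈ N := by
  cases g
  · exact hN _ (.inl (.inl (.inl (.inl ⟨i, rfl⟩)))) ⟨v, hv, rfl⟩
  · exact hN _ (.inl (.inl (.inl (.inr ⟨i, rfl⟩)))) ⟨v, hv, rfl⟩
  · exact hN _ (.inl (.inl (.inr ⟨i, rfl⟩))) ⟨v, hv, rfl⟩
  · exact hN _ (.inl (.inr ⟨i, rfl⟩)) ⟨v, hv, rfl⟩

lemma exists_weight (hsimple : IsSimpleRep (sOps L H G Q CL CLa Ca) gr)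
    (hHC : IsHarishChandra (L 0)) : ∃ lam : ℂ, (L 0).eigenspace lam ≠ ⊥ := by
  by_contra! h
  obtain ⟨v, hv⟩ := hsimple.1
  have := hHC.1
  rw [IsWeightMod, iSup_congr h, iSup_bot] at this
  exact hv ((Submodule.mem_bot ℂ).1 (this ▸ Submodule.mem_top))

/-- A central even operator acts as a scalar. -/
lemma central_scalar (hsimple : IsSimpleRep (sOps L H G Q CL CLa Ca) gr)
    (hHC : IsHarishChandra (L 0)) {p : End ℂ M} (hp : IsEvenProj gr p) {f : End ℂ M}
    (hf : ∀ i, f * L i = L i * f ∧ f * H i = H i * f ∧ f * G i = G i * f ∧ f * Q i = Q i * f)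
    (h1 : f * CL = CL * f) (h2 : f * CLa = CLa * f) (h3 : f * Ca = Ca * f)
    (hf0 : MapsGr gr 0 f) : ∃ z : ℂ, f = z • 1 := by
  obtain ⟨lam, hlam⟩ := exists_weight hsimple hHC
  have := hHC.2 lam
  have : Nontrivial ((L 0).eigenspace lam) := Submodule.nontrivial_iff_ne_bot.2 hlam
  have hm : ∀ v ∈ (L 0).eigenspace lam, f v ∈ (L 0).eigenspace lam := by
    intro v hv
    rw [Module.End.mem_eigenspace_iff] at hv ⊢
    rw [← Module.End.mul_apply, ← (hf 0).1, Module.End.mul_apply, hv, map_smul]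
  obtain ⟨z, hz⟩ := Module.End.exists_eigenvalue (f.restrict hm)
  obtain ⟨w, hw⟩ := hz.exists_hasEigenvector
  have hw1 : f w = z • (w : M) := congrArg Subtype.val hw.apply_eq_smul
  have hw0 : (w : M) ≠ 0 := fun h0 => hw.2 (Subtype.ext h0)
  have hcomm : ∀ {g : End ℂ M}, f * g = g * f → ∀ v ∈ f.eigenspace z, g v ∈ f.eigenspace z := by
    intro g hg v hv
    rw [Module.End.mem_eigenspace_iff] at hv ⊢
    rw [← Module.End.mul_apply, hg, Module.End.mul_apply, hv, map_smul]
  refine ⟨z, LinearMap.ext fun v => ?_⟩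
  have hX : ∀ g i, ∀ v ∈ f.eigenspace z, hvFam L H G Q g i v ∈ f.eigenspace z := by
    intro g i
    cases g
    · exact hcomm (hf i).1
    · exact hcomm (hf i).2.1
    · exact hcomm (hf i).2.2.1
    · exact hcomm (hf i).2.2.2
  rcases hsimple.2 (f.eigenspace z) (invariantUnder_sOps hX (hcomm h1) (hcomm h2)
    (hcomm h3)) (hp.gradedSub (hcomm (LinearMap.ext fun v => (hp.comm_even hf0 v).symm)))
    with h0 | h0
  · exact absurd ((Submodule.mem_bot ℂ).1 (h0 ▸ Module.End.mem_eigenspace_iff.2 hw1)) hw0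
  · exact Module.End.mem_eigenspace_iff.1 (h0 ▸ Submodule.mem_top)

lemma exists_hvData (hrep : IsSRep L H G Q CL CLa Ca) (hsuper : IsSSuper gr L H G Q CL CLa Ca)
    (hsimple : IsSimpleRep (sOps L H G Q CL CLa Ca) gr) (hHC : IsHarishChandra (L 0)) :
    ∃ (c l a lam : ℂ) (p : End ℂ M), CL = c • 1 ∧ CLa = l • 1 ∧ Ca = a • 1 ∧ IsEvenProj gr p ∧
      HVData (hvFam L H G Q) c l a lam p := by
  obtain ⟨p, hp⟩ := exists_isEvenProj hsuper.internal
  obtain ⟨c, hc⟩ := central_scalar hsimple hHC hp hrep.central_CL.1 rfl hrep.central_CL.2.1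
    hrep.central_CL.2.2 hsuper.hCL
  obtain ⟨l, hl⟩ := central_scalar hsimple hHC hp hrep.central_CLa.1 hrep.central_CL.2.1.symm rfl
    hrep.central_CLa.2 hsuper.hCLa
  obtain ⟨a, ha⟩ := central_scalar hsimple hHC hp hrep.central_Ca hrep.central_CL.2.2.symm
    hrep.central_CLa.2.symm rfl hsuper.hCa
  obtain ⟨lam, hlam⟩ := exists_weight hsimple hHC
  subst hc hl ha
  have hrel : HVRel (hvFam L H G Q) c l a := ⟨hrep⟩
  have hs : ∀ N : Submodule ℂ M, (∀ g i, ∀ v ∈ N, hvFam L H G Q g i v ∈ N) →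
      (∀ v ∈ N, p v ∈ N) → N = ⊥ ∨ N = ⊤ := fun N hN hpN =>
    hsimple.2 N (invariantUnder_sOps hN (fun v hv => N.smul_mem c hv)
      (fun v hv => N.smul_mem l hv) fun v hv => N.smul_mem a hv) (hp.gradedSub hpN)
  obtain ⟨w, hw, hw0⟩ := Submodule.exists_mem_ne_zero_of_ne_bot hlam
  refine ⟨c, l, a, lam, p, rfl, rfl, rfl, hp, hrel, fun v => hp.even _ (hp.mem v),
    fun i => hp.comm_even (hsuper.hL i), fun i => hp.comm_even (hsuper.hH i),
    fun i => hp.comm_odd (hsuper.hG i), fun i => hp.comm_odd (hsuper.hQ i), hs,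
    ⟨w, hw0, Module.End.mem_eigenspace_iff.1 hw⟩, ?_, fun k => hHC.2 _⟩
  have hstable : ∀ f : End ℂ M, (∀ k : ℤ, ∃ n : ℤ, ∀ v ∈ (L 0).eigenspace (lam + k),
      f v ∈ (L 0).eigenspace (lam + n)) → ∀ v ∈ ⨆ k : ℤ, (L 0).eigenspace (lam + k),
      f v ∈ ⨆ k : ℤ, (L 0).eigenspace (lam + k) := by
    intro f hf v hv
    suffices hle : ⨆ k : ℤ, (L 0).eigenspace (lam + k) ≤
        (⨆ k : ℤ, (L 0).eigenspace (lam + k)).comap f from hle hv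
    refine iSup_le fun k v hv => ?_
    obtain ⟨n, hn⟩ := hf k
    exact Submodule.mem_iSup_of_mem n (hn v hv)
  refine (hs (⨆ k : ℤ, (L 0).eigenspace (lam + k)) (fun g i => hstable _ fun k => ⟨k + i, ?_⟩)
    (hstable _ fun k => ⟨k, ?_⟩)).resolve_left fun h0 => ?_
  · intro v hv
    rw [Module.End.mem_eigenspace_iff] at hv ⊢
    refine (hrel.L0X g i v).trans ?_
    change hvFam L H G Q g i (L 0 v) + _ = _
    rw [hv, map_smul]
    push_cast
    module
  · intro v hv
    rw [Module.End.mem_eigenspace_iff] at hv ⊢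
    rw [← hp.comm_even (hsuper.hL 0), hv, map_smul]
  · have : w ∈ ⨆ k : ℤ, (L 0).eigenspace (lam + k) :=
      Submodule.mem_iSup_of_mem 0 (by simpa using hw)
    rw [h0, Submodule.mem_bot] at this
    exact hw0 this

lemma invariantUnder_hvOps {lam b d : ℂ} {W : Submodule ℂ HVCar}
    (hW : ∀ g i, ∀ w ∈ W, hvAct lam b d g i w ∈ W) : InvariantUnder (hvOps lam b d) W := by
  rintro f hf _ ⟨v, hv, rfl⟩
  rcases hf with ((⟨i, rfl⟩ | ⟨i, rfl⟩) | ⟨i, rfl⟩) | ⟨i, rfl⟩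
  · exact hW .L i v hv
  · exact hW .G i v hv
  · exact hW .H i v hv
  · exact hW .Q i v hv

end

end

/-- **Statement 19.** Let `M` be a simple Harish-Chandra module over the `N = 1`
Heisenberg–Virasoro algebra `S`.  Then `M` is a highest weight module, a lowest
weight module, or isomorphic to `Γ'(λ, b, d)` or `Π(Γ'(λ, b, d))` for some
`λ, b, d ∈ ℂ`, where `Γ'(λ, b, d)` is the unique nontrivial simple sub-quotient
of `Γ(λ, b, d)`.  (Being isomorphic to a nontrivial simple sub-quotient of
`Γ(λ, b, d)` is encoded by an invariant graded subspace `W ⊆ Γ(λ, b, d)` and a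
linear map `θ` which is equivariant on `W` and maps `W` onto `M`; `θ` preserves
parity for `Γ'` and reverses it for `Π(Γ')`.  The central elements act by zero
on `Γ(λ, b, d)`.) -/
theorem simple_HC_module_classification_HeisenbergVirasoro
    (M : Type) [AddCommGroup M] [Module ℂ M]
    (L H G Q : ℤ → End ℂ M) (CL CLa Ca : End ℂ M)
    (gr : Fin 2 → Submodule ℂ M)
    (hrep : IsSRep L H G Q CL CLa Ca)
    (hsuper : IsSSuper gr L H G Q CL CLa Ca)
    (hsimple : IsSimpleRep (sOps L H G Q CL CLa Ca) gr)
    (hHC : IsHarishChandra (L 0)) :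
    IsHighestWeightS L H G Q CL CLa Ca ∨ IsLowestWeightS L H G Q CL CLa Ca ∨
    ∃ (lam b d : ℂ) (W : Submodule ℂ HVCar),
      InvariantUnder (hvOps lam b d) W ∧ GradedSub hvGr W ∧
      ∃ θ : HVCar →ₗ[ℂ] M,
        W.map θ = ⊤ ∧
        (∀ w ∈ W, ∀ i : ℤ,
          θ (hvL lam b i w) = L i (θ w) ∧
          θ (hvG lam b i w) = G i (θ w) ∧
          θ (hvH d i w) = H i (θ w) ∧
          θ (hvQ d i w) = Q i (θ w)) ∧
        (∀ w ∈ W, CL (θ w) = 0 ∧ CLa (θ w) = 0 ∧ Ca (θ w) = 0) ∧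
        ((∀ q, ∀ w ∈ W ⊓ hvGr q, θ w ∈ gr q) ∨
         (∀ q, ∀ w ∈ W ⊓ hvGr q, θ w ∈ gr (q + 1))) := by
  obtain ⟨c, l, a, lam, p, rfl, rfl, rfl, hp, h⟩ := exists_hvData hrep hsuper hsimple hHC
  rcases h.trichotomy with ⟨v, hv, hkill, hL, hH, hgen⟩ | ⟨v, hv, hkill, hL, hH, hgen⟩ |
    ⟨⟨C, hC⟩, hne⟩
  · exact .inl ⟨v, hv, fun i hi => ⟨hkill .L i (by omega), hkill .H i (by omega),
      hkill .G i (by omega), hkill .Q i (by omega)⟩, hL, hH, ⟨c, rfl⟩, ⟨l, rfl⟩, ⟨a, rfl⟩,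
      fun N hN => hgen N fun g i => hN.hvFam_mem g i⟩
  · exact .inr (.inl ⟨v, hv, fun i hi => ⟨hkill .L i (by omega), hkill .H i (by omega),
      hkill .G i (by omega), hkill .Q i (by omega)⟩, hL, hH, ⟨c, rfl⟩, ⟨l, rfl⟩, ⟨a, rfl⟩,
      fun N hN => hgen N fun g i => hN.hvFam_mem g i⟩)
  · obtain ⟨rfl, rfl, rfl, p', b, d, φ, φ', K, hp', T⟩ := h.exists_tensorPair hC hne
    have h' : HVData (hvFam L H G Q) 0 0 0 lam p' := by
      rcases hp' with rfl | rfl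
      · exact h
      · exact h.flip
    obtain ⟨W, θ, hW, hWe, hθ, hact, hpar⟩ := h'.exists_subquotient T
    refine .inr (.inr ⟨lam, b, d, W, invariantUnder_hvOps hW, isEvenProj_hvEven.gradedSub hWe, θ,
      hθ, fun w hw i => ⟨hact w hw .L i, hact w hw .G i, hact w hw .H i, hact w hw .Q i⟩,
      fun w hw => by simp, ?_⟩)
    have heven : ∀ w ∈ W ⊓ hvGr 0, p' (θ w) = θ w := fun w hw => by
      rw [← hpar w hw.1, isEvenProj_hvEven.even w hw.2]
    have hodd : ∀ w ∈ W ⊓ hvGr 1, p' (θ w) = 0 := fun w hw => by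
      rw [← hpar w hw.1, isEvenProj_hvEven.odd w hw.2, map_zero]
    rcases hp' with rfl | rfl
    · refine .inl (Fin.forall_fin_two.2 ⟨fun w hw => ?_, fun w hw => ?_⟩)
      · rw [← heven w hw]; exact hp.mem _
      · have := hp.sub_mem (θ w)
        rwa [hodd w hw, sub_zero] at this
    · refine .inr (Fin.forall_fin_two.2 ⟨fun w hw => ?_, fun w hw => ?_⟩)
      · rw [← heven w hw]; exact hp.sub_mem _
      · have := hodd w hw
        rw [LinearMap.sub_apply, Module.End.one_apply, sub_eq_zero] at this
        rw [this]; exact hp.mem _
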